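/- Let K ⊂ ℚ̄ be a number field, f an E-function with Taylor coefficients in K, and α ∈ K. Then either f(α) ∈ K or f(α) is transcendental. -/

import Mathlib

noncomputable section

/-- The derivative `d/dz` of a formal power series over `ℂ`. -/
def psD (f : PowerSeries ℂ) : PowerSeries ℂ :=
  PowerSeries.mk fun n => ((n : ℂ) + 1) * PowerSeries.coeff (n + 1) f

/-- The Mahler operator `σ_q : f(z) ↦ f(z^q)` on formal power series over `ℂ`. -/
def psSigma (q : ℕ) (f : PowerSeries ℂ) : PowerSeries ℂ :=
  PowerSeries.mk fun n => if q ∣ n then PowerSeries.coeff (n / q) f else 0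

/-- The canonical embedding of polynomials into power series. -/
def polyPS : Polynomial ℂ →+* PowerSeries ℂ := Polynomial.coeToPowerSeries.ringHom

/-- The power series `∑ (a n / n!) zⁿ` attached to a sequence `a` of coefficients. -/
def ePS (a : ℕ → ℂ) : PowerSeries ℂ := PowerSeries.mk fun n => a n / (n.factorial : ℂ)

/-- `IsE a` : the power series `∑ (a n / n!) zⁿ` is an E-function: its coefficients are
algebraic, it satisfies a nonzero linear differential equation over `ℚ̄[z]`, and the size of
the conjugates of the `a n` as well as their common denominators grow at most geometrically. -/
def IsE (a : ℕ → ℂ) : Prop :=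
  (∀ n, IsAlgebraic ℚ (a n)) ∧
  (∃ (m : ℕ) (p : ℕ → Polynomial ℂ),
      (∀ i k, IsAlgebraic ℚ ((p i).coeff k)) ∧ (∃ i, i ≤ m ∧ p i ≠ 0) ∧
      ∑ i ∈ Finset.range (m + 1), polyPS (p i) * psD^[i] (ePS a) = 0) ∧
  (∃ C : ℝ, 0 < C ∧ ∃ d : ℕ → ℕ, ∀ n : ℕ, 1 ≤ n →
      1 ≤ d n ∧ (d n : ℝ) ≤ C ^ n ∧
      (∀ σ : (integralClosure ℚ ℂ) →+* ℂ, ∀ h : a n ∈ integralClosure ℚ ℂ,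
        ‖σ ⟨a n, h⟩‖ ≤ C ^ n) ∧
      (∀ i, 1 ≤ i → i ≤ n → IsIntegral ℤ ((d n : ℂ) * a i)))

/-- The value at `α` of the E-function with coefficient sequence `a`
(E-functions are entire, so this series converges for all `α`). -/
def evalE (a : ℕ → ℂ) (α : ℂ) : ℂ := ∑' n : ℕ, a n / (n.factorial : ℂ) * α ^ n

/-- `IsM q f` : the formal power series `f` is an M_q-function, i.e. it has algebraic
coefficients and satisfies a linear `σ_q`-difference equation over `ℚ̄[z]` with
not-all-zero polynomial coefficients. -/
def IsM (q : ℕ) (f : PowerSeries ℂ) : Prop :=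
  (∀ n, IsAlgebraic ℚ (PowerSeries.coeff n f)) ∧
  ∃ (m : ℕ) (p : ℕ → Polynomial ℂ),
    (∀ i k, IsAlgebraic ℚ ((p i).coeff k)) ∧ (∃ i, i ≤ m ∧ p i ≠ 0) ∧
    ∑ i ∈ Finset.range (m + 1), polyPS (p i) * (psSigma q)^[i] f = 0

/-- `MahlerValue f α v` : the meromorphic extension of (the sum of) the power series `f`
to the open unit disk has no pole at `α` and takes the value `v` there. -/
def MahlerValue (f : PowerSeries ℂ) (α v : ℂ) : Prop :=
  ∃ F : ℂ → ℂ, MeromorphicOn F (Metric.ball (0 : ℂ) 1) ∧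
    (∀ᶠ z in nhds (0 : ℂ), HasSum (fun n => PowerSeries.coeff n f * z ^ n) (F z)) ∧
    AnalyticAt ℂ F α ∧ F α = v

/-- The power series `f` converges (hence defines an analytic function) on the open
disk `D(0,R)`. -/
def AnOnBall (f : PowerSeries ℂ) (R : ℝ) : Prop :=
  ∀ z : ℂ, ‖z‖ < R → Summable fun n => PowerSeries.coeff n f * z ^ n

/-- The value at `z` of (the sum of) the power series `f`. -/
def psEval (f : PowerSeries ℂ) (z : ℂ) : ℂ := ∑' n : ℕ, PowerSeries.coeff n f * z ^ n

/-- `Banal fv α P` : the homogeneous algebraic relation `P` among the values at `α` of the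
power series `fv 1, …, fv r` is banal: it is the specialization at `z = α` of some
`Q ∈ ℚ̄[z, X₁, …, X_r]`, homogeneous in `X₁, …, X_r`, with `Q(z, fv 1, …, fv r) = 0`. -/
def Banal {r : ℕ} (fv : Fin r → PowerSeries ℂ) (α : ℂ) (P : MvPolynomial (Fin r) ℂ) : Prop :=
  ∃ Q : MvPolynomial (Fin r) (Polynomial ℂ),
    (∀ v k, IsAlgebraic ℚ ((MvPolynomial.coeff v Q).coeff k)) ∧
    (∃ e, Q.IsHomogeneous e) ∧
    MvPolynomial.eval₂ polyPS fv Q = 0 ∧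
    MvPolynomial.map (Polynomial.evalRingHom α) Q = P

/-- `Eset S` : the set of values at `z = 1` of all E-functions with coefficients in `S`. -/
def Eset (S : Set ℂ) : Set ℂ :=
  {x | ∃ a : ℕ → ℂ, IsE a ∧ (∀ n, a n ∈ S) ∧ x = evalE a 1}

/-- `Mset q α S` : the set of values at `α` of all M_q-functions with coefficients in `S`
having no pole at `α`. -/
def Mset (q : ℕ) (α : ℂ) (S : Set ℂ) : Set ℂ :=
  {x | ∃ f : PowerSeries ℂ, IsM q f ∧ (∀ n, PowerSeries.coeff n f ∈ S) ∧ MahlerValue f α x}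

namespace EFun
open Polynomial

/-- Formal Laurent series over `ℚ`. -/
abbrev Lau := LaurentSeries ℚ

/-- Rational functions over `ℚ`. -/
def Rat1 := RatFunc ℚ

instance : Field Rat1 := inferInstanceAs (Field (RatFunc ℚ))

instance : CharZero Rat1 := inferInstanceAs (CharZero (RatFunc ℚ))

instance : Algebra ℚ[X] Rat1 := inferInstanceAs (Algebra ℚ[X] (RatFunc ℚ))

instance : IsFractionRing ℚ[X] Rat1 := inferInstanceAs (IsFractionRing ℚ[X] (RatFunc ℚ))

/-- The Euler operator `x d/dx` on Laurent series. -/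
def eulerOp (f : Lau) : Lau where
  coeff n := (n : ℚ) * f.coeff n
  isPWO_support' := f.isPWO_support.mono fun n hn h => hn (by simp [h])

@[simp] lemma eulerOp_coeff (f : Lau) (n : ℤ) : (eulerOp f).coeff n = (n : ℚ) * f.coeff n := rfl

lemma eulerOp_mul (f g : Lau) : eulerOp (f * g) = f * eulerOp g + g * eulerOp f := by
  ext n
  rw [mul_comm g, HahnSeries.coeff_add, eulerOp_coeff, HahnSeries.coeff_mul,
    HahnSeries.coeff_mul_left' (x := eulerOp f) f.isPWO_support (fun n hn h => hn (by simp [h])),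
    HahnSeries.coeff_mul_right' (y := eulerOp g) g.isPWO_support (fun n hn h => hn (by simp [h])),
    Finset.mul_sum, ← Finset.sum_add_distrib]
  refine Finset.sum_congr rfl fun ij hij => ?_
  have h : ij.1 + ij.2 = n := (Finset.mem_antidiagonal.1 hij).2.2
  rw [← h]
  simp only [eulerOp_coeff]
  push_cast
  ring

/-- The derivation `d/dx` on Laurent series. -/
def D : Lau →+ Lau := AddMonoidHom.mk' (fun f => HahnSeries.single (-1) 1 * eulerOp f) fun f g => by
  rw [← mul_add]
  congr 1
  ext n
  simp [mul_add]

lemma D_mul (f g : Lau) : D (f * g) = D f * g + f * D g := by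
  change HahnSeries.single (-1) 1 * eulerOp (f * g) = (HahnSeries.single (-1) 1 * eulerOp f) * g +
    f * (HahnSeries.single (-1) 1 * eulerOp g)
  rw [eulerOp_mul]
  ring

lemma D_coeff (f : Lau) (n : ℤ) : (D f).coeff n = ((n : ℚ) + 1) * f.coeff (n + 1) := by
  have h := HahnSeries.coeff_single_mul_add (r := (1:ℚ)) (x := eulerOp f) (a := n + 1) (b := -1)
  rw [show n + 1 + -1 = n by ring] at h
  refine h.trans ?_
  simp

lemma D_one : D 1 = 0 := by
  have h := D_mul 1 1
  rw [mul_one, mul_one, one_mul] at h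
  simpa using h

lemma D_div (f g : Lau) (hg : g ≠ 0) : D (f / g) = (D f * g - f * D g) / g ^ 2 := by
  have h := D_mul (f / g) g
  rw [div_mul_cancel₀ _ hg] at h
  rw [h]
  field_simp
  ring

lemma D_iterate_coeff (k : ℕ) (f : Lau) (n : ℤ) :
    (D^[k] f).coeff n = (∏ i ∈ Finset.range k, ((n : ℚ) + k - i)) * f.coeff (n + k) := by
  induction k generalizing f n with
  | zero => simp
  | succ k ih =>
    rw [Function.iterate_succ_apply, ih, D_coeff, Finset.prod_range_succ']
    push_cast
    rw [show n + ((k:ℤ) + 1) = n + k + 1 by ring, ← mul_assoc]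
    congr 1
    congr 1
    · refine Finset.prod_congr rfl fun i _ => by ring
    · ring

lemma D_coe (f : PowerSeries ℚ) : D (f : Lau) = ((PowerSeries.derivative ℚ f : PowerSeries ℚ) : Lau) := by
  ext n
  rw [D_coeff]
  rcases lt_or_ge n 0 with h | h
  · rcases lt_or_eq_of_le (show n + 1 ≤ 0 by lia) with h1 | h1
    · rw [PowerSeries.coeff_coe, PowerSeries.coeff_coe, if_pos h1, if_pos h, mul_zero]
    · rw [PowerSeries.coeff_coe _ n, if_pos h, show n = -1 by lia]; simp
  · lift n to ℕ using h
    rw [show ((n:ℤ) + 1) = ((n+1 : ℕ) : ℤ) by simp, LaurentSeries.coeff_coe_powerSeries, LaurentSeries.coeff_coe_powerSeries, PowerSeries.coeff_derivative]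
    push_cast; ring

/-- Polynomials as Laurent series. -/
abbrev pl : ℚ[X] →+* Lau := algebraMap ℚ[X] Lau

lemma pl_eq (p : ℚ[X]) : pl p = ((p : PowerSeries ℚ) : Lau) := by
  rfl

lemma pl_injective : Function.Injective pl := by
  intro p q h
  rw [pl_eq, pl_eq] at h
  exact Polynomial.coe_injective ℚ (HahnSeries.ofPowerSeries_injective h)

instance : Algebra Rat1 Lau := (IsFractionRing.lift (K := Rat1) pl_injective).toAlgebra

instance : IsScalarTower ℚ[X] Rat1 Lau :=
  IsScalarTower.of_algebraMap_eq fun p => (IsFractionRing.lift_algebraMap pl_injective p).symm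

lemma algebraMap_div (p q : ℚ[X]) :
    algebraMap Rat1 Lau (algebraMap _ _ p / algebraMap _ _ q) = pl p / pl q := by
  rw [map_div₀, ← IsScalarTower.algebraMap_apply, ← IsScalarTower.algebraMap_apply]

lemma D_pl (p : ℚ[X]) : D (pl p) = pl (derivative p) := by
  rw [pl_eq, D_coe, pl_eq]
  congr 1
  exact PowerSeries.derivative_coe p

lemma pl_coeff_nat (p : ℚ[X]) (n : ℕ) : (pl p).coeff n = p.coeff n := by
  rw [pl_eq, LaurentSeries.coeff_coe_powerSeries, Polynomial.coeff_coe]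

lemma exists_D_rat (c : Rat1) : ∃ c' : Rat1, D (algebraMap Rat1 Lau c) = algebraMap Rat1 Lau c' := by
  obtain ⟨p, q, hq, rfl⟩ := IsFractionRing.div_surjective (A := ℚ[X]) c
  · have hq' : pl q ≠ 0 := by simpa using pl_injective.ne (nonZeroDivisors.ne_zero hq)
    refine ⟨algebraMap ℚ[X] Rat1 (derivative p * q - p * derivative q) / algebraMap ℚ[X] Rat1 (q ^ 2), ?_⟩
    rw [algebraMap_div, algebraMap_div]
    rw [D_div _ _ hq', D_pl, D_pl]
    simp only [map_sub, map_mul, map_pow]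

/-- The derivation `d/dx` on rational functions. -/
def dr (c : Rat1) : Rat1 := (exists_D_rat c).choose

lemma D_algebraMap (c : Rat1) : D (algebraMap Rat1 Lau c) = algebraMap Rat1 Lau (dr c) :=
  (exists_D_rat c).choose_spec

lemma D_smul (c : Rat1) (f : Lau) : D (c • f) = dr c • f + c • D f := by
  rw [Algebra.smul_def, D_mul, D_algebraMap, Algebra.smul_def, Algebra.smul_def]

/-- A Laurent series is holonomic if it lies in a finite-dimensional `ℚ(x)`-subspace which is
stable under differentiation. -/
def Hol (f : Lau) : Prop :=
  ∃ V : Submodule Rat1 Lau, Module.Finite Rat1 V ∧ (∀ v ∈ V, D v ∈ V) ∧ f ∈ V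

lemma Hol.add {f g : Lau} (hf : Hol f) (hg : Hol g) : Hol (f + g) := by
  obtain ⟨V, hV, hD, hf⟩ := hf
  obtain ⟨W, hW, hE, hg⟩ := hg
  refine ⟨V ⊔ W, inferInstance, fun v hv => ?_, add_mem (Submodule.mem_sup_left hf) (Submodule.mem_sup_right hg)⟩
  obtain ⟨a, ha, b, hb, rfl⟩ := Submodule.mem_sup.1 hv
  rw [map_add]
  exact add_mem (Submodule.mem_sup_left (hD a ha)) (Submodule.mem_sup_right (hE b hb))

lemma Hol.mul {f g : Lau} (hf : Hol f) (hg : Hol g) : Hol (f * g) := by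
  obtain ⟨V, hV, hD, hf⟩ := hf
  obtain ⟨W, hW, hE, hg⟩ := hg
  refine ⟨V * W, Module.Finite.iff_fg.2 ((Module.Finite.iff_fg.1 hV).mul (Module.Finite.iff_fg.1 hW)), fun v hv => ?_,
    Submodule.mul_mem_mul hf hg⟩
  induction hv using Submodule.mul_induction_on' with
  | mem_mul_mem a ha b hb =>
    rw [D_mul]
    exact add_mem (Submodule.mul_mem_mul (hD a ha) hb) (Submodule.mul_mem_mul ha (hE b hb))
  | add a _ b _ h1 h2 => rw [map_add]; exact add_mem h1 h2

lemma hol_rat (c : Rat1) : Hol (algebraMap Rat1 Lau c) := by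
  refine ⟨Submodule.span Rat1 {1}, inferInstance, fun v hv => ?_, Submodule.mem_span_singleton.2 ⟨c, ?_⟩⟩
  · obtain ⟨a, rfl⟩ := Submodule.mem_span_singleton.1 hv
    rw [D_smul, D_one, smul_zero, add_zero]
    exact Submodule.mem_span_singleton.2 ⟨_, rfl⟩
  · rw [Algebra.smul_def, mul_one]

section StableSubspaces

variable {k V : Type*} [Field k] [AddCommGroup V] [Module k V] (δ : V →+ V) {d : k → k}

/-- The value at `v` of the differential operator `∑ L i δ^i`. -/
def opEval (L : ℕ →₀ k) (v : V) : V := Finsupp.linearCombination k (fun i => δ^[i] v) L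

lemma opEval_eq_sum (L : ℕ →₀ k) (v : V) : opEval δ L v = ∑ i ∈ L.support, L i • δ^[i] v := by
  simp [opEval, Finsupp.linearCombination_apply, Finsupp.sum]

lemma opEval_add (L : ℕ →₀ k) (v w : V) : opEval δ L (v + w) = opEval δ L v + opEval δ L w := by
  have h : ∀ i, δ^[i] (v + w) = δ^[i] v + δ^[i] w := fun i => iterate_map_add δ i v w
  simp only [opEval_eq_sum, h, smul_add, Finset.sum_add_distrib]

lemma iterate_mem {X : Submodule k V} (hX : ∀ x ∈ X, δ x ∈ X) {x : V} (hx : x ∈ X) (i : ℕ) :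
    δ^[i] x ∈ X := by
  induction i with
  | zero => exact hx
  | succ i ih => rw [Function.iterate_succ_apply']; exact hX _ ih

lemma opEval_mem {X : Submodule k V} (hX : ∀ x ∈ X, δ x ∈ X) {x : V} (hx : x ∈ X) (L : ℕ →₀ k) :
    opEval δ L x ∈ X := by
  rw [opEval_eq_sum]
  exact Submodule.sum_mem _ fun i _ => X.smul_mem _ (iterate_mem δ hX hx i)

lemma exists_annihilator [FiniteDimensional k V] (v : V) : ∃ L : ℕ →₀ k, L ≠ 0 ∧ opEval δ L v = 0 := by
  have h : ¬ LinearIndependent k (fun i : ℕ => δ^[i] v) := fun h => by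
    exact not_finite_iff_infinite.2 inferInstance h.finite_of_isNoetherian
  rw [linearIndependent_iff] at h
  push Not at h
  obtain ⟨L, h1, h2⟩ := h
  exact ⟨L, h2, h1⟩

lemma exists_operators_aux [FiniteDimensional k V] (X : Submodule k V) : (∀ x ∈ X, δ x ∈ X) →
    ∃ S : Finset (ℕ →₀ k), (∀ L ∈ S, L ≠ 0) ∧ ∀ V' : Submodule k V, (∀ v ∈ V', δ v ∈ V') → V' ≠ ⊥ →
      V' ⊓ X = ⊥ → ∃ v ∈ V', v ≠ 0 ∧ ∃ L ∈ S, opEval δ L v = 0 := by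
  induction X using WellFoundedGT.induction with
  | ind X ih =>
  intro hX
  by_cases htop : X = ⊤
  · refine ⟨∅, by simp, fun V' _ h1 h2 => (h1 ?_).elim⟩
    rwa [htop, inf_top_eq] at h2
  obtain ⟨Y, ⟨hY1, hY2⟩, hYmin⟩ := wellFounded_lt.has_min
    {Y : Submodule k V | (∀ x ∈ Y, δ x ∈ Y) ∧ X < Y} ⟨⊤, by simp, lt_top_iff_ne_top.2 htop⟩
  obtain ⟨S, hS0, hS⟩ := ih Y hY2 hY1
  obtain ⟨y, hyY, hyX⟩ := SetLike.exists_of_lt hY2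
  obtain ⟨L, hL0, hL⟩ := exists_annihilator (k := k) δ y
  classical
  refine ⟨insert L S, fun M hM => ?_, fun V' hV' h0 hVX => ?_⟩
  · rcases Finset.mem_insert.1 hM with rfl | h
    · exact hL0
    · exact hS0 _ h
  by_cases hVY : V' ⊓ Y = ⊥
  · obtain ⟨v, hv, hv0, M, hM, h⟩ := hS V' hV' h0 hVY
    exact ⟨v, hv, hv0, M, Finset.mem_insert_of_mem hM, h⟩
  have hst : ∀ x ∈ (V' ⊓ Y) ⊔ X, δ x ∈ (V' ⊓ Y) ⊔ X := by
    intro x hx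
    obtain ⟨a, ha, b, hb, rfl⟩ := Submodule.mem_sup.1 hx
    rw [map_add]
    exact add_mem (Submodule.mem_sup_left ⟨hV' _ ha.1, hY1 _ ha.2⟩) (Submodule.mem_sup_right (hX _ hb))
  have hle : (V' ⊓ Y) ⊔ X ≤ Y := sup_le inf_le_right hY2.le
  have hlt : X < (V' ⊓ Y) ⊔ X := by
    refine lt_of_le_of_ne le_sup_right fun h => hVY ?_
    have h1 : V' ⊓ Y ≤ X := by rw [h]; exact le_sup_left
    rw [eq_bot_iff, ← hVX]
    exact le_inf inf_le_left h1
  have heq : (V' ⊓ Y) ⊔ X = Y := by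
    by_contra hne
    exact hYmin _ ⟨hst, hlt⟩ (lt_of_le_of_ne hle hne)
  rw [← heq] at hyY
  obtain ⟨v, hv, x, hx, rfl⟩ := Submodule.mem_sup.1 hyY
  refine ⟨v, hv.1, fun h => hyX (by rw [h, zero_add]; exact hx), L, Finset.mem_insert_self _ _, ?_⟩
  have h1 : opEval δ L v ∈ V' ⊓ X := by
    refine ⟨opEval_mem δ hV' hv.1 L, ?_⟩
    rw [opEval_add] at hL
    rw [eq_neg_of_add_eq_zero_left hL]
    exact X.neg_mem (opEval_mem δ hX hx L)
  rwa [hVX, Submodule.mem_bot] at h1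

/-- There is a finite set of nonzero differential operators such that every nonzero stable subspace
contains a nonzero solution of one of them. -/
lemma exists_operators [FiniteDimensional k V] :
    ∃ S : Finset (ℕ →₀ k), (∀ L ∈ S, L ≠ 0) ∧ ∀ V' : Submodule k V, (∀ v ∈ V', δ v ∈ V') → V' ≠ ⊥ →
      ∃ v ∈ V', v ≠ 0 ∧ ∃ L ∈ S, opEval δ L v = 0 := by
  obtain ⟨S, h0, h⟩ := exists_operators_aux δ (⊥ : Submodule k V) (by simp)
  exact ⟨S, h0, fun V' h1 h2 => h V' h1 h2 (inf_bot_eq _)⟩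

lemma exists_dual_of_not_linearIndependent [FiniteDimensional k V]
    (hδ : ∀ (c : k) (v : V), δ (c • v) = d c • v + c • δ v) (u : V)
    (h : ¬ LinearIndependent k (fun i : Fin (Module.finrank k V) => δ^[i] u)) :
    ∃ φ : Module.Dual k V, φ ≠ 0 ∧ ∀ s, φ (δ^[s] u) = 0 := by
  have hm : ∃ m < Module.finrank k V,
      δ^[m] u ∈ Submodule.span k (Set.range fun i : Fin m => δ^[i] u) := by
    by_contra! hcon
    refine h ?_
    have : ∀ m ≤ Module.finrank k V, LinearIndependent k (fun i : Fin m => δ^[i] u) := by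
      intro m
      induction m with
      | zero => intro _; exact linearIndependent_empty_type
      | succ m ih =>
        intro hm
        rw [linearIndependent_finSucc']
        exact ⟨ih (by lia), by simpa [Fin.init_def] using hcon m (by lia)⟩
    exact this _ le_rfl
  obtain ⟨m, hm, hmem⟩ := hm
  set X := Submodule.span k (Set.range fun i : Fin m => δ^[i] u) with hX
  have hst : ∀ x ∈ X, δ x ∈ X := by
    intro x hx
    induction hx using Submodule.span_induction with
    | mem x hx =>
      obtain ⟨i, rfl⟩ := hx
      simp only
      rw [← Function.iterate_succ_apply' δ]
      rcases lt_or_eq_of_le (Nat.succ_le_of_lt i.2) with h | h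
      · exact Submodule.subset_span ⟨⟨_, h⟩, rfl⟩
      · rwa [h]
    | zero => simp
    | add x y _ _ h1 h2 => rw [map_add]; exact add_mem h1 h2
    | smul c x hx h1 => rw [hδ]; exact add_mem (X.smul_mem _ hx) (X.smul_mem _ h1)
  have hall : ∀ s, δ^[s] u ∈ X := by
    intro s
    rcases lt_or_ge s m with h | h
    · exact Submodule.subset_span ⟨⟨_, h⟩, rfl⟩
    · obtain ⟨r, rfl⟩ := Nat.exists_eq_add_of_le h
      rw [add_comm, Function.iterate_add_apply]
      exact iterate_mem δ hst hmem r
  have hlt : X < ⊤ := by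
    refine lt_top_iff_ne_top.2 fun h => ?_
    have h1 : Module.finrank k X ≤ m := by
      simpa [Set.finrank] using finrank_range_le_card (R := k) (fun i : Fin m => δ^[i] u)
    rw [h, finrank_top] at h1
    lia
  obtain ⟨φ, hφ, hk⟩ := Submodule.exists_le_ker_of_lt_top X hlt
  exact ⟨φ, hφ, fun s => hk (hall s)⟩

end StableSubspaces

section Orders

lemma coeff_mul_eq_zero {f g : Lau} {a b m : ℤ} (hf : ∀ m < a, f.coeff m = 0)
    (hg : ∀ m < b, g.coeff m = 0) (hm : m < a + b) : (f * g).coeff m = 0 := by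
  rw [HahnSeries.coeff_mul]
  refine Finset.sum_eq_zero fun ij hij => ?_
  have h : ij.1 + ij.2 = m := (Finset.mem_antidiagonal.1 hij).2.2
  rcases lt_or_ge ij.1 a with h1 | h1
  · rw [hf _ h1, zero_mul]
  · rw [hg _ (by lia), mul_zero]

lemma coeff_mul_add {f g : Lau} {a b : ℤ} (hf : ∀ m < a, f.coeff m = 0)
    (hg : ∀ m < b, g.coeff m = 0) : (f * g).coeff (a + b) = f.coeff a * g.coeff b := by
  rw [HahnSeries.coeff_mul]
  rw [Finset.sum_eq_single (a, b)]
  · intro ij hij hne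
    have h : ij.1 + ij.2 = a + b := (Finset.mem_antidiagonal.1 hij).2.2
    rcases lt_trichotomy ij.1 a with h1 | h1 | h1
    · rw [hf _ h1, zero_mul]
    · exact (hne (Prod.ext h1 (by simp only; lia))).elim
    · rw [hg _ (by lia), mul_zero]
  · intro h
    by_contra hne
    exact h (Finset.mem_antidiagonal.2 ⟨left_ne_zero_of_mul hne, right_ne_zero_of_mul hne, rfl⟩)

lemma exists_coeff_vanish (f : Lau) : ∃ a : ℤ, ∀ m < a, f.coeff m = 0 :=
  ⟨f.order, fun _ h => HahnSeries.coeff_eq_zero_of_lt_order h⟩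

lemma exists_coeff_vanish_finset {ι : Type*} (s : Finset ι) (f : ι → Lau) :
    ∃ a : ℤ, ∀ i ∈ s, ∀ m < a, (f i).coeff m = 0 := by
  classical
  induction s using Finset.induction_on with
  | empty => exact ⟨0, by simp⟩
  | insert i s _ ih =>
    obtain ⟨a, ha⟩ := ih
    obtain ⟨b, hb⟩ := exists_coeff_vanish (f i)
    refine ⟨min a b, fun j hj m hm => ?_⟩
    rcases Finset.mem_insert.1 hj with rfl | h
    · exact hb m (by lia)
    · exact ha j h m (by lia)

/-- The orders of the solutions of a nonzero linear differential equation lie in a finite set. -/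
lemma exists_orders (L : ℕ →₀ Lau) (hL : L ≠ 0) : ∃ S : Finset ℤ, ∀ v : Lau, v ≠ 0 →
    ∑ i ∈ L.support, L i * D^[i] v = 0 → v.order ∈ S := by
  obtain ⟨i0, hi0, hmin⟩ := L.support.exists_min_image (fun i => (L i).order - i)
    (Finsupp.support_nonempty_iff.2 hL)
  set μ := (L i0).order - i0 with hμ
  have hvan : ∀ i ∈ L.support, ∀ m < μ + i, (L i).coeff m = 0 := fun i hi m hm =>
    HahnSeries.coeff_eq_zero_of_lt_order (by have := hmin i hi; lia)
  set χ : ℚ[X] := ∑ i ∈ L.support, C ((L i).coeff (μ + i)) * descPochhammer ℚ i with hχ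
  have hχ0 : χ ≠ 0 := by
    set S := L.support.filter fun i => (L i).coeff (μ + i) ≠ 0 with hS
    have hSn : S.Nonempty := ⟨i0, Finset.mem_filter.2 ⟨hi0, by
      rw [hμ, sub_add_cancel]
      exact HahnSeries.coeff_order_eq_zero.not.2 (Finsupp.mem_support_iff.1 hi0)⟩⟩
    set j := S.max' hSn
    have hj : j ∈ S := S.max'_mem hSn
    have : χ.coeff j = (L j).coeff (μ + j) := by
      rw [hχ, finsetSum_coeff, Finset.sum_eq_single j]
      · rw [coeff_C_mul]
        have h1 : (descPochhammer ℚ j).coeff j = 1 := by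
          have := monic_descPochhammer ℚ j
          rwa [Monic, leadingCoeff, descPochhammer_natDegree] at this
        rw [h1, mul_one]
      · intro i hi hij
        rw [coeff_C_mul]
        by_cases h0 : (L i).coeff (μ + i) = 0
        · rw [h0, zero_mul]
        · have hle : i ≤ j := S.le_max' i (Finset.mem_filter.2 ⟨hi, h0⟩)
          rw [coeff_eq_zero_of_natDegree_lt, mul_zero]
          rw [descPochhammer_natDegree]
          lia
      · intro h
        exact (h (Finset.mem_filter.1 hj).1).elim
    intro h
    rw [h, coeff_zero] at this
    exact (Finset.mem_filter.1 hj).2 this.symm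
  refine ⟨(χ.roots.toFinset.preimage (fun n : ℤ => (n : ℚ)) Int.cast_injective.injOn), fun v hv h => ?_⟩
  have hD : ∀ i : ℕ, ∀ m < v.order - i, (D^[i] v).coeff m = 0 := fun i m hm => by
    rw [D_iterate_coeff, HahnSeries.coeff_eq_zero_of_lt_order (by lia), mul_zero]
  have h1 := congrArg (fun f : Lau => f.coeff (μ + v.order)) h
  simp only [HahnSeries.coeff_sum, HahnSeries.coeff_zero] at h1
  have h2 : ∀ i ∈ L.support, (L i * D^[i] v).coeff (μ + v.order) =
      ((C ((L i).coeff (μ + i)) * descPochhammer ℚ i).eval (v.order : ℚ)) * v.coeff v.order := by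
    intro i hi
    rw [show μ + v.order = (μ + i) + (v.order - i) by ring, coeff_mul_add (hvan i hi) (hD i),
      D_iterate_coeff, eval_mul, eval_C, descPochhammer_eval_eq_prod_range, sub_add_cancel, mul_assoc]
    congr 2
    refine Finset.prod_congr rfl fun j _ => by push_cast; ring
  rw [Finset.sum_congr rfl h2, ← Finset.sum_mul, ← eval_finsetSum, ← hχ] at h1
  rw [Finset.mem_preimage, Multiset.mem_toFinset, mem_roots hχ0]
  exact (mul_eq_zero.1 h1).resolve_right (HahnSeries.coeff_order_eq_zero.not.2 hv)

end Orders

/-- Constants as Laurent series. -/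
abbrev cst : ℚ →+* Lau := HahnSeries.C

lemma D_cst (c : ℚ) : D (cst c) = 0 := by
  ext n
  rw [D_coeff]
  by_cases h : n + 1 = 0
  · have : (n : ℚ) + 1 = 0 := by exact_mod_cast h
    simp [this]
  · rw [HahnSeries.C_apply, HahnSeries.coeff_single_of_ne h, mul_zero]; rfl

lemma D_cst_mul (c : ℚ) (f : Lau) : D (cst c * f) = cst c * D f := by
  rw [D_mul, D_cst, zero_mul, zero_add]

lemma D_iterate_cst_mul (c : ℚ) (f : Lau) (i : ℕ) : D^[i] (cst c * f) = cst c * D^[i] f := by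
  induction i with
  | zero => rfl
  | succ i ih => rw [Function.iterate_succ_apply', Function.iterate_succ_apply', ih, D_cst_mul]

lemma cst_mul_coeff (c : ℚ) (f : Lau) (n : ℤ) : (cst c * f).coeff n = c * f.coeff n := by
  rw [HahnSeries.C_apply, HahnSeries.coeff_single_zero_mul]

lemma algebraMap_smul_rat (c : ℚ) (g : Rat1) :
    algebraMap Rat1 Lau (c • g) = cst c * algebraMap Rat1 Lau g := by
  rw [Algebra.smul_def, map_mul]
  congr 1
  exact DFunLike.congr_fun (Subsingleton.elim ((algebraMap Rat1 Lau).comp (algebraMap ℚ Rat1)) cst) c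

lemma smul_rat_smul (c : ℚ) (g : Rat1) (f : Lau) : (c • g) • f = cst c * (g • f) := by
  rw [Algebra.smul_def, algebraMap_smul_rat, Algebra.smul_def, mul_assoc]

lemma D_iterate_add (i : ℕ) (f g : Lau) : D^[i] (f + g) = D^[i] f + D^[i] g := iterate_map_add D i f g

section Bounds

variable {n : ℕ} (W : Fin n → Lau)

/-- The `ℚ`-space of coordinate vectors of solutions of a differential operator. -/
def solCoords (L : ℕ →₀ Lau) : Submodule ℚ (Fin n → Rat1) where
  carrier := {c | ∑ i ∈ L.support, L i * D^[i] (∑ j, c j • W j) = 0}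
  add_mem' {a b} ha hb := by
    simp only [Set.mem_ofPred_eq, Pi.add_apply, add_smul, Finset.sum_add_distrib, D_iterate_add,
      mul_add] at ha hb ⊢
    rw [ha, hb, add_zero]
  zero_mem' := by
    have h : ∀ i, D^[i] (0 : Lau) = 0 := fun i => iterate_map_zero D i
    simp [h]
  smul_mem' r a ha := by
    simp only [Set.mem_ofPred_eq, Pi.smul_apply, smul_rat_smul, ← Finset.mul_sum,
      D_iterate_cst_mul, mul_left_comm _ (cst r)] at ha ⊢
    rw [ha, mul_zero]

lemma finite_solCoords (hW : LinearIndependent Rat1 W) (L : ℕ →₀ Lau) (hL : L ≠ 0) :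
    Module.Finite ℚ (solCoords W L) := by
  obtain ⟨S, hS⟩ := exists_orders L hL
  let T : solCoords W L →ₗ[ℚ] (S → ℚ) :=
    { toFun := fun c o => (∑ j, c.1 j • W j).coeff o
      map_add' := fun a b => by
        ext o
        simp [add_smul, Finset.sum_add_distrib]
      map_smul' := fun r a => by
        ext o
        simp only [Submodule.coe_smul, Pi.smul_apply, smul_rat_smul, ← Finset.mul_sum,
          cst_mul_coeff, RingHom.id_apply, smul_eq_mul] }
  refine Module.Finite.of_injective T ((injective_iff_map_eq_zero T).2 fun c hc => ?_)
  have h0 : ∑ j, c.1 j • W j = 0 := by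
    by_contra hne
    have := congrFun hc ⟨_, hS _ hne c.2⟩
    exact hne (HahnSeries.coeff_order_eq_zero.1 this)
  ext j
  exact Fintype.linearIndependent_iff.1 hW _ h0 j

lemma exists_coords_bound (hW : LinearIndependent Rat1 W) (L : ℕ →₀ Lau) (hL : L ≠ 0) :
    ∃ a : ℤ, ∀ c ∈ solCoords W L, ∀ i, ∀ m < a, (algebraMap Rat1 Lau (c i)).coeff m = 0 := by
  have := finite_solCoords W hW L hL
  obtain ⟨G, hG⟩ := Module.Finite.iff_fg.1 this
  obtain ⟨a, ha⟩ := exists_coeff_vanish_finset (G ×ˢ (Finset.univ : Finset (Fin n)))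
    (fun p => algebraMap Rat1 Lau (p.1 p.2))
  refine ⟨a, fun c hc => ?_⟩
  rw [← hG] at hc
  induction hc using Submodule.span_induction with
  | mem x hx => exact fun i => ha (x, i) (by simpa using hx)
  | zero => simp
  | add x y _ _ h1 h2 => intro i m hm; simp [h1 i m hm, h2 i m hm]
  | smul r x _ h =>
    intro i m hm
    rw [Pi.smul_apply, algebraMap_smul_rat, cst_mul_coeff, h i m hm, mul_zero]

/-- Every nonzero stable subspace of a stable finite-dimensional space contains a nonzero element
of bounded order with coordinates of bounded pole order. -/
lemma exists_bounded_element (hW : LinearIndependent Rat1 W)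
    (hst : ∀ i, D (W i) ∈ Submodule.span Rat1 (Set.range W)) :
    ∃ B : ℤ, ∀ V' : Submodule Rat1 Lau, V' ≤ Submodule.span Rat1 (Set.range W) →
      (∀ v ∈ V', D v ∈ V') → V' ≠ ⊥ → ∃ c : Fin n → Rat1, ∑ j, c j • W j ∈ V' ∧
        ∑ j, c j • W j ≠ 0 ∧ (∑ j, c j • W j).order ≤ B ∧
        ∀ i, ∀ m < -B, (algebraMap Rat1 Lau (c i)).coeff m = 0 := by
  set V := Submodule.span Rat1 (Set.range W) with hV
  have hVst : ∀ v ∈ V, D v ∈ V := by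
    intro x hx
    induction hx using Submodule.span_induction with
    | mem x hx => obtain ⟨i, rfl⟩ := hx; exact hst i
    | zero => simp
    | add x y _ _ h1 h2 => rw [map_add]; exact add_mem h1 h2
    | smul c x hx h1 => rw [D_smul]; exact add_mem (V.smul_mem _ hx) (V.smul_mem _ h1)
  have : FiniteDimensional Rat1 V := FiniteDimensional.span_of_finite _ (Set.finite_range W)
  let δ : V →+ V := AddMonoidHom.mk' (fun v => ⟨D v, hVst _ v.2⟩) fun a b => by ext1; simp
  have hδ : ∀ (i : ℕ) (v : V), ((δ^[i] v : V) : Lau) = D^[i] (v : Lau) := by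
    intro i v
    induction i with
    | zero => rfl
    | succ i ih => rw [Function.iterate_succ_apply', Function.iterate_succ_apply', ← ih]; rfl
  obtain ⟨S, hS0, hS⟩ := exists_operators (k := Rat1) δ
  let ι : (ℕ →₀ Rat1) → (ℕ →₀ Lau) := fun L => L.mapRange (algebraMap Rat1 Lau) (map_zero _)
  have hι : ∀ L, L ≠ 0 → ι L ≠ 0 := by
    intro L hL h
    refine hL (Finsupp.ext fun i => ?_)
    have := DFunLike.congr_fun h i
    simpa [ι] using this
  have hex : ∀ L : ℕ →₀ Rat1, ∃ B : ℤ, L ≠ 0 → ∀ c ∈ solCoords W (ι L), ∑ j, c j • W j ≠ 0 →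
      (∑ j, c j • W j).order ≤ B ∧ ∀ i, ∀ m < -B, (algebraMap Rat1 Lau (c i)).coeff m = 0 := by
    intro L
    by_cases hL : L = 0
    · exact ⟨0, fun h => (h hL).elim⟩
    obtain ⟨a, ha⟩ := exists_coords_bound W hW (ι L) (hι L hL)
    obtain ⟨T, hT⟩ := exists_orders (ι L) (hι L hL)
    obtain ⟨b, hb⟩ := T.bddAbove
    refine ⟨max b (-a), fun _ c hc h0 => ⟨(hb (hT _ h0 hc)).trans (le_max_left _ _),
      fun i m hm => ha c hc i m ?_⟩⟩
    have := le_max_right b (-a)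
    lia
  choose B hB using hex
  obtain ⟨B', hB'⟩ := (S.image B).bddAbove
  refine ⟨B', fun V' hle hst' hne => ?_⟩
  obtain ⟨v, hv, hv0, L, hL, hLv⟩ := hS (V'.comap V.subtype) (fun v hv => hst' _ hv) (by
    obtain ⟨x, hx, hx0⟩ := V'.ne_bot_iff.1 hne
    exact (Submodule.ne_bot_iff _).2 ⟨⟨x, hle hx⟩, hx, by simpa [Subtype.ext_iff] using hx0⟩)
  obtain ⟨c, hc⟩ := (Submodule.mem_span_range_iff_exists_fun Rat1).1 v.2
  have hv0' : ∑ j, c j • W j ≠ 0 := by rw [hc]; simpa using hv0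
  have hmem : c ∈ solCoords W (ι L) := by
    change ∑ i ∈ (ι L).support, ι L i * D^[i] (∑ j, c j • W j) = 0
    have h1 := congrArg (fun x : V => (x : Lau)) hLv
    rw [hc]
    simp only [opEval_eq_sum, AddSubmonoidClass.coe_finsetSum, Submodule.coe_smul, hδ,
      ZeroMemClass.coe_zero] at h1
    rw [← h1]
    have hsupp : (ι L).support = L.support := by
      ext i
      simp [ι]
    rw [hsupp]
    refine Finset.sum_congr rfl fun i _ => ?_
    rw [Algebra.smul_def]
    rfl
  obtain ⟨h1, h2⟩ := hB L (hS0 L hL) c hmem hv0'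
  have hBB : B L ≤ B' := hB' (by simpa using ⟨L, hL, rfl⟩)
  exact ⟨c, by rw [hc]; exact hv, hv0', h1.trans hBB, fun i m hm => h2 i m (by lia)⟩

end Bounds

section L1

/-- The sum of the absolute values of the coefficients of an integer polynomial. -/
def l1 (p : ℤ[X]) : ℝ := ∑ i ∈ p.support, |(p.coeff i : ℝ)|

lemma l1_eq_sum (p : ℤ[X]) {s : Finset ℕ} (h : p.support ⊆ s) : l1 p = ∑ i ∈ s, |(p.coeff i : ℝ)| :=
  Finset.sum_subset h fun i _ hi => by simp [notMem_support_iff.1 hi]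

lemma l1_nonneg (p : ℤ[X]) : 0 ≤ l1 p := Finset.sum_nonneg fun _ _ => abs_nonneg _

lemma l1_add_le (p q : ℤ[X]) : l1 (p + q) ≤ l1 p + l1 q := by
  rw [l1_eq_sum (p + q) (support_add), l1_eq_sum p (Finset.subset_union_left (s₂ := q.support)),
    l1_eq_sum q (Finset.subset_union_right (s₁ := p.support)), ← Finset.sum_add_distrib]
  refine Finset.sum_le_sum fun i _ => ?_
  rw [coeff_add]
  push_cast
  exact abs_add_le _ _

lemma l1_zero : l1 0 = 0 := by simp [l1]

lemma l1_sum_le {ι : Type*} (s : Finset ι) (f : ι → ℤ[X]) : l1 (∑ i ∈ s, f i) ≤ ∑ i ∈ s, l1 (f i) := by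
  classical
  induction s using Finset.induction_on with
  | empty => simp [l1_zero]
  | insert a s ha ih =>
    rw [Finset.sum_insert ha, Finset.sum_insert ha]
    exact (l1_add_le _ _).trans (by gcongr)

lemma abs_coeff_le_l1 (p : ℤ[X]) (i : ℕ) : |(p.coeff i : ℝ)| ≤ l1 p := by
  by_cases h : i ∈ p.support
  · exact Finset.single_le_sum (f := fun i => |(p.coeff i : ℝ)|) (fun _ _ => abs_nonneg _) h
  · simp [notMem_support_iff.1 h, l1_nonneg]

lemma l1_monomial (n : ℕ) (c : ℤ) : l1 (monomial n c) = |(c : ℝ)| := by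
  rw [l1_eq_sum _ (support_monomial_subset n c)]
  simp

lemma l1_monomial_mul_le (n : ℕ) (c : ℤ) (q : ℤ[X]) : l1 (monomial n c * q) ≤ |(c : ℝ)| * l1 q := by
  have h : monomial n c * q = ∑ i ∈ q.support, monomial (n + i) (c * q.coeff i) := by
    conv_lhs => rw [q.as_sum_support]
    rw [Finset.mul_sum]
    simp [monomial_mul_monomial]
  rw [h]
  refine (l1_sum_le _ _).trans ?_
  rw [l1, Finset.mul_sum]
  refine Finset.sum_le_sum fun i _ => ?_
  rw [l1_monomial]
  push_cast
  rw [abs_mul]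

lemma l1_mul_le (p q : ℤ[X]) : l1 (p * q) ≤ l1 p * l1 q := by
  conv_lhs => rw [p.as_sum_support]
  rw [Finset.sum_mul]
  refine (l1_sum_le _ _).trans ?_
  rw [l1, Finset.sum_mul]
  exact Finset.sum_le_sum fun i _ => l1_monomial_mul_le _ _ _

lemma l1_one : l1 1 = 1 := by
  rw [← monomial_zero_one, l1_monomial]
  simp

lemma l1_prod_le {ι : Type*} (s : Finset ι) (f : ι → ℤ[X]) : l1 (∏ i ∈ s, f i) ≤ ∏ i ∈ s, l1 (f i) := by
  classical
  induction s using Finset.induction_on with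
  | empty => simp [l1_one]
  | insert a s ha ih =>
    rw [Finset.prod_insert ha, Finset.prod_insert ha]
    exact (l1_mul_le _ _).trans (by gcongr; exact l1_nonneg _)

lemma l1_pow_le (p : ℤ[X]) (n : ℕ) : l1 (p ^ n) ≤ l1 p ^ n := by
  simpa using l1_prod_le (Finset.range n) (fun _ => p)

lemma l1_neg (p : ℤ[X]) : l1 (-p) = l1 p := by simp [l1]

lemma l1_det_le {n : ℕ} (A : Matrix (Fin n) (Fin n) ℤ[X]) (B : ℝ) (hB : ∀ i j, l1 (A i j) ≤ B) :
    l1 A.det ≤ n.factorial * B ^ n := by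
  rw [Matrix.det_apply]
  refine (l1_sum_le _ _).trans ?_
  have : ∀ σ ∈ (Finset.univ : Finset (Equiv.Perm (Fin n))),
      l1 (Equiv.Perm.sign σ • ∏ i, A (σ i) i) ≤ B ^ n := by
    intro σ _
    have h1 : l1 (Equiv.Perm.sign σ • ∏ i, A (σ i) i) = l1 (∏ i, A (σ i) i) := by
      rcases Int.units_eq_one_or (Equiv.Perm.sign σ) with h | h <;> rw [h] <;> simp [l1_neg]
    rw [h1]
    refine (l1_prod_le _ _).trans ?_
    refine (Finset.prod_le_prod (fun _ _ => l1_nonneg _) (fun i _ => hB (σ i) i)).trans ?_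
    simp
  refine (Finset.sum_le_sum this).trans ?_
  simp [Fintype.card_perm]

lemma l1_le_of_coeff (p : ℤ[X]) (N : ℕ) (B : ℝ) (hN : p.natDegree ≤ N) (hB : ∀ i, |(p.coeff i : ℝ)| ≤ B) :
    l1 p ≤ (N + 1) * B := by
  rw [l1_eq_sum p (s := Finset.range (N + 1)) (fun i hi => Finset.mem_range.2
    (by have := le_natDegree_of_mem_supp i hi; lia))]
  refine (Finset.sum_le_sum fun i _ => hB i).trans ?_
  simp

end L1

section Geometric

/-- Sequences of at most geometric growth. -/
def GB (b : ℕ → ℝ) : Prop := ∃ C : ℝ, 1 ≤ C ∧ ∀ s, b s ≤ C ^ (s + 1)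

lemma GB.mul {b c : ℕ → ℝ} (hb : GB b) (hc : GB c) (h0 : ∀ s, 0 ≤ c s) :
    GB fun s => b s * c s := by
  obtain ⟨B, hB, h1⟩ := hb
  obtain ⟨C, hC, h2⟩ := hc
  refine ⟨B * C, one_le_mul_of_one_le_of_one_le hB hC, fun s => ?_⟩
  rw [mul_pow]
  exact mul_le_mul (h1 s) (h2 s) (h0 s) (by positivity)

lemma GB.mono {b c : ℕ → ℝ} (hc : GB c) (h : ∀ s, b s ≤ c s) : GB b := by
  obtain ⟨C, hC, h2⟩ := hc
  exact ⟨C, hC, fun s => (h s).trans (h2 s)⟩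

lemma GB.const (B : ℝ) : GB fun _ => B := by
  refine ⟨max 1 B, le_max_left _ _, fun s => (le_max_right 1 B).trans ?_⟩
  exact le_self_pow₀ (le_max_left _ _) (by lia)

lemma GB.powr (B : ℝ) : GB fun s => B ^ s := by
  refine ⟨max 1 |B|, le_max_left _ _, fun s => ?_⟩
  calc B ^ s ≤ |B| ^ s := by rw [← abs_pow]; exact le_abs_self _
    _ ≤ (max 1 |B|) ^ s := by gcongr; exact le_max_right _ _
    _ ≤ _ := pow_le_pow_right₀ (le_max_left _ _) (by lia)

lemma GB.pow {b : ℕ → ℝ} (hb : GB b) (h0 : ∀ s, 0 ≤ b s) (n : ℕ) : GB fun s => b s ^ n := by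
  induction n with
  | zero => simpa using GB.const 1
  | succ n ih => simpa only [pow_succ] using ih.mul hb h0

lemma GB.add {b c : ℕ → ℝ} (hb : GB b) (hc : GB c) : GB fun s => b s + c s := by
  obtain ⟨B, hB, h1⟩ := hb
  obtain ⟨C, hC, h2⟩ := hc
  refine ⟨B + C, by linarith, fun s => (add_le_add (h1 s) (h2 s)).trans ?_⟩
  exact pow_add_pow_le (by linarith) (by linarith) (by lia)

/-- Composition of a geometric sequence with an affine function. -/
lemma GB.affine {b : ℕ → ℝ} (hb : GB b) (u v : ℕ) : GB fun s => b (u * s + v) := by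
  obtain ⟨B, hB, h1⟩ := hb
  refine ⟨B ^ (u + v + 1), one_le_pow₀ hB, fun s => (h1 _).trans ?_⟩
  rw [← pow_mul]
  exact pow_le_pow_right₀ hB (by nlinarith [Nat.zero_le (v * s), Nat.zero_le u])

lemma GB.natCast : GB fun s => (s : ℝ) := by
  refine ⟨2, by norm_num, fun s => ?_⟩
  have : s < 2 ^ (s + 1) := (Nat.lt_two_pow_self).trans (Nat.pow_lt_pow_right (by norm_num) (by lia))
  show (s : ℝ) ≤ 2 ^ (s + 1)
  exact_mod_cast this.le

lemma not_GB_factorial : ¬ GB fun s => (s.factorial : ℝ) := by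
  rintro ⟨C, hC, h⟩
  have h1 := FloorSemiring.tendsto_pow_div_factorial_atTop C
  have h2 : ∀ᶠ s : ℕ in Filter.atTop, C ^ s / s.factorial < 1 / C :=
    h1.eventually_lt_const (by positivity)
  obtain ⟨s, hs⟩ := h2.exists
  have h3 : (0 : ℝ) < s.factorial := by positivity
  rw [div_lt_div_iff₀ h3 (by linarith)] at hs
  have := h s
  rw [pow_succ] at this
  linarith

end Geometric

section IntegerPolynomials

/-- Integer polynomials as rational functions. -/
def zr : ℤ[X] →+* Rat1 := (algebraMap ℚ[X] Rat1).comp (mapRingHom (Int.castRingHom ℚ))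

/-- Integer polynomials as Laurent series. -/
def zl : ℤ[X] →+* Lau := pl.comp (mapRingHom (Int.castRingHom ℚ))

lemma algebraMap_zr (p : ℤ[X]) : algebraMap Rat1 Lau (zr p) = zl p := by
  simp only [zr, zl, RingHom.comp_apply, ← IsScalarTower.algebraMap_apply]

lemma map_int_injective : Function.Injective (mapRingHom (Int.castRingHom ℚ)) :=
  map_injective _ Int.cast_injective

lemma zl_injective : Function.Injective zl := pl_injective.comp map_int_injective

lemma zr_injective : Function.Injective zr := (IsFractionRing.injective ℚ[X] Rat1).comp map_int_injective

lemma zl_coeff (p : ℤ[X]) (n : ℕ) : (zl p).coeff n = p.coeff n := by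
  rw [zl, RingHom.comp_apply, pl_coeff_nat]
  simp

lemma zl_coeff_neg (p : ℤ[X]) (n : ℤ) (hn : n < 0) : (zl p).coeff n = 0 := by
  rw [zl, RingHom.comp_apply, pl_eq, PowerSeries.coeff_coe, if_pos hn]

lemma D_zl (p : ℤ[X]) : D (zl p) = zl (derivative p) := by
  rw [zl, RingHom.comp_apply, D_pl, RingHom.comp_apply, coe_mapRingHom, derivative_map]

lemma D_iterate_zl (p : ℤ[X]) (k : ℕ) : D^[k] (zl p) = k.factorial * zl (hasseDeriv k p) := by
  have h : D^[k] (zl p) = zl (derivative^[k] p) := by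
    induction k with
    | zero => rfl
    | succ k ih => rw [Function.iterate_succ_apply', Function.iterate_succ_apply', ih, D_zl]
  rw [h, ← factorial_smul_hasseDeriv]
  simp

end IntegerPolynomials

section Connection

variable {R : Type*} [CommRing R] {n : ℕ} (d : R →+ R) (Γ : Fin n → Fin n → R)

/-- The connection `Y ↦ d Y - Γ Y`. -/
def pd : (Fin n → R) →+ (Fin n → R) :=
  AddMonoidHom.mk' (fun Y i => d (Y i) - ∑ j, Γ i j * Y j) fun Y Z => by
    ext i
    simp only [Pi.add_apply, map_add, mul_add, Finset.sum_add_distrib]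
    ring

lemma pd_apply (Y : Fin n → R) (i : Fin n) : pd d Γ Y i = d (Y i) - ∑ j, Γ i j * Y j := rfl

lemma pd_smul (hd : ∀ a b, d (a * b) = d a * b + a * d b) (f : R) (Y : Fin n → R) :
    pd d Γ (f • Y) = d f • Y + f • pd d Γ Y := by
  ext i
  simp only [pd_apply, Pi.add_apply, Pi.smul_apply, smul_eq_mul, hd, mul_sub, Finset.mul_sum]
  have : ∀ j, Γ i j * (f * Y j) = f * (Γ i j * Y j) := fun j => by ring
  simp only [this]
  ring

lemma pd_iterate_smul (hd : ∀ a b, d (a * b) = d a * b + a * d b) (f : R) (Y : Fin n → R) (m : ℕ) :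
    (pd d Γ)^[m] (f • Y) =
      ∑ p ∈ Finset.HasAntidiagonal.antidiagonal m, m.choose p.1 • (d^[p.1] f • (pd d Γ)^[p.2] Y) := by
  induction m with
  | zero => simp
  | succ m ih =>
    rw [Function.iterate_succ_apply', ih, map_sum,
      Finset.sum_antidiagonal_choose_succ_nsmul fun a b => d^[a] f • (pd d Γ)^[b] Y,
      ← Finset.sum_add_distrib]
    refine Finset.sum_congr rfl fun p hp => ?_
    rw [map_nsmul, pd_smul d Γ hd, ← Function.iterate_succ_apply' d, ← Function.iterate_succ_apply' (pd d Γ),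
      smul_add, add_comm]
    congr 2
    rw [← Finset.HasAntidiagonal.mem_antidiagonal.1 hp, Nat.choose_symm_add]

lemma pd_iterate_flat (hd : ∀ a b, d (a * b) = d a * b + a * d b) (f : R) (Y : Fin n → R)
    (hY : pd d Γ Y = 0) (m : ℕ) : (pd d Γ)^[m] (f • Y) = d^[m] f • Y := by
  induction m with
  | zero => rfl
  | succ m ih =>
    rw [Function.iterate_succ_apply', ih, pd_smul d Γ hd, hY, smul_zero, add_zero,
      ← Function.iterate_succ_apply' d]

/-- `T^(s+1) ∂^(s+1) = T ∂ (T^s ∂^s) - s T' T^s ∂^s`. -/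
lemma pow_smul_pd_succ (hd : ∀ a b, d (a * b) = d a * b + a * d b) (T : R) (Y : Fin n → R) (s : ℕ) :
    T ^ (s + 1) • (pd d Γ)^[s + 1] Y =
      T • pd d Γ (T ^ s • (pd d Γ)^[s] Y) - (s * d T) • (T ^ s • (pd d Γ)^[s] Y) := by
  have hp : T * d (T ^ s) = s * d T * T ^ s := by
    induction s with
    | zero =>
      have h := hd 1 1
      simp only [mul_one, one_mul, left_eq_add] at h
      simp [h]
    | succ s ih =>
      rw [pow_succ, hd, mul_add, ← mul_assoc, ih]
      push_cast
      ring
  rw [pd_smul d Γ hd, smul_add, smul_smul, hp, smul_smul, smul_smul, pow_succ', Function.iterate_succ_apply']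
  abel

end Connection

section RationalDerivation

lemma algebraMap_rat_injective : Function.Injective (algebraMap Rat1 Lau) := (algebraMap Rat1 Lau).injective

/-- The derivation `d/dx` on rational functions as an additive map. -/
def drh : Rat1 →+ Rat1 := AddMonoidHom.mk' dr fun a b => algebraMap_rat_injective <| by
  rw [map_add, ← D_algebraMap, ← D_algebraMap, ← D_algebraMap, map_add, map_add]

lemma drh_apply (a : Rat1) : drh a = dr a := rfl

lemma drh_mul (a b : Rat1) : drh (a * b) = drh a * b + a * drh b := algebraMap_rat_injective <| by
  simp only [drh_apply, map_add, map_mul, ← D_algebraMap, D_mul]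

end RationalDerivation

section Support

lemma zl_mul_coeff (p : ℤ[X]) (f : Lau) (m : ℤ) :
    (zl p * f).coeff m = ∑ k ∈ Finset.range (p.natDegree + 1), (p.coeff k : ℚ) * f.coeff (m - k) := by
  have h : zl p = ∑ k ∈ Finset.range (p.natDegree + 1), HahnSeries.single (k : ℤ) (p.coeff k : ℚ) := by
    ext i
    rw [HahnSeries.coeff_sum]
    simp only [HahnSeries.coeff_single]
    rcases lt_or_ge i 0 with hi | hi
    · rw [zl_coeff_neg p i hi, Finset.sum_eq_zero]
      intro k _
      rw [if_neg (by lia)]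
    · lift i to ℕ using hi
      rw [zl_coeff]
      simp only [Nat.cast_inj, Finset.sum_ite_eq, Finset.mem_range]
      split_ifs with h
      · rfl
      · rw [coeff_eq_zero_of_natDegree_lt (by lia), Int.cast_zero]
  rw [h, Finset.sum_mul, HahnSeries.coeff_sum]
  refine Finset.sum_congr rfl fun k _ => ?_
  rw [HahnSeries.coeff_single_mul]

/-- All coefficients of index less than `a` vanish. -/
def LB (a : ℤ) (f : Lau) : Prop := ∀ m < a, f.coeff m = 0

/-- All coefficients of index greater than `b` vanish. -/
def UB (b : ℤ) (f : Lau) : Prop := ∀ m, b < m → f.coeff m = 0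

lemma LB.sub {a : ℤ} {f g : Lau} (hf : LB a f) (hg : LB a g) : LB a (f - g) := fun m hm => by
  rw [HahnSeries.coeff_sub, hf m hm, hg m hm, sub_zero]

lemma UB.sub {a : ℤ} {f g : Lau} (hf : UB a f) (hg : UB a g) : UB a (f - g) := fun m hm => by
  rw [HahnSeries.coeff_sub, hf m hm, hg m hm, sub_zero]

lemma LB.sum {ι : Type*} {s : Finset ι} {a : ℤ} {f : ι → Lau} (hf : ∀ i ∈ s, LB a (f i)) :
    LB a (∑ i ∈ s, f i) := fun m hm => by
  rw [HahnSeries.coeff_sum]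
  exact Finset.sum_eq_zero fun i hi => hf i hi m hm

lemma UB.sum {ι : Type*} {s : Finset ι} {a : ℤ} {f : ι → Lau} (hf : ∀ i ∈ s, UB a (f i)) :
    UB a (∑ i ∈ s, f i) := fun m hm => by
  rw [HahnSeries.coeff_sum]
  exact Finset.sum_eq_zero fun i hi => hf i hi m hm

lemma LB.zl_mul {a : ℤ} {f : Lau} (hf : LB a f) (p : ℤ[X]) : LB a (zl p * f) := fun m hm => by
  rw [zl_mul_coeff]
  exact Finset.sum_eq_zero fun i hi => by rw [hf _ (by lia), mul_zero]

lemma UB.zl_mul {b : ℤ} {f : Lau} (hf : UB b f) {p : ℤ[X]} {t : ℕ} (ht : p.natDegree ≤ t) :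
    UB (b + t) (zl p * f) := fun m hm => by
  rw [zl_mul_coeff]
  exact Finset.sum_eq_zero fun i hi => by
    have := Finset.mem_range.1 hi
    rw [hf _ (by lia), mul_zero]

lemma LB.D {a : ℤ} {f : Lau} (hf : LB a f) : LB (a - 1) (D f) := fun m hm => by
  rw [D_coeff, hf _ (by lia), mul_zero]

lemma UB.D {b : ℤ} {f : Lau} (hf : UB b f) : UB b (D f) := fun m hm => by
  rw [D_coeff, hf _ (by lia), mul_zero]

lemma LB.zl_mul_D {a : ℤ} {f : Lau} (hf : LB a f) {p : ℤ[X]} (hp : X ∣ p) :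
    LB a (zl p * EFun.D f) := fun m hm => by
  rw [zl_mul_coeff]
  refine Finset.sum_eq_zero fun i hi => ?_
  rcases Nat.eq_zero_or_pos i with rfl | h
  · rw [X_dvd_iff.1 hp]; simp
  · rw [hf.D _ (by lia), mul_zero]

lemma LB.mul {a b : ℤ} {f g : Lau} (hf : LB a f) (hg : LB b g) : LB (a + b) (f * g) := fun _ hm =>
  coeff_mul_eq_zero hf hg hm

end Support

section Siegel
attribute [local instance] Matrix.seminormedAddCommGroup

lemma exists_pade_denominator {n : ℕ} (hn : 0 < n) {l : ℕ} (hl : 0 < l) (u : Fin n → ℕ → ℤ) (A : ℝ)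
    (hA : 1 ≤ A) (hu : ∀ i m, m ≤ 2 * n * l + l → |(u i m : ℝ)| ≤ A) :
    ∃ q : ℤ[X], q ≠ 0 ∧ q.natDegree ≤ 2 * n * l ∧ (∀ k, |(q.coeff k : ℝ)| ≤ (2 * n * l + 1) * A) ∧
      ∀ i m, 2 * n * l < m → m ≤ 2 * n * l + l →
        ∑ k ∈ Finset.range (2 * n * l + 1), q.coeff k * u i (m - k) = 0 := by
  set N := 2 * n * l with hN
  let B : Matrix (Fin n × Fin l) (Fin (N + 1)) ℤ := fun p k => u p.1 (N + 1 + p.2 - k)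
  have hnl : 0 < n * l := Nat.mul_pos hn hl
  have hc : Fintype.card (Fin n × Fin l) = n * l := by simp
  obtain ⟨t, ht0, ht, hnorm⟩ := Int.Matrix.exists_ne_zero_int_vec_norm_le B
    (by rw [hc, Fintype.card_fin]; lia) (by rw [hc]; exact hnl)
  have hBn : ‖B‖ ≤ A := by
    rw [Matrix.norm_le_iff (by linarith)]
    intro p k
    rw [Int.norm_eq_abs]
    have := p.2.2
    exact hu _ _ (by lia)
  have hbound : ‖t‖ ≤ (N + 1) * A := by
    refine hnorm.trans ?_
    rw [hc, Fintype.card_fin]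
    have h1 : (1 : ℝ) ≤ ((N + 1 : ℕ) : ℝ) * max 1 ‖B‖ := by
      refine one_le_mul_of_one_le_of_one_le ?_ (le_max_left _ _)
      exact_mod_cast Nat.le_add_left 1 N
    refine (Real.rpow_le_rpow_of_exponent_le h1 (z := 1) ?_).trans ?_
    · have h2 : (N : ℝ) = 2 * ((n * l : ℕ) : ℝ) := by rw [hN]; push_cast; ring
      have h3 : (0 : ℝ) ≤ ((n * l : ℕ) : ℝ) := by positivity
      push_cast at h2 h3 ⊢
      rw [div_le_one (by linarith)]
      linarith
    · rw [Real.rpow_one]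
      push_cast
      gcongr
      exact max_le hA hBn
  let q : ℤ[X] := ∑ k : Fin (N + 1), monomial k (t k)
  have hq : ∀ k : Fin (N + 1), q.coeff k = t k := by
    intro k
    simp only [q, finsetSum_coeff, coeff_monomial]
    rw [Finset.sum_eq_single k]
    · simp
    · intro b _ hb
      rw [if_neg]
      exact fun h => hb (Fin.ext h)
    · simp
  have hdeg : q.natDegree ≤ N := by
    refine natDegree_sum_le_of_forall_le _ _ fun k _ => ?_
    exact (natDegree_monomial_le _).trans (by have := k.2; lia)
  refine ⟨q, ?_, hdeg, ?_, ?_⟩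
  · intro h
    refine ht0 (funext fun k => ?_)
    rw [← hq, h]; rfl
  · intro k
    rcases lt_or_ge k (N + 1) with h | h
    · have := hq ⟨k, h⟩
      simp only at this
      rw [this, ← Int.norm_eq_abs]
      have h5 : (2 * (n:ℝ) * l + 1) = N + 1 := by rw [hN]; push_cast; ring
      rw [h5]
      exact (norm_le_pi_norm t _).trans hbound
    · rw [coeff_eq_zero_of_natDegree_lt (by lia)]
      simp only [Int.cast_zero, abs_zero]
      positivity
  · intro i m h1 h2
    have h3 := congrFun ht (i, ⟨m - (N + 1), by lia⟩)
    simp only [Matrix.mulVec, dotProduct, B, Pi.zero_apply] at h3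
    rw [Finset.sum_range, ← h3]
    refine Finset.sum_congr rfl fun k _ => ?_
    rw [hq, mul_comm]
    congr 2
    lia

end Siegel

section Truncation

/-- Truncation of an integer polynomial to degree at most `M`. -/
def ptrunc (M : ℕ) (p : ℤ[X]) : ℤ[X] := ∑ k ∈ Finset.range (M + 1), monomial k (p.coeff k)

lemma coeff_ptrunc (M : ℕ) (p : ℤ[X]) (k : ℕ) :
    (ptrunc M p).coeff k = if k ≤ M then p.coeff k else 0 := by
  simp only [ptrunc, finsetSum_coeff, coeff_monomial, Finset.sum_ite_eq', Finset.mem_range]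
  simp

lemma l1_ptrunc_le (M : ℕ) (p : ℤ[X]) : l1 (ptrunc M p) ≤ l1 p := by
  have hs : (ptrunc M p).support ⊆ p.support := by
    intro i hi
    rw [mem_support_iff, coeff_ptrunc] at hi
    rw [mem_support_iff]
    intro h
    simp [h] at hi
  rw [l1_eq_sum _ hs, l1_eq_sum p subset_rfl]
  refine Finset.sum_le_sum fun i _ => ?_
  rw [coeff_ptrunc]
  split_ifs <;> simp

lemma l1_hasseDeriv_le (p : ℤ[X]) (s N : ℕ) (A : ℝ) (hN : p.natDegree ≤ N)
    (hA : ∀ k, |(p.coeff k : ℝ)| ≤ A) : l1 (hasseDeriv s p) ≤ (N + 1) * (2 ^ N * A) := by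
  have hA0 : 0 ≤ A := (abs_nonneg _).trans (hA 0)
  refine l1_le_of_coeff _ N _ ((natDegree_hasseDeriv_le _ _).trans (by lia)) fun i => ?_
  rw [hasseDeriv_coeff]
  push_cast
  rw [abs_mul, Nat.abs_cast]
  rcases le_or_gt (i + s) N with h | h
  · refine mul_le_mul ?_ (hA _) (abs_nonneg _) (by positivity)
    refine le_trans (b := ((2 ^ (i + s) : ℕ) : ℝ)) (by exact_mod_cast Nat.choose_le_two_pow _ _) ?_
    push_cast
    exact pow_le_pow_right₀ (by norm_num) h
  · rw [coeff_eq_zero_of_natDegree_lt (by lia)]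
    simp only [Int.cast_zero, abs_zero, mul_zero]
    positivity

end Truncation

/-- A differential system over `ℚ(x)` with a solution whose components are linearly independent
power series with geometrically bounded coefficients and denominators. -/
structure GSys (n : ℕ) where
  W : Fin n → PowerSeries ℚ
  Γ : Fin n → Fin n → Rat1
  T : ℤ[X]
  G : Fin n → Fin n → ℤ[X]
  T_ne : T ≠ 0
  X_dvd : X ∣ T
  T_mul : ∀ i j, zr T * Γ i j = zr (G i j)
  flat : ∀ i, D (W i : Lau) = ∑ j, Γ i j • (W j : Lau)
  li : LinearIndependent Rat1 fun i => (W i : Lau)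
  arith : ∃ C : ℝ, 1 ≤ C ∧ ∀ N : ℕ, ∃ δ : ℕ, 1 ≤ δ ∧ (δ : ℝ) ≤ C ^ (N + 1) ∧ ∀ i, ∀ l ≤ N,
    (∃ z : ℤ, δ * PowerSeries.coeff l (W i) = z) ∧ |((PowerSeries.coeff l (W i) : ℚ) : ℝ)| ≤ C ^ (N + 1)

lemma natCast_mul_coeff (c : ℕ) (f : Lau) (m : ℤ) : ((c : Lau) * f).coeff m = c * f.coeff m := by
  rw [← nsmul_eq_mul, HahnSeries.coeff_nsmul, Pi.smul_apply, nsmul_eq_mul]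

namespace GSys

variable {n : ℕ} (g : GSys n)

/-- The solution as a vector of Laurent series. -/
def w : Fin n → Lau := fun i => (g.W i : Lau)

/-- The connection acting on vectors of Laurent series. -/
def dl : (Fin n → Lau) →+ (Fin n → Lau) := pd D fun i j => algebraMap Rat1 Lau (g.Γ i j)

/-- The connection acting on vectors of rational functions. -/
def drat : (Fin n → Rat1) →+ (Fin n → Rat1) := pd drh g.Γ

/-- Componentwise embedding of rational functions in Laurent series. -/
def emb {n : ℕ} (Y : Fin n → Rat1) : Fin n → Lau := fun i => algebraMap Rat1 Lau (Y i)

lemma dl_emb (Y : Fin n → Rat1) : g.dl (emb Y) = emb (g.drat Y) := by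
  ext1 i
  simp only [dl, drat, emb, pd_apply, D_algebraMap, drh_apply, map_sub, map_sum, map_mul]

lemma dl_iterate_emb (Y : Fin n → Rat1) (s : ℕ) : g.dl^[s] (emb Y) = emb (g.drat^[s] Y) := by
  induction s with
  | zero => rfl
  | succ s ih => rw [Function.iterate_succ_apply', ih, dl_emb, Function.iterate_succ_apply']

lemma dl_w : g.dl g.w = 0 := by
  ext1 i
  simp only [dl, pd_apply, w, g.flat, Pi.zero_apply, Algebra.smul_def, sub_self]

lemma T_mul_dl (Y : Fin n → Lau) (i : Fin n) :
    zl g.T * g.dl Y i = zl g.T * D (Y i) - ∑ j, zl (g.G i j) * Y j := by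
  rw [dl, pd_apply, mul_sub, Finset.mul_sum]
  congr 1
  refine Finset.sum_congr rfl fun j _ => ?_
  rw [← mul_assoc, ← algebraMap_zr, ← map_mul, g.T_mul, algebraMap_zr]

lemma T_pow_dl_succ (Y : Fin n → Lau) (s : ℕ) (i : Fin n) :
    zl g.T ^ (s + 1) * g.dl^[s + 1] Y i =
      (zl g.T * D (zl g.T ^ s * g.dl^[s] Y i) - ∑ j, zl (g.G i j) * (zl g.T ^ s * g.dl^[s] Y j)) -
        zl (s * derivative g.T) * (zl g.T ^ s * g.dl^[s] Y i) := by
  have h := congrFun (pow_smul_pd_succ D (fun i j => algebraMap Rat1 Lau (g.Γ i j)) D_mul (zl g.T) Y s) i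
  have h2 := g.T_mul_dl (zl g.T ^ s • g.dl^[s] Y) i
  simp only [Pi.smul_apply, smul_eq_mul, Pi.sub_apply] at h h2
  rw [dl] at h2 ⊢
  rw [h, h2, D_zl, map_mul zl, map_natCast zl]

lemma LB_T_pow_dl {a : ℤ} {Y : Fin n → Lau} (hY : ∀ i, LB a (Y i)) (s : ℕ) (i : Fin n) :
    LB a (zl g.T ^ s * g.dl^[s] Y i) := by
  induction s generalizing i with
  | zero => simpa using hY i
  | succ s ih =>
    rw [T_pow_dl_succ]
    exact (((ih i).zl_mul_D g.X_dvd).sub (LB.sum fun j _ => (ih j).zl_mul _)).sub ((ih i).zl_mul _)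

lemma UB_T_pow_dl {b : ℤ} {Y : Fin n → Lau} (hY : ∀ i, UB b (Y i)) {t : ℕ} (ht : g.T.natDegree ≤ t)
    (hG : ∀ i j, (g.G i j).natDegree ≤ t) (s : ℕ) (i : Fin n) :
    UB (b + s * t) (zl g.T ^ s * g.dl^[s] Y i) := by
  induction s generalizing i with
  | zero => simpa using hY i
  | succ s ih =>
    rw [T_pow_dl_succ, show b + ((s + 1 : ℕ) : ℤ) * t = b + s * t + t by push_cast; ring]
    have hd : ((s : ℤ[X]) * derivative g.T).natDegree ≤ t := by
      refine natDegree_mul_le.trans ?_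
      rw [natDegree_natCast, zero_add]
      exact (natDegree_derivative_le _).trans (by lia)
    exact (((ih i).D.zl_mul ht).sub (UB.sum fun j _ => (ih j).zl_mul (hG i j))).sub ((ih i).zl_mul hd)

lemma integral_T_pow_dl {t : ℕ} (ht : g.T.natDegree ≤ t) (hG : ∀ i j, (g.G i j).natDegree ≤ t)
    (N l : ℕ) (Q : ℤ[X]) (P : Fin n → Lau) (hP0 : ∀ i, LB 0 (P i)) (hP : ∀ i, UB N (P i))
    (hR : ∀ i, LB (N + l + 1) (zl Q * g.w i - P i)) (δ : ℕ) (u : Fin n → ℕ → ℤ)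
    (hu : ∀ i, ∀ k ≤ N + l, δ * PowerSeries.coeff k (g.W i) = u i k) (s : ℕ) (hs : s * t ≤ l)
    (i : Fin n) :
    δ * (zl g.T ^ s * g.dl^[s] P i) = s.factorial * zl (ptrunc (N + l)
      (g.T ^ s * hasseDeriv s Q * ∑ k ∈ Finset.range (N + l + 1), monomial k (u i k))) := by
  set F : ℤ[X] := ∑ k ∈ Finset.range (N + l + 1), monomial k (u i k) with hF
  have hdiff : LB (N + l + 1) (δ * g.w i - zl F) := by
    intro m hm
    rw [HahnSeries.coeff_sub, natCast_mul_coeff, w]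
    rcases lt_or_ge m 0 with h | h
    · rw [PowerSeries.coeff_coe, if_pos h, zl_coeff_neg _ _ h]
      simp
    · lift m to ℕ using h
      have hm' : m ≤ N + l := by lia
      rw [LaurentSeries.coeff_coe_powerSeries, zl_coeff, hu i m hm', hF, finsetSum_coeff]
      simp [coeff_monomial, hm']
  have hRs : LB (N + l + 1) (zl g.T ^ s * g.dl^[s] (zl Q • g.w - P) i) :=
    g.LB_T_pow_dl (fun i => hR i) s i
  have hsub : g.dl^[s] (zl Q • g.w - P) = D^[s] (zl Q) • g.w - g.dl^[s] P := by
    rw [iterate_map_sub]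
    congr 1
    exact pd_iterate_flat D _ D_mul (zl Q) g.w g.dl_w s
  rw [hsub, D_iterate_zl] at hRs
  have key : δ * (zl g.T ^ s * g.dl^[s] P i) = s.factorial * zl (g.T ^ s * hasseDeriv s Q * F) +
      (s.factorial * (zl (g.T ^ s * hasseDeriv s Q) * (δ * g.w i - zl F)) -
        δ * (zl g.T ^ s * ((s.factorial * zl (hasseDeriv s Q)) • g.w - g.dl^[s] P) i)) := by
    simp only [Pi.sub_apply, Pi.smul_apply, smul_eq_mul, map_mul, map_pow]
    ring
  ext m
  rcases lt_or_ge m 0 with h | h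
  · rw [natCast_mul_coeff, natCast_mul_coeff, zl_coeff_neg _ _ h, g.LB_T_pow_dl hP0 s i m h]
    simp
  lift m to ℕ using h
  rcases le_or_gt m (N + l) with hm | hm
  · rw [key, HahnSeries.coeff_add, HahnSeries.coeff_sub, natCast_mul_coeff, natCast_mul_coeff,
      natCast_mul_coeff, hRs m (by lia), hdiff.zl_mul _ m (by lia), natCast_mul_coeff, zl_coeff,
      zl_coeff, coeff_ptrunc, if_pos hm]
    simp
  · rw [natCast_mul_coeff, natCast_mul_coeff, zl_coeff, coeff_ptrunc, if_neg (by lia),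
      g.UB_T_pow_dl hP ht hG s i m (by rw [← Nat.cast_mul]; lia)]
    simp

/-- `δ T^(m+n) ∂^m Y / (m factorial)` is integral for all `m ≤ S`. -/
def Good (δ S : ℕ) (Y : Fin n → Lau) : Prop := ∀ m ≤ S, ∃ Z : Fin n → ℤ[X], ∀ i,
  δ * (zl g.T ^ (m + n) * g.dl^[m] Y i) = m.factorial * zl (Z i)

variable {g} in
lemma Good.sum {δ S : ℕ} {ι : Type*} {s : Finset ι} {Y : ι → Fin n → Lau}
    (h : ∀ k ∈ s, g.Good δ S (Y k)) : g.Good δ S (∑ k ∈ s, Y k) := by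
  classical
  induction s using Finset.induction_on with
  | empty =>
    intro m _
    refine ⟨0, fun i => ?_⟩
    simp [iterate_map_zero]
  | insert a s ha ih =>
    intro m hm
    obtain ⟨Z, hZ⟩ := h a (by simp) m hm
    obtain ⟨Z', hZ'⟩ := ih (fun k hk => h k (by simp [hk])) m hm
    refine ⟨Z + Z', fun i => ?_⟩
    rw [Finset.sum_insert ha, iterate_map_add, Pi.add_apply, Pi.add_apply, map_add, mul_add, mul_add,
      mul_add, hZ, hZ']

variable {g} in
lemma Good.zl_smul {δ S : ℕ} {Y : Fin n → Lau} (h : g.Good δ S Y) (p : ℤ[X]) :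
    g.Good δ S (zl p • Y) := by
  intro m hm
  choose! Z hZ using h
  refine ⟨fun i => ∑ q ∈ Finset.HasAntidiagonal.antidiagonal m,
    hasseDeriv q.1 p * g.T ^ q.1 * Z q.2 i, fun i => ?_⟩
  rw [dl, pd_iterate_smul D _ D_mul, map_sum, Finset.sum_apply, Finset.mul_sum, Finset.mul_sum,
    Finset.mul_sum]
  refine Finset.sum_congr rfl fun q hq => ?_
  have hq' := Finset.HasAntidiagonal.mem_antidiagonal.1 hq
  have h1 := hZ q.2 (by lia) i
  rw [dl] at h1
  have hf : (m.factorial : Lau) = m.choose q.1 * q.1.factorial * q.2.factorial := by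
    rw [← hq', ← Nat.add_choose_mul_factorial_mul_factorial q.1 q.2]
    rw [Nat.choose_symm_add]
    push_cast
    rfl
  rw [D_iterate_zl, Pi.smul_apply, Pi.smul_apply, smul_eq_mul, nsmul_eq_mul, map_mul, map_mul,
    map_pow, hf]
  rw [show m + n = q.1 + (q.2 + n) by lia, pow_add]
  linear_combination (m.choose q.1 * q.1.factorial * zl (hasseDeriv q.1 p) * zl g.T ^ q.1) * h1

end GSys

namespace GSys

variable {n : ℕ} (g : GSys n)

/-- Contraction of the solution with a vector of rational functions. -/
def con (c : Fin n → Rat1) : Lau := ∑ j, c j • g.w j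

/-- The dual connection on vectors of rational functions. -/
def ddual (c : Fin n → Rat1) : Fin n → Rat1 := fun j => dr (c j) + ∑ i, c i * g.Γ i j

lemma D_con (c : Fin n → Rat1) : D (g.con c) = g.con (g.ddual c) := by
  simp only [con, map_sum, D_smul, ddual, add_smul, Finset.sum_add_distrib]
  congr 1
  simp only [w, g.flat, Finset.smul_sum, Finset.sum_smul, smul_smul]
  exact Finset.sum_comm

lemma ddual_dot (c Y : Fin n → Rat1) :
    ∑ j, g.ddual c j * Y j = drh (∑ j, c j * Y j) - ∑ j, c j * g.drat Y j := by
  simp only [ddual, map_sum, drh_mul, drat, pd_apply, ← drh_apply, add_mul, mul_sub,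
    Finset.sum_add_distrib, Finset.sum_sub_distrib]
  have : ∑ j, (∑ i, c i * g.Γ i j) * Y j = ∑ i, c i * ∑ j, g.Γ i j * Y j := by
    simp only [Finset.sum_mul, Finset.mul_sum, mul_assoc]
    exact Finset.sum_comm
  rw [this]
  ring

lemma con_injective {c c' : Fin n → Rat1} (h : g.con c = g.con c') : c = c' := by
  have := Fintype.linearIndependent_iff.1 g.li (fun j => c j - c' j) (by
    have h' : g.con c - g.con c' = 0 := sub_eq_zero.2 h
    rw [con, con, ← Finset.sum_sub_distrib] at h'
    simp only [← sub_smul] at h'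
    exact h')
  exact funext fun j => sub_eq_zero.1 (this j)

/-- The contractions annihilating all derivatives of `Y`. -/
def annih (Y : Fin n → Rat1) : Submodule Rat1 Lau where
  carrier := {v | ∃ c : Fin n → Rat1, (∀ s, ∑ j, c j * g.drat^[s] Y j = 0) ∧ g.con c = v}
  zero_mem' := ⟨0, by simp [con]⟩
  add_mem' := by
    rintro _ _ ⟨c, hc, rfl⟩ ⟨c', hc', rfl⟩
    refine ⟨c + c', fun s => ?_, ?_⟩
    · simp only [Pi.add_apply, add_mul, Finset.sum_add_distrib, hc, hc', add_zero]
    · simp only [con, Pi.add_apply, add_smul, Finset.sum_add_distrib]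
  smul_mem' := by
    rintro a _ ⟨c, hc, rfl⟩
    refine ⟨a • c, fun s => ?_, ?_⟩
    · simp only [Pi.smul_apply, smul_eq_mul, mul_assoc, ← Finset.mul_sum, hc, mul_zero]
    · simp only [con, Pi.smul_apply, smul_eq_mul, mul_smul, Finset.smul_sum]

lemma exists_linearIndependent_bound : ∃ B : ℤ, ∀ (N l : ℕ) (Q : ℤ[X]) (P : Fin n → Rat1), Q ≠ 0 →
    Q.natDegree ≤ N → (∀ i, LB (N + l + 1) (zl Q * g.w i - emb P i)) → 2 * B ≤ l →
    LinearIndependent Rat1 fun i : Fin n => g.drat^[i] P := by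
  have hst : ∀ i, D (g.w i) ∈ Submodule.span Rat1 (Set.range g.w) := by
    intro i
    rw [w, g.flat]
    exact Submodule.sum_mem _ fun j _ => Submodule.smul_mem _ _ (Submodule.subset_span ⟨j, rfl⟩)
  obtain ⟨B, hB⟩ := exists_bounded_element g.w g.li hst
  refine ⟨B, fun N l Q P hQ hQN hR hl => ?_⟩
  by_contra hli
  have hfr : Module.finrank Rat1 (Fin n → Rat1) = n := Module.finrank_fin_fun _
  have hδ : ∀ (c : Rat1) (v : Fin n → Rat1), g.drat (c • v) = drh c • v + c • g.drat v :=
    fun c v => pd_smul _ _ drh_mul c v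
  obtain ⟨φ, hφ0, hφ⟩ := exists_dual_of_not_linearIndependent g.drat hδ P (fun h => hli (by
    exact (linearIndependent_equiv' (finCongr hfr.symm) rfl).2 h))
  let c : Fin n → Rat1 := fun j => φ (Pi.single j 1)
  have hφc : ∀ Y, φ Y = ∑ j, c j * Y j := by
    intro Y
    conv_lhs => rw [pi_eq_sum_univ' Y]
    simp only [map_sum, map_smul, smul_eq_mul, c]
    refine Finset.sum_congr rfl fun j _ => ?_
    rw [mul_comm]
  have hc0 : c ≠ 0 := fun h => hφ0 (LinearMap.ext fun Y => by rw [hφc, h]; simp)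
  obtain ⟨c', hmem, hne, hord, hlow⟩ := hB (g.annih P) (by
    rintro _ ⟨c, _, rfl⟩
    exact Submodule.sum_mem _ fun j _ => Submodule.smul_mem _ _ (Submodule.subset_span ⟨j, rfl⟩)) (by
    rintro _ ⟨c, hc, rfl⟩
    refine ⟨g.ddual c, fun s => ?_, (g.D_con c).symm⟩
    rw [ddual_dot, hc s, map_zero, zero_sub, neg_eq_zero]
    have := hc (s + 1)
    rwa [Function.iterate_succ_apply'] at this) (by
    refine (Submodule.ne_bot_iff _).2 ⟨g.con c, ⟨c, fun s => by rw [← hφc, hφ], rfl⟩, fun h => hc0 ?_⟩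
    exact g.con_injective (h.trans (by simp [con])))
  obtain ⟨c'', hc'', heq⟩ := hmem
  obtain rfl := g.con_injective (c := c'') (c' := c') heq
  have h1 : zl Q * (∑ j, c'' j • g.w j) =
      ∑ j, algebraMap Rat1 Lau (c'' j) * (zl Q * g.w j - emb P j) := by
    have h2 := congrArg (algebraMap Rat1 Lau) (hc'' 0)
    simp only [map_sum, map_mul, map_zero, Function.iterate_zero, id_eq] at h2
    simp only [mul_sub, Finset.sum_sub_distrib, emb, h2, sub_zero, Finset.mul_sum, Algebra.smul_def]
    exact Finset.sum_congr rfl fun j _ => by ring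
  have h3 : LB (-B + (N + l + 1)) (zl Q * (∑ j, c'' j • g.w j)) := by
    rw [h1]
    exact LB.sum fun j _ => LB.mul (fun m hm => hlow j m hm) (hR j)
  have hzQ : zl Q ≠ 0 := by simpa using zl_injective.ne hQ
  have h4 : (zl Q).order ≤ N := by
    refine HahnSeries.order_le_of_coeff_ne_zero (g := (Q.natDegree : ℤ)) ?_ |>.trans (by exact_mod_cast hQN)
    rw [zl_coeff]
    simpa using hQ
  have h5 : (zl Q * (∑ j, c'' j • g.w j)).coeff ((zl Q).order + (∑ j, c'' j • g.w j).order) ≠ 0 := by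
    rw [← HahnSeries.order_mul hzQ hne]
    exact HahnSeries.coeff_order_eq_zero.not.2 (mul_ne_zero hzQ hne)
  exact h5 (h3 _ (by lia))

end GSys

/-- The bound for the determinants in the Padé construction. -/
def padeBound (n t : ℕ) (C c : ℝ) (S : ℕ) : ℝ :=
  let l := t * (S + n)
  let N := 2 * n * l
  let A := (C ^ 2) ^ (N + l + 1)
  n.factorial * (n.factorial * (c * ((N + 1) * (2 ^ N * ((N + 1) * A))) * ((N + l + 1) * A))) ^ n

lemma GB.comp {b : ℕ → ℝ} (hb : GB b) {φ : ℕ → ℕ} (u v : ℕ) (h : ∀ s, φ s = u * s + v) :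
    GB fun s => b (φ s) := by
  simpa only [h] using hb.affine u v

lemma GB.succ : GB fun s => (s : ℝ) + 1 := by
  simpa using GB.natCast.add (GB.const 1)

lemma GB_padeBound (n t : ℕ) (C c : ℝ) (hc : 0 ≤ c) : GB (padeBound n t C c) := by
  have hN : ∀ s, 2 * n * (t * (s + n)) = (2 * n * t) * s + 2 * n * (t * n) := fun s => by ring
  have hM : ∀ s, 2 * n * (t * (s + n)) + t * (s + n) =
    (2 * n * t + t) * s + (2 * n * (t * n) + t * n) := fun s => by ring
  have h1 := GB.succ.comp _ _ hN
  have h2 : GB fun s => (2:ℝ) ^ (2 * n * (t * (s + n))) := (GB.powr 2).comp _ _ hN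
  have h3 : GB fun s => (C ^ 2 : ℝ) ^ (2 * n * (t * (s + n)) + t * (s + n) + 1) :=
    (GB.powr (C ^ 2)).comp (2 * n * t + t) (2 * n * (t * n) + t * n + 1) (fun s => by rw [hM]; ring)
  have h4 := GB.succ.comp _ _ hM
  have hA0 : ∀ s, 0 ≤ (C ^ 2 : ℝ) ^ (2 * n * (t * (s + n)) + t * (s + n) + 1) := fun s => by positivity
  have h5 := (GB.const n.factorial).mul ((((GB.const n.factorial).mul (((GB.const c).mul (h1.mul (h2.mul (h1.mul h3 hA0)
    (fun s => by positivity)) (fun s => by positivity)) (fun s => by positivity)).mul (h4.mul h3 hA0)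
    (fun s => by positivity)) (fun s => by positivity))).pow (fun s => by positivity) n)
    (fun s => by positivity)
  refine h5.mono fun s => le_of_eq ?_
  simp only [padeBound]
  push_cast
  ring

namespace GSys

variable {n : ℕ} (g : GSys n)

lemma exists_pade : ∃ C c : ℝ, ∃ t : ℕ, 1 ≤ C ∧ 0 ≤ c ∧ 0 < t ∧ ∃ S₀ : ℕ, ∀ S ≥ S₀, 0 < n →
    ∃ (δ : ℕ) (p : ℤ[X]), p ≠ 0 ∧ 1 ≤ δ ∧ (δ : ℝ) ≤ C ^ (2 * n * (t * (S + n)) + t * (S + n) + 1) ∧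
      l1 p ≤ padeBound n t C c S ∧ ∀ e : Fin n, g.Good δ S (zl p • Pi.single e 1) := by
  obtain ⟨C, hC, har⟩ := g.arith
  obtain ⟨B, hB⟩ := g.exists_linearIndependent_bound
  let t : ℕ := 1 + g.T.natDegree + ∑ i, ∑ j, (g.G i j).natDegree
  have htT : g.T.natDegree ≤ t := by simp only [t]; lia
  have htG : ∀ i j, (g.G i j).natDegree ≤ t := by
    intro i j
    have h1 := Finset.single_le_sum (f := fun j => (g.G i j).natDegree) (fun _ _ => Nat.zero_le _) (Finset.mem_univ j)
    have h2 := Finset.single_le_sum (f := fun i => ∑ j, (g.G i j).natDegree) (fun _ _ => Nat.zero_le _) (Finset.mem_univ i)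
    simp only [t] at h1 h2 ⊢
    lia
  have ht : 0 < t := by simp only [t]; lia
  refine ⟨C, (l1 g.T + 1) ^ n, t, hC, by have := l1_nonneg g.T; positivity, ht, (2 * B).toNat, fun S hS hn => ?_⟩
  obtain ⟨l, hl⟩ : ∃ l, l = t * (S + n) := ⟨_, rfl⟩
  obtain ⟨N, hN⟩ : ∃ N, N = 2 * n * l := ⟨_, rfl⟩
  have hl0 : 0 < l := hl ▸ Nat.mul_pos ht (by lia)
  obtain ⟨δ, hδ1, hδC, hδ⟩ := har (N + l)
  rw [← hl, ← hN]
  choose! u hu using fun i k hk => (hδ i k hk).1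
  set A : ℝ := (C ^ 2) ^ (N + l + 1) with hA
  have hA1 : 1 ≤ A := one_le_pow₀ (one_le_pow₀ hC)
  have huA : ∀ i m, m ≤ N + l → |(u i m : ℝ)| ≤ A := by
    intro i m hm
    have h1 : ((u i m : ℚ) : ℝ) = δ * ((PowerSeries.coeff m (g.W i) : ℚ) : ℝ) := by
      rw [← hu i m hm]; push_cast; ring
    rw [Rat.cast_intCast] at h1
    rw [h1, abs_mul, Nat.abs_cast, hA, ← pow_mul, mul_comm 2, pow_mul, sq]
    exact mul_le_mul hδC (hδ i m hm).2 (abs_nonneg _) (by positivity)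
  obtain ⟨Q, hQ0, hQd, hQc, hQ⟩ := exists_pade_denominator hn hl0 u A hA1 (by rw [← hN]; exact huA)
  rw [← hN] at hQd hQ
  have hN' : (2 * (n : ℝ) * l + 1) = N + 1 := by rw [hN]; push_cast; ring
  rw [hN'] at hQc
  let P : Fin n → ℚ[X] := fun i => ∑ k ∈ Finset.range (N + 1), monomial k ((zl Q * g.w i).coeff k)
  have hPc : ∀ i (m : ℕ), (P i).coeff m = if m ≤ N then (zl Q * g.w i).coeff m else 0 := by
    intro i m
    simp only [P, finsetSum_coeff, coeff_monomial, Finset.sum_ite_eq', Finset.mem_range, Nat.lt_succ_iff]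
  let Pr : Fin n → Rat1 := fun i => algebraMap ℚ[X] Rat1 (P i)
  have hemb : ∀ i, emb Pr i = pl (P i) := fun i => by
    simp only [emb, Pr, ← IsScalarTower.algebraMap_apply]
  have hw0 : ∀ i, LB 0 (g.w i) := fun i m hm => by rw [w, PowerSeries.coeff_coe, if_pos hm]
  have hP0 : ∀ i, LB 0 (emb Pr i) := by
    intro i m hm
    rw [hemb, pl_eq, PowerSeries.coeff_coe, if_pos hm]
  have hPN : ∀ i, UB N (emb Pr i) := by
    intro i m hm
    lift m to ℕ using by lia
    rw [hemb, pl_coeff_nat, hPc, if_neg (by lia)]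
  have hR : ∀ i, LB (N + l + 1) (zl Q * g.w i - emb Pr i) := by
    intro i m hm
    rw [HahnSeries.coeff_sub]
    rcases lt_or_ge m 0 with h | h
    · rw [hP0 i m h, (hw0 i).zl_mul Q m h, sub_zero]
    lift m to ℕ using h
    rw [hemb, pl_coeff_nat, hPc]
    split_ifs with hmN
    · rw [sub_self]
    rw [sub_zero, zl_mul_coeff]
    have h1 := hQ i m (by lia) (by lia)
    have h2 : (δ : ℚ) * ∑ k ∈ Finset.range (Q.natDegree + 1), (Q.coeff k : ℚ) * (g.w i).coeff ((m : ℤ) - k) = 0 := by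
      rw [Finset.sum_subset (Finset.range_subset_range.2 (show Q.natDegree + 1 ≤ N + 1 by lia)) (fun k _ hk => by
        rw [coeff_eq_zero_of_natDegree_lt (by simpa using hk), Int.cast_zero, zero_mul]), Finset.mul_sum,
        ← Int.cast_zero, ← h1, Int.cast_sum]
      refine Finset.sum_congr rfl fun k hk => ?_
      have hk' := Finset.mem_range.1 hk
      rw [Int.cast_mul, ← hu i (m - k) (by lia), show (m : ℤ) - k = ((m - k : ℕ) : ℤ) by lia, w,
        LaurentSeries.coeff_coe_powerSeries]
      ring
    exact (mul_eq_zero.1 h2).resolve_left (by positivity)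
  have hLI := hB N l Q Pr hQ0 hQd hR (by nlinarith [Int.self_le_toNat (2 * B)])
  let Z : ℕ → Fin n → ℤ[X] := fun s i => ptrunc (N + l)
      (g.T ^ s * hasseDeriv s Q * ∑ k ∈ Finset.range (N + l + 1), monomial k (u i k))
  have hZ : ∀ s ≤ S + n, ∀ i, δ * (zl g.T ^ s * g.dl^[s] (emb Pr) i) = s.factorial * zl (Z s i) := by
    intro s hs i
    exact g.integral_T_pow_dl htT htG N l Q (emb Pr) hP0 hPN hR δ u hu s (by rw [hl, mul_comm]; gcongr) i
  let M : Matrix (Fin n) (Fin n) ℤ[X] := fun i j => (j : ℕ).factorial * Z j i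
  have hM : ∀ i j, zl (M i j) = δ * (zl g.T ^ (j : ℕ) * g.dl^[j] (emb Pr) i) := by
    intro i j
    rw [hZ _ (by lia)]
    simp [M]
  refine ⟨δ, M.det, ?_, hδ1, hδC, ?_, ?_⟩
  · intro hdet
    have h1 : (zr.mapMatrix M).det = 0 := by rw [← RingHom.map_det, hdet, map_zero]
    obtain ⟨v, hv0, hv⟩ := Matrix.exists_mulVec_eq_zero_iff.2 h1
    have h2 : ∀ i j, zr (M i j) = δ * zr g.T ^ (j : ℕ) * g.drat^[j] Pr i := by
      intro i j
      refine algebraMap_rat_injective ?_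
      rw [algebraMap_zr, hM, dl_iterate_emb, map_mul, map_mul, map_pow, algebraMap_zr, map_natCast, mul_assoc]
      rfl
    have h3 := Fintype.linearIndependent_iff.1 hLI (fun j => v j * (δ * zr g.T ^ (j : ℕ))) (by
      ext i
      have h4 := congrFun hv i
      simp only [Matrix.mulVec, dotProduct, RingHom.mapMatrix_apply, Matrix.map_apply, h2] at h4
      rw [Finset.sum_apply, ← h4]
      refine Finset.sum_congr rfl fun j _ => ?_
      rw [Pi.smul_apply, smul_eq_mul]
      ring)
    refine hv0 (funext fun j => ?_)
    refine (mul_eq_zero.1 (h3 j)).resolve_right (mul_ne_zero ?_ (pow_ne_zero _ ?_))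
    · exact_mod_cast (by lia : δ ≠ 0)
    · simpa using zr_injective.ne g.T_ne
  · have hZl : ∀ s < n, ∀ i, l1 (Z s i) ≤
        (l1 g.T + 1) ^ n * ((N + 1) * (2 ^ N * ((N + 1) * A))) * ((N + l + 1) * A) := by
      intro s hs i
      refine (l1_ptrunc_le _ _).trans ((l1_mul_le _ _).trans ?_)
      have hT0 := l1_nonneg g.T
      refine mul_le_mul ((l1_mul_le _ _).trans (mul_le_mul ?_ (l1_hasseDeriv_le _ _ _ _ hQd hQc)
        (l1_nonneg _) (by positivity))) ?_ (l1_nonneg _) (by positivity)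
      · refine (l1_pow_le _ _).trans ?_
        calc l1 g.T ^ s ≤ (l1 g.T + 1) ^ s := by gcongr; linarith
          _ ≤ _ := pow_le_pow_right₀ (by linarith) hs.le
      · refine (l1_sum_le _ _).trans ?_
        refine (Finset.sum_le_sum (g := fun _ => A) fun k hk => ?_).trans ?_
        · rw [l1_monomial]
          exact huA i k (by have := Finset.mem_range.1 hk; lia)
        · simp
    have hb : ∀ i j, l1 (M i j) ≤ n.factorial * ((l1 g.T + 1) ^ n *
        ((N + 1) * (2 ^ N * ((N + 1) * A))) * ((N + l + 1) * A)) := by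
      intro i j
      refine (l1_mul_le _ _).trans (mul_le_mul ?_ (hZl j j.2 i) (l1_nonneg _) (by positivity))
      have h1 : ((j : ℕ).factorial : ℤ[X]) = monomial 0 ((j : ℕ).factorial : ℤ) := by simp
      rw [h1, l1_monomial]
      push_cast
      rw [Nat.abs_cast]
      exact_mod_cast Nat.factorial_le j.2.le
    refine (l1_det_le M _ hb).trans (le_of_eq ?_)
    simp only [padeBound, ← hl, ← hN, ← hA]
  · intro e
    have hgood : ∀ j < n, g.Good δ S (g.dl^[j] (emb Pr)) := by
      intro j hj m hm
      refine ⟨fun i => ((m + 1).ascFactorial j : ℤ[X]) * (g.T ^ (n - j) * Z (m + j) i), fun i => ?_⟩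
      have h1 := hZ (m + j) (by lia) i
      rw [← Function.iterate_add_apply, map_mul, map_mul, map_pow, map_natCast]
      rw [← Nat.factorial_mul_ascFactorial] at h1
      rw [show m + n = (m + j) + (n - j) by lia, pow_add]
      push_cast at h1
      linear_combination (zl g.T ^ (n - j)) * h1
    have hsum : zl M.det • (Pi.single e 1 : Fin n → Lau) =
        ∑ j : Fin n, zl (M.adjugate j e) • zl ((δ : ℤ[X]) * g.T ^ (j : ℕ)) • g.dl^[j] (emb Pr) := by
      ext1 i
      have h1 := congrFun (congrFun (Matrix.mul_adjugate M) i) e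
      rw [Matrix.mul_apply, Matrix.smul_apply, Matrix.one_apply] at h1
      have h2 := congrArg zl h1
      rw [map_sum] at h2
      simp only [map_mul, hM] at h2
      rw [Finset.sum_apply, Pi.smul_apply, Pi.single_apply]
      simp only [Pi.smul_apply, smul_eq_mul, map_mul, map_natCast, map_pow]
      rw [smul_eq_mul, map_mul] at h2
      have h3 : zl (if i = e then 1 else 0) = if i = e then 1 else 0 := by split_ifs <;> simp
      rw [h3] at h2
      rw [← h2]
      exact Finset.sum_congr rfl fun j _ => by ring
    rw [hsum]
    exact Good.sum fun j _ => ((hgood j j.2).zl_smul _).zl_smul _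

end GSys

section Weighted

/-- Coefficients of weight `b m < μ` vanish. -/
def WB (b μ : ℤ) (f : Lau) : Prop := ∀ m, b * m < μ → f.coeff m = 0

/-- The coefficient of weight `b m = μ`. -/
def lc (b μ : ℤ) (f : Lau) : ℚ := if b ∣ μ then f.coeff (μ / b) else 0

variable {b μ ν : ℤ} {f g : Lau}

lemma WB.mono (hf : WB b μ f) (h : ν ≤ μ) : WB b ν f := fun m hm => hf m (by lia)

lemma WB.sub (hf : WB b μ f) (hg : WB b μ g) : WB b μ (f - g) := fun m hm => by
  rw [HahnSeries.coeff_sub, hf m hm, hg m hm, sub_zero]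

lemma WB.sum {ι : Type*} {s : Finset ι} {f : ι → Lau} (hf : ∀ i ∈ s, WB b μ (f i)) :
    WB b μ (∑ i ∈ s, f i) := fun m hm => by
  rw [HahnSeries.coeff_sum]
  exact Finset.sum_eq_zero fun i hi => hf i hi m hm

lemma WB.D (hf : WB b μ f) : WB b (μ - b) (D f) := fun m hm => by
  rw [D_coeff, hf (m + 1) (by linarith), mul_zero]

lemma lc_sub : lc b μ (f - g) = lc b μ f - lc b μ g := by
  simp only [lc]; split_ifs <;> simp

lemma lc_sum {ι : Type*} {s : Finset ι} {f : ι → Lau} :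
    lc b μ (∑ i ∈ s, f i) = ∑ i ∈ s, lc b μ (f i) := by
  simp only [lc]; split_ifs
  · rw [HahnSeries.coeff_sum]
  · simp

lemma lc_eq_zero (hf : WB b μ f) (h : ν < μ) : lc b ν f = 0 := by
  simp only [lc]
  split_ifs with hd
  · exact hf _ (by rwa [Int.mul_ediv_cancel' hd])
  · rfl

lemma lc_mul_right (hb : 0 < b) (m : ℤ) : lc b (b * m) f = f.coeff m := by
  rw [lc, if_pos (dvd_mul_right _ _), Int.mul_ediv_cancel_left _ hb.ne']

lemma WB.mul (hf : WB b μ f) (hg : WB b ν g) : WB b (μ + ν) (f * g) := fun m hm => by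
  rw [HahnSeries.coeff_mul]
  refine Finset.sum_eq_zero fun ij hij => ?_
  have h : ij.1 + ij.2 = m := (Finset.mem_antidiagonal.1 hij).2.2
  rcases lt_or_ge (b * ij.1) μ with h1 | h1
  · rw [hf _ h1, zero_mul]
  · rw [hg _ (by rw [← h, mul_add] at hm; lia), mul_zero]

lemma lc_mul (hb : 0 < b) (hf : WB b μ f) (hg : WB b ν g) : lc b (μ + ν) (f * g) = lc b μ f * lc b ν g := by
  by_cases hd : b ∣ μ
  · obtain ⟨c, rfl⟩ := hd
    by_cases hd' : b ∣ ν
    · obtain ⟨e, rfl⟩ := hd'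
      rw [← mul_add, lc_mul_right hb, lc_mul_right hb, lc_mul_right hb]
      exact coeff_mul_add (fun m hm => hf m (by nlinarith)) (fun m hm => hg m (by nlinarith))
    · rw [lc, if_neg (by rwa [dvd_add_right (dvd_mul_right _ _)]), lc.eq_1 b ν, if_neg hd', mul_zero]
  · rw [lc.eq_1 b μ f, if_neg hd, zero_mul]
    by_cases hs : b ∣ μ + ν
    · obtain ⟨q, hq⟩ := hs
      rw [hq, lc_mul_right hb, HahnSeries.coeff_mul]
      refine Finset.sum_eq_zero fun ij hij => ?_
      have h : ij.1 + ij.2 = q := (Finset.mem_antidiagonal.1 hij).2.2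
      rcases lt_trichotomy (b * ij.1) μ with h1 | h1 | h1
      · rw [hf _ h1, zero_mul]
      · exact (hd ⟨_, h1.symm⟩).elim
      · rw [hg _ (by rw [← h, mul_add] at hq; lia), mul_zero]
    · rw [lc, if_neg hs]

end Weighted

section Companion

variable {n : ℕ}

/-- The companion matrix with last row `c`. -/
def comp (c : Fin n → ℚ) (v : Fin n → ℚ) : Fin n → ℚ :=
  fun i => if h : (i : ℕ) + 1 < n then v ⟨i + 1, h⟩ else ∑ j, c j * v j

lemma abs_comp_iterate_le (c v : Fin n → ℚ) (B : ℚ) (hv : ∀ i, |v i| ≤ B) (S : ℕ) (i : Fin n) :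
    |(comp c)^[S] v i| ≤ B * (1 + ∑ j, |c j|) ^ S := by
  have h0 : 0 ≤ ∑ j, |c j| := Finset.sum_nonneg fun _ _ => abs_nonneg _
  have hB : 0 ≤ B := (abs_nonneg _).trans (hv i)
  induction S generalizing i with
  | zero => simpa using hv i
  | succ S ih =>
    rw [Function.iterate_succ_apply', comp, pow_succ, ← mul_assoc]
    split_ifs with h
    · exact (ih _).trans (le_mul_of_one_le_right (by positivity) (by linarith))
    · refine (Finset.abs_sum_le_sum_abs _ _).trans ?_
      rw [mul_add, mul_one, Finset.mul_sum]
      refine le_trans (Finset.sum_le_sum fun j _ => ?_) (le_add_of_nonneg_left (by positivity))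
      rw [abs_mul, mul_comm]
      exact mul_le_mul_of_nonneg_right (ih j) (abs_nonneg _)

lemma exists_comp_iterate_ne_zero (c v : Fin n → ℚ) (j₁ : Fin n) (hj : c j₁ ≠ 0) (hmin : ∀ j < j₁, c j = 0)
    (hv : ∃ k, j₁ ≤ k ∧ v k ≠ 0) (S : ℕ) : ∃ k, j₁ ≤ k ∧ (comp c)^[S] v k ≠ 0 := by
  induction S with
  | zero => exact hv
  | succ S ih =>
    rw [Function.iterate_succ_apply']
    set u := (comp c)^[S] v
    by_cases hk : ∃ k, j₁ < k ∧ u k ≠ 0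
    · obtain ⟨k, hk, hu⟩ := hk
      have hk' : (j₁ : ℕ) < k := hk
      refine ⟨⟨k - 1, by lia⟩, Fin.le_def.2 (by simp only; lia), ?_⟩
      rw [comp, dif_pos (by simp only; lia)]
      convert hu using 2
      ext; simp only; lia
    · push Not at hk
      obtain ⟨k, hk1, hk2⟩ := ih
      have hj1 : u j₁ ≠ 0 := by
        rcases eq_or_lt_of_le hk1 with h | h
        · rwa [h]
        · exact (hk2 (hk k h)).elim
      refine ⟨⟨n - 1, by lia⟩, Fin.le_def.2 (by simp only; lia), ?_⟩
      rw [comp, dif_neg (by simp only; lia), Finset.sum_eq_single j₁]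
      · exact mul_ne_zero hj hj1
      · intro j _ hne
        rcases lt_or_gt_of_ne hne with h | h
        · rw [hmin j h, zero_mul]
        · rw [hk j h, mul_zero]
      · simp

end Companion

namespace GSys
variable {n : ℕ} (g : GSys n)

/-- The system is a companion system with last row `γ`. -/
def IsCompanion (γ : Fin n → Rat1) : Prop := ∀ Y : Fin n → Lau, ∀ i : Fin n,
  g.dl Y i = EFun.D (Y i) - if h : (i : ℕ) + 1 < n then Y ⟨i + 1, h⟩ else ∑ j, algebraMap Rat1 Lau (γ j) * Y j

variable {g} {γ : Fin n → Rat1} {a b : ℤ}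

lemma weight_dl (hγ : g.IsCompanion γ) (hb : 0 < b) (hab : b < a)
    (hw : ∀ j : Fin n, WB b (-(a * (n - (j : ℕ)))) (algebraMap Rat1 Lau (γ j))) {ρ : ℤ} {Y : Fin n → Lau}
    (hY : ∀ i : Fin n, WB b (ρ - a * (i : ℕ)) (Y i)) (i : Fin n) :
    WB b (ρ - a - a * (i : ℕ)) (g.dl Y i) ∧ lc b (ρ - a - a * (i : ℕ)) (g.dl Y i) =
      - comp (fun j => lc b (-(a * (n - (j : ℕ)))) (algebraMap Rat1 Lau (γ j)))
        (fun j => lc b (ρ - a * (j : ℕ)) (Y j)) i := by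
  rw [hγ, lc_sub, lc_eq_zero (hY i).D (by linarith), zero_sub, comp]
  have hD : WB b (ρ - a - a * (i : ℕ)) (EFun.D (Y i)) := (hY i).D.mono (by linarith)
  split_ifs with h
  · have h1 := hY ⟨i + 1, h⟩
    have h2 : ρ - a - a * (i : ℕ) = ρ - a * ((i + 1 : ℕ) : ℤ) := by push_cast; ring
    refine ⟨hD.sub (by rw [h2]; exact h1), ?_⟩
    rw [h2]
  · have h2 : ∀ j : Fin n, ρ - a - a * (i : ℕ) = -(a * (n - (j : ℕ))) + (ρ - a * (j : ℕ)) := by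
      intro j
      have : (n : ℤ) = (i : ℕ) + 1 := by have := i.2; omega
      rw [this]; ring
    refine ⟨hD.sub (WB.sum fun j _ => by rw [h2 j]; exact (hw j).mul (hY j)), ?_⟩
    rw [lc_sum]
    congr 1
    refine Finset.sum_congr rfl fun j _ => ?_
    rw [h2 j, lc_mul hb (hw j) (hY j)]

lemma weight_dl_iterate (hγ : g.IsCompanion γ) (hb : 0 < b) (hab : b < a)
    (hw : ∀ j : Fin n, WB b (-(a * (n - (j : ℕ)))) (algebraMap Rat1 Lau (γ j))) {ρ : ℤ} {Y : Fin n → Lau}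
    (hY : ∀ i : Fin n, WB b (ρ - a * (i : ℕ)) (Y i)) (S : ℕ) :
    (∀ i : Fin n, WB b (ρ - a * S - a * (i : ℕ)) (g.dl^[S] Y i)) ∧
      (fun i : Fin n => lc b (ρ - a * S - a * (i : ℕ)) (g.dl^[S] Y i)) =
      (-1) ^ S • (comp (fun j => lc b (-(a * (n - (j : ℕ)))) (algebraMap Rat1 Lau (γ j))))^[S]
        (fun j => lc b (ρ - a * (j : ℕ)) (Y j)) := by
  have hneg : ∀ (c v : Fin n → ℚ) (e : ℤ), comp c (e • v) = e • comp c v := by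
    intro c v e
    ext i
    simp only [comp, Pi.smul_apply]
    split_ifs
    · rfl
    · rw [Finset.smul_sum]
      exact Finset.sum_congr rfl fun j _ => by rw [mul_smul_comm]
  induction S with
  | zero => simpa using hY
  | succ S ih =>
    obtain ⟨h1, h2⟩ := ih
    have h3 := weight_dl hγ hb hab hw h1
    rw [h2] at h3
    have h4 : ρ - a * ((S + 1 : ℕ) : ℤ) = ρ - a * S - a := by push_cast; ring
    rw [Function.iterate_succ_apply', Function.iterate_succ_apply', h4]
    refine ⟨fun i => (h3 i).1, ?_⟩
    ext i
    rw [(h3 i).2, hneg, pow_succ, mul_neg_one, neg_smul]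
    rfl

end GSys

lemma LB_pow {a : ℤ} {f : Lau} (hf : LB a f) (k : ℕ) :
    LB (k * a) (f ^ k) ∧ (f ^ k).coeff (k * a) = f.coeff a ^ k := by
  induction k with
  | zero =>
    refine ⟨fun m hm => ?_, by simp⟩
    rw [pow_zero, HahnSeries.coeff_one, if_neg (by rintro rfl; simp at hm)]
  | succ k ih =>
    rw [pow_succ, show ((k + 1 : ℕ) : ℤ) * a = k * a + a by push_cast; ring]
    exact ⟨ih.1.mul hf, by rw [coeff_mul_add ih.1 hf, ih.2, pow_succ]⟩

lemma LB_zl (p : ℤ[X]) : LB p.natTrailingDegree (zl p) := fun m hm => by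
  rcases lt_or_ge m 0 with h | h
  · exact zl_coeff_neg _ _ h
  · lift m to ℕ using h
    rw [zl_coeff, coeff_eq_zero_of_lt_natTrailingDegree (by exact_mod_cast hm), Int.cast_zero]

lemma exists_int_coeff_zl (p : ℤ[X]) (m : ℤ) : ∃ z : ℤ, (zl p).coeff m = z := by
  rcases lt_or_ge m 0 with h | h
  · exact ⟨0, by rw [zl_coeff_neg _ _ h, Int.cast_zero]⟩
  · lift m to ℕ using h
    exact ⟨_, zl_coeff p m⟩

namespace GSys
variable {n : ℕ} {g : GSys n} {γ : Fin n → Rat1} {a b : ℤ}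

set_option maxHeartbeats 400000 in
lemma false_of_weight (hγ : g.IsCompanion γ) (hb : 0 < b) (hab : b < a)
    (hw : ∀ j : Fin n, WB b (-(a * (n - (j : ℕ)))) (algebraMap Rat1 Lau (γ j)))
    (hne : ∃ j : Fin n, lc b (-(a * (n - (j : ℕ)))) (algebraMap Rat1 Lau (γ j)) ≠ 0) : False := by
  set c : Fin n → ℚ := fun j => lc b (-(a * (n - (j : ℕ)))) (algebraMap Rat1 Lau (γ j)) with hc
  obtain ⟨j₁, hj₁, hmin⟩ := wellFounded_lt.has_min {j | c j ≠ 0} hne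
  have hmin' : ∀ j < j₁, c j = 0 := fun j hj => by
    by_contra h
    exact hmin j h hj
  have hn : 0 < n := j₁.pos
  obtain ⟨C, c', t, hC, hc', ht, S₀, hS₀⟩ := g.exists_pade
  set t₀ : ℝ := |((g.T.coeff g.T.natTrailingDegree : ℤ) : ℝ)| with ht₀
  set κ : ℝ := ((1 + ∑ j, |c j| : ℚ) : ℝ) with hκ
  have hκ0 : 0 ≤ κ := by
    rw [hκ]
    exact_mod_cast (add_nonneg zero_le_one (Finset.sum_nonneg fun _ _ => abs_nonneg _))
  have main : ∀ S ≥ S₀, (S.factorial : ℝ) ≤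
      C ^ (2 * n * (t * (S + n)) + t * (S + n) + 1) * (t₀ ^ (S + n) * (padeBound n t C c' S * κ ^ S)) := by
    intro S hS
    obtain ⟨δ, p, hp0, hδ1, hδ, hp, hgood⟩ := hS₀ S hS hn
    let e : Fin n := ⟨n - 1, by lia⟩
    obtain ⟨Z, hZ⟩ := hgood e S le_rfl
    set Y : Fin n → Lau := zl p • Pi.single e 1 with hYdef
    have hYe : Y e = zl p := by simp [hYdef]
    have hYne : ∀ i ≠ e, Y i = 0 := fun i hi => by simp [hYdef, hi]
    set ρ : ℤ := b * p.natTrailingDegree + a * (e : ℕ) with hρ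
    have hY : ∀ i : Fin n, WB b (ρ - a * (i : ℕ)) (Y i) := by
      intro i
      by_cases hi : i = e
      · rw [hi, hYe, hρ, add_sub_cancel_right]
        exact fun m hm => LB_zl p m (by nlinarith)
      · rw [hYne i hi]; exact fun m _ => rfl
    set v : Fin n → ℚ := fun j => lc b (ρ - a * (j : ℕ)) (Y j) with hv
    have hve : v e = p.coeff p.natTrailingDegree := by
      rw [hv]
      simp only
      rw [hYe, hρ, add_sub_cancel_right, lc_mul_right hb, zl_coeff]
    have hvne : ∀ i ≠ e, v i = 0 := fun i hi => by
      rw [hv]; simp only; rw [hYne i hi, lc]; split_ifs <;> rfl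
    have hpt : p.coeff p.natTrailingDegree ≠ 0 := by
      rw [coeff_natTrailingDegree_eq_zero.ne]; exact hp0
    have hve0 : v e ≠ 0 := by rw [hve]; exact_mod_cast hpt
    have hvb : ∀ i, |v i| ≤ |v e| := by
      intro i
      by_cases hi : i = e
      · rw [hi]
      · rw [hvne i hi, abs_zero]; exact abs_nonneg _
    obtain ⟨hW1, hW2⟩ := weight_dl_iterate hγ hb hab hw hY S
    obtain ⟨k, -, hk⟩ := exists_comp_iterate_ne_zero c v j₁ hj₁ hmin'
      ⟨e, Fin.le_def.2 (by simp only [e]; lia), hve0⟩ S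
    have hlc := congrFun hW2 k
    rw [Pi.smul_apply] at hlc
    have habs : |lc b (ρ - a * S - a * (k : ℕ)) (g.dl^[S] Y k)| = |(comp c)^[S] v k| := by
      rw [hlc]
      rcases neg_one_pow_eq_or ℤ S with h | h <;> rw [h]
      · rw [one_smul]
      · rw [neg_smul, one_smul, abs_neg]
    have hdvd : b ∣ ρ - a * S - a * (k : ℕ) := by
      by_contra h
      rw [lc, if_neg h, abs_zero] at habs
      exact hk (abs_eq_zero.1 habs.symm)
    obtain ⟨m, hm⟩ := hdvd
    have hlow : LB m (g.dl^[S] Y k) := fun m' hm' => hW1 k m' (by rw [hm]; nlinarith)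
    rw [hm, lc_mul_right hb] at habs
    obtain ⟨hT1, hT2⟩ := LB_pow (LB_zl g.T) (S + n)
    have hcoef := congrArg (fun f : Lau => f.coeff (((S + n : ℕ) : ℤ) * g.T.natTrailingDegree + m)) (hZ k)
    simp only [natCast_mul_coeff] at hcoef
    rw [coeff_mul_add hT1 hlow, hT2, zl_coeff] at hcoef
    obtain ⟨z, hz⟩ := exists_int_coeff_zl (Z k) (((S + n : ℕ) : ℤ) * g.T.natTrailingDegree + m)
    rw [hz] at hcoef
    have hTt : g.T.coeff g.T.natTrailingDegree ≠ 0 := by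
      rw [coeff_natTrailingDegree_eq_zero.ne]; exact g.T_ne
    have hz0 : z ≠ 0 := by
      rintro rfl
      rw [Int.cast_zero, mul_zero] at hcoef
      have hcm : (g.dl^[S] Y k).coeff m ≠ 0 := fun h => by
        rw [h, abs_zero] at habs
        exact hk (abs_eq_zero.1 habs.symm)
      have h1 : (δ : ℚ) ≠ 0 := by positivity
      have h2 : (g.T.coeff g.T.natTrailingDegree : ℚ) ≠ 0 := by exact_mod_cast hTt
      exact mul_ne_zero h1 (mul_ne_zero (pow_ne_zero _ h2) hcm) hcoef
    have hz1 : (1 : ℝ) ≤ |(z : ℝ)| := by exact_mod_cast Int.one_le_abs hz0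
    have hR := congrArg (fun q : ℚ => |(q : ℝ)|) hcoef
    simp only [Rat.cast_mul, Rat.cast_natCast, Rat.cast_pow, Rat.cast_intCast, abs_mul, abs_pow, Nat.abs_cast] at hR
    have hcm : |((g.dl^[S] Y k).coeff m : ℝ)| ≤ padeBound n t C c' S * κ ^ S := by
      have h1 := abs_comp_iterate_le c v |v e| hvb S k
      rw [← habs, hve] at h1
      have h2 : |((g.dl^[S] Y k).coeff m : ℝ)| ≤ |(p.coeff p.natTrailingDegree : ℝ)| * κ ^ S := by
        rw [hκ]; exact_mod_cast h1
      refine h2.trans (mul_le_mul_of_nonneg_right ((abs_coeff_le_l1 _ _).trans hp) (pow_nonneg hκ0 _))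
    have h1 : (S.factorial : ℝ) ≤ S.factorial * |(z : ℝ)| :=
      le_mul_of_one_le_right (Nat.cast_nonneg _) hz1
    refine h1.trans (hR.symm.le.trans ?_)
    refine mul_le_mul hδ (mul_le_mul_of_nonneg_left hcm (by positivity)) (by positivity)
      (by positivity)
  have hpade : ∀ S, 0 ≤ padeBound n t C c' S := fun S => by
    simp only [padeBound]; positivity
  have hB : GB fun S => C ^ (2 * n * (t * (S + n)) + t * (S + n) + 1) *
      (t₀ ^ (S + n) * (padeBound n t C c' S * κ ^ S)) := by
    refine ((GB.powr C).comp (φ := fun S => 2 * n * (t * (S + n)) + t * (S + n) + 1)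
      (2 * n * t + t) (2 * n * (t * n) + t * n + 1) fun s => by ring).mul ?_ fun s => ?_
    · refine ((GB.powr t₀).comp (φ := fun S => S + n) 1 n fun s => by ring).mul ?_ fun s => ?_
      · exact (GB_padeBound n t C c' hc').mul (GB.powr κ) fun s => pow_nonneg hκ0 _
      · exact mul_nonneg (hpade s) (pow_nonneg hκ0 _)
    · exact mul_nonneg (by positivity) (mul_nonneg (hpade s) (pow_nonneg hκ0 _))
  refine not_GB_factorial (((GB.const S₀.factorial).add hB).mono fun S => ?_)
  rcases lt_or_ge S S₀ with h | h
  · refine (Nat.cast_le.2 (Nat.factorial_le h.le)).trans (le_add_of_nonneg_right ?_)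
    exact mul_nonneg (by positivity) (mul_nonneg (by positivity)
      (mul_nonneg (hpade S) (pow_nonneg hκ0 _)))
  · exact (main S h).trans (le_add_of_nonneg_left (Nat.cast_nonneg _))

end GSys

namespace GSys
variable {n : ℕ} {g : GSys n} {γ : Fin n → Rat1}

lemma pole_bound (hγ : g.IsCompanion γ) (j : Fin n) :
    LB (-((n : ℤ) - (j : ℕ))) (algebraMap Rat1 Lau (γ j)) := by
  by_contra hcon
  simp only [LB] at hcon
  push Not at hcon
  obtain ⟨m, hm, hm0⟩ := hcon
  set ord : Fin n → ℤ := fun j => (algebraMap Rat1 Lau (γ j)).order with hord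
  have hpos : ∀ j : Fin n, 0 < (n : ℤ) - (j : ℕ) := fun j => by have := j.2; omega
  classical
  obtain ⟨j₀, hj₀, hmax⟩ := Finset.exists_max_image
    (Finset.univ.filter fun j => algebraMap Rat1 Lau (γ j) ≠ 0)
    (fun j => (-(ord j) : ℚ) / ((n : ℤ) - (j : ℕ) : ℤ))
    ⟨j, by simp only [Finset.mem_filter_univ]; intro h; simp [h] at hm0⟩
  simp only [Finset.mem_filter_univ] at hj₀ hmax
  have hmax' : ∀ j, algebraMap Rat1 Lau (γ j) ≠ 0 →
      -ord j * ((n : ℤ) - (j₀ : ℕ)) ≤ -ord j₀ * ((n : ℤ) - (j : ℕ)) := fun j hj => by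
    have h := hmax j hj
    rw [div_le_div_iff₀ (by exact_mod_cast hpos j) (by exact_mod_cast hpos j₀)] at h
    exact_mod_cast h
  have hjm : ord j ≤ m := HahnSeries.order_le_of_coeff_ne_zero hm0
  have h1 := hmax' j fun h => by simp [h] at hm0
  have h2 := hpos j
  have h3 := hpos j₀
  refine g.false_of_weight hγ (a := -ord j₀) h3 ?_ (fun i m' hm' => ?_) ⟨j₀, ?_⟩
  · by_contra hle
    have hle' : -ord j₀ ≤ (n : ℤ) - (j₀ : ℕ) := not_lt.1 hle
    nlinarith
  · by_cases hi : algebraMap Rat1 Lau (γ i) = 0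
    · rw [hi]; rfl
    · refine HahnSeries.coeff_eq_zero_of_lt_order ?_
      have h4 := hmax' i hi
      change m' < ord i
      by_contra hle
      nlinarith [hpos i]
  · rw [show -(-ord j₀ * ((n : ℤ) - (j₀ : ℕ))) = ((n : ℤ) - (j₀ : ℕ)) * ord j₀ by ring, lc_mul_right h3]
    exact fun h => hj₀ (HahnSeries.coeff_order_eq_zero.1 h)

end GSys

/-- Geometric growth of coefficients and of their common denominators. -/
def Geom (a : ℕ → ℚ) : Prop := ∃ C : ℝ, 1 ≤ C ∧ ∀ N : ℕ, ∃ δ : ℕ, 1 ≤ δ ∧ (δ : ℝ) ≤ C ^ (N + 1) ∧ ∀ l ≤ N,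
    (∃ z : ℤ, δ * a l = z) ∧ |((a l : ℚ) : ℝ)| ≤ C ^ (N + 1)

lemma D_iterate_coe (f : PowerSeries ℚ) (i : ℕ) :
    D^[i] (f : Lau) = (((PowerSeries.derivative ℚ)^[i] f : PowerSeries ℚ) : Lau) := by
  induction i with
  | zero => rfl
  | succ i ih => rw [Function.iterate_succ_apply', ih, D_coe, Function.iterate_succ_apply']

lemma exists_int_mul (p : ℚ[X]) :
    ∃ b : ℤ, b ≠ 0 ∧ ∃ p' : ℤ[X], mapRingHom (Int.castRingHom ℚ) p' = (b : ℚ[X]) * p := by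
  obtain ⟨b, hb, h⟩ := IsLocalization.integerNormalization_spec (nonZeroDivisors ℤ) p
  refine ⟨b, nonZeroDivisors.ne_zero hb, _, h.trans ?_⟩
  ext n
  simp [← zsmul_eq_mul]

lemma exists_zr_denominator {ι : Type*} [Finite ι] (Γ : ι → Rat1) :
    ∃ T : ℤ[X], T ≠ 0 ∧ X ∣ T ∧ ∀ i, ∃ G : ℤ[X], zr T * Γ i = zr G := by
  classical
  cases nonempty_fintype ι
  have key : ∀ c : Rat1, ∃ T : ℤ[X], T ≠ 0 ∧ ∃ G : ℤ[X], zr T * c = zr G := by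
    intro c
    obtain ⟨p, q, hq, rfl⟩ := IsFractionRing.div_surjective (A := ℚ[X]) c
    have hq0 : q ≠ 0 := nonZeroDivisors.ne_zero hq
    obtain ⟨b, hb0, p', hp'⟩ := exists_int_mul p
    obtain ⟨e, he0, q', hq'⟩ := exists_int_mul q
    have hq'0 : q' ≠ 0 := by
      rintro rfl
      rw [map_zero] at hq'
      exact mul_ne_zero (by exact_mod_cast he0) hq0 hq'.symm
    refine ⟨(b : ℤ[X]) * q', mul_ne_zero (by exact_mod_cast hb0) hq'0, (e : ℤ[X]) * p', ?_⟩
    have hqr : algebraMap ℚ[X] Rat1 q ≠ 0 := by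
      simpa using (IsFractionRing.injective ℚ[X] Rat1).ne hq0
    simp only [map_mul, map_intCast]
    simp only [zr, RingHom.comp_apply, hp', hq', map_mul, map_intCast]
    field_simp
  choose T hT G hG using fun i => key (Γ i)
  refine ⟨X * ∏ i, T i, mul_ne_zero X_ne_zero (Finset.prod_ne_zero_iff.2 fun i _ => hT i), dvd_mul_right _ _,
    fun i => ⟨X * ((∏ j ∈ Finset.univ.erase i, T j) * G i), ?_⟩⟩
  rw [map_mul, map_mul, map_mul, ← hG, ← Finset.prod_erase_mul _ _ (Finset.mem_univ i), map_mul]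
  ring

lemma Geom.derivative_iterate {f : PowerSeries ℚ} (hf : Geom fun l => PowerSeries.coeff l f) (n : ℕ) :
    ∃ C : ℝ, 1 ≤ C ∧ ∀ N : ℕ, ∃ δ : ℕ, 1 ≤ δ ∧ (δ : ℝ) ≤ C ^ (N + 1) ∧ ∀ i : Fin n, ∀ l ≤ N,
      (∃ z : ℤ, δ * PowerSeries.coeff l ((PowerSeries.derivative ℚ)^[i] f) = z) ∧
      |((PowerSeries.coeff l ((PowerSeries.derivative ℚ)^[i] f) : ℚ) : ℝ)| ≤ C ^ (N + 1) := by
  obtain ⟨C, hC, h⟩ := hf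
  have h2C : (1 : ℝ) ≤ 2 ^ n * C := one_le_mul_of_one_le_of_one_le (one_le_pow₀ one_le_two) hC
  have hle : ∀ N : ℕ, C ^ (N + n + 1) ≤ ((2 ^ n * C) ^ (n + 1)) ^ (N + 1) ∧
      (2 ^ (N + n + 1)) ^ n * C ^ (N + n + 1) ≤ ((2 ^ n * C) ^ (n + 1)) ^ (N + 1) := fun N => by
    have h1 : (2 ^ (N + n + 1)) ^ n * C ^ (N + n + 1) ≤ ((2 ^ n * C) ^ (n + 1)) ^ (N + 1) := by
      rw [← pow_mul, mul_comm (N + n + 1), pow_mul, ← mul_pow, ← pow_mul]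
      exact pow_le_pow_right₀ h2C (by nlinarith)
    exact ⟨le_trans (le_mul_of_one_le_left (by positivity) (one_le_pow₀ (one_le_pow₀ one_le_two))) h1, h1⟩
  refine ⟨(2 ^ n * C) ^ (n + 1), one_le_pow₀ h2C, fun N => ?_⟩
  obtain ⟨δ, hδ1, hδ, hl⟩ := h (N + n)
  refine ⟨δ, hδ1, hδ.trans (hle N).1, fun i l hlN => ?_⟩
  obtain ⟨⟨z, hz⟩, hb⟩ := hl (l + i) (by have := i.2; omega)
  rw [PowerSeries.coeff_iterate_derivative]
  refine ⟨⟨((l + 1).ascFactorial i : ℕ) * z, ?_⟩, ?_⟩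
  · push_cast; rw [← hz]; ring
  · rw [Rat.cast_mul, abs_mul, Rat.cast_natCast, Nat.abs_cast]
    refine le_trans (mul_le_mul ?_ hb (abs_nonneg _) (by positivity)) (hle N).2
    have h1 : (l + 1).ascFactorial i ≤ (2 ^ (N + n + 1)) ^ n := by
      refine (Nat.ascFactorial_le_pow_add _ _).trans ?_
      have h2 : l + i ≤ 2 ^ (N + n + 1) :=
        le_trans (by have := i.2; omega) (Nat.lt_two_pow_self (n := N + n + 1)).le
      exact (Nat.pow_le_pow_left h2 _).trans (Nat.pow_le_pow_right (by positivity) i.2.le)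
    exact_mod_cast h1

lemma exists_companion {A : PowerSeries ℚ} (hol : Hol (A : Lau)) :
    ∃ n, LinearIndependent Rat1 (fun i : Fin n => D^[i] (A : Lau)) ∧
      ∃ γ : Fin n → Rat1, D^[n] (A : Lau) = ∑ j, γ j • D^[j] (A : Lau) := by
  classical
  obtain ⟨V, hV, hD, hAV⟩ := hol
  have hex : ∃ n, ¬ LinearIndependent Rat1 (fun i : Fin (n + 1) => D^[i] (A : Lau)) := by
    by_contra hcon
    push Not at hcon
    have h1 := hcon (Module.finrank Rat1 V)
    have hmem : ∀ i : ℕ, D^[i] (A : Lau) ∈ V := fun i => iterate_mem D hD hAV i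
    have h2 : LinearIndependent Rat1 (fun i : Fin (Module.finrank Rat1 V + 1) => (⟨_, hmem i⟩ : V)) :=
      LinearIndependent.of_comp V.subtype h1
    have h3 := h2.fintype_card_le_finrank
    simp at h3
  have hli : LinearIndependent Rat1 (fun i : Fin (Nat.find hex) => D^[i] (A : Lau)) := by
    rcases h : Nat.find hex with _ | m
    · exact linearIndependent_empty_type
    · have := Nat.find_min hex (m := m) (by lia)
      rwa [not_not] at this
  refine ⟨Nat.find hex, hli, ?_⟩
  have h := Nat.find_spec hex
  rw [linearIndependent_finSucc'] at h
  push Not at h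
  have h' := h hli
  rw [Submodule.mem_span_range_iff_exists_fun] at h'
  obtain ⟨γ, hγ⟩ := h'
  exact ⟨γ, hγ.symm⟩

/-- A power series of geometric type annihilated by a differential operator has a minimal equation
with at most a regular singularity at the origin. -/
theorem exists_fuchsian {A : PowerSeries ℚ} (hol : Hol (A : Lau))
    (hG : Geom fun l => PowerSeries.coeff l A) : ∃ n, ∃ γ : Fin n → Rat1,
      (∀ j : Fin n, LB (-((n : ℤ) - (j : ℕ))) (algebraMap Rat1 Lau (γ j))) ∧
      D^[n] (A : Lau) = ∑ j, γ j • D^[j] (A : Lau) := by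
  obtain ⟨n, hli, γ, hγ⟩ := exists_companion hol
  let Γ : Fin n → Fin n → Rat1 := fun i j =>
    if h : (i : ℕ) + 1 < n then (if j = ⟨i + 1, h⟩ then 1 else 0) else γ j
  obtain ⟨T, hT0, hXT, hT⟩ := exists_zr_denominator (fun ij : Fin n × Fin n => Γ ij.1 ij.2)
  choose G hTG using hT
  let g : GSys n :=
    { W := fun i => (PowerSeries.derivative ℚ)^[i] A
      Γ := Γ
      T := T
      G := fun i j => G (i, j)
      T_ne := hT0
      X_dvd := hXT
      T_mul := fun i j => hTG (i, j)
      flat := fun i => by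
        simp only [← D_iterate_coe, Γ]
        rw [← Function.iterate_succ_apply' D]
        by_cases h : (i : ℕ) + 1 < n
        · simp [h]
        · have : (i : ℕ).succ = n := by have := i.2; omega
          simp only [h, this, hγ, dite_false]
      li := by simpa only [← D_iterate_coe] using hli
      arith := hG.derivative_iterate n }
  refine ⟨n, γ, g.pole_bound fun Y i => ?_, hγ⟩
  rw [GSys.dl, pd_apply]
  congr 1
  change ∑ j, algebraMap Rat1 Lau (Γ i j) * Y j = _
  by_cases h : (i : ℕ) + 1 < n <;> simp [Γ, h]

section Iterate
variable {R V : Type*} [CommRing R] [AddCommGroup V] [Module R V] (δ : V →+ V)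

/-- The span of the first `k` iterated derivatives of `v`. -/
def spanLT (R : Type*) {V : Type*} [CommRing R] [AddCommGroup V] [Module R V] (δ : V →+ V) (v : V) (k : ℕ) :
    Submodule R V :=
  Submodule.span R (Set.range fun i : Fin k => δ^[i] v)

lemma iterate_mem_spanLT (v : V) {i k : ℕ} (h : i < k) : δ^[i] v ∈ spanLT R δ v k :=
  Submodule.subset_span ⟨⟨i, h⟩, rfl⟩

lemma spanLT_mono (v : V) {k l : ℕ} (h : k ≤ l) : spanLT R δ v k ≤ spanLT R δ v l :=
  Submodule.span_le.2 (by rintro _ ⟨i, rfl⟩; exact iterate_mem_spanLT δ v (i.2.trans_le h))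

variable {δ} {d : R → R}

lemma map_mem_of_span (hδ : ∀ (c : R) (v : V), δ (c • v) = d c • v + c • δ v)
    {s : Set V} {U : Submodule R V} (hsU : Submodule.span R s ≤ U)
    (h : ∀ v ∈ s, δ v ∈ U) {w : V} (hw : w ∈ Submodule.span R s) : δ w ∈ U := by
  induction hw using Submodule.span_induction with
  | mem x hx => exact h x hx
  | zero => rw [map_zero]; exact U.zero_mem
  | add x y _ _ h1 h2 => rw [map_add]; exact U.add_mem h1 h2
  | smul c x hx h1 => rw [hδ]; exact U.add_mem (U.smul_mem _ (hsU hx)) (U.smul_mem _ h1)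

lemma map_mem_spanLT (hδ : ∀ (c : R) (v : V), δ (c • v) = d c • v + c • δ v)
    {v w : V} {k : ℕ} (hw : w ∈ spanLT R δ v k) : δ w ∈ spanLT R δ v (k + 1) := by
  refine map_mem_of_span hδ (spanLT_mono δ v k.le_succ) ?_ hw
  rintro _ ⟨i, rfl⟩
  change δ (δ^[i] v) ∈ _
  rw [← Function.iterate_succ_apply' δ]
  exact iterate_mem_spanLT δ v (by have := i.2; omega)

lemma iterate_smul_sub_mem (hδ : ∀ (c : R) (v : V), δ (c • v) = d c • v + c • δ v)
    (c : R) (v : V) (k : ℕ) :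
    δ^[k] (c • v) - c • δ^[k] v ∈ spanLT R δ v k := by
  induction k with
  | zero => simp
  | succ k ih =>
    have h := Submodule.add_mem _ (map_mem_spanLT hδ ih)
      ((spanLT R δ v (k + 1)).smul_mem (d c) (iterate_mem_spanLT δ v k.lt_succ_self))
    rw [map_sub, hδ] at h
    rw [Function.iterate_succ_apply', Function.iterate_succ_apply']
    convert h using 1
    abel

lemma spanLT_stable (hδ : ∀ (c : R) (v : V), δ (c • v) = d c • v + c • δ v)
    {v : V} {k : ℕ} (h : δ^[k] v ∈ spanLT R δ v k) {w : V} (hw : w ∈ spanLT R δ v k) :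
    δ w ∈ spanLT R δ v k := by
  refine map_mem_of_span hδ le_rfl ?_ hw
  rintro _ ⟨i, rfl⟩
  change δ (δ^[i] v) ∈ _
  rw [← Function.iterate_succ_apply' δ]
  rcases Nat.lt_or_ge (i : ℕ).succ k with h1 | h1
  · exact iterate_mem_spanLT δ v h1
  · rwa [show (i : ℕ).succ = k by have := i.2; omega]

end Iterate

section LocalRing

/-- The ideal of polynomials vanishing at `1`. -/
def idOne : Ideal ℚ[X] := Ideal.span {X - C 1}

instance : idOne.IsPrime :=
  (Ideal.span_singleton_prime (X_sub_C_ne_zero 1)).2 (prime_X_sub_C 1)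

lemma mem_idOne {p : ℚ[X]} : p ∈ idOne ↔ p.eval 1 = 0 := by
  rw [idOne, Ideal.mem_span_singleton, dvd_iff_isRoot, IsRoot]

/-- Rational functions regular at `1`. -/
def Loc := Localization.AtPrime idOne

instance : CommRing Loc := inferInstanceAs (CommRing (Localization.AtPrime idOne))

instance : Algebra ℚ[X] Loc := inferInstanceAs (Algebra ℚ[X] (Localization.AtPrime idOne))

instance : IsLocalization.AtPrime Loc idOne :=
  inferInstanceAs (IsLocalization.AtPrime (Localization.AtPrime idOne) idOne)

lemma ne_zero_of_notMem {q : ℚ[X]} (hq : q ∈ idOne.primeCompl) : q ≠ 0 := fun h =>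
  hq (h ▸ idOne.zero_mem)

instance : Algebra Loc Rat1 := (IsLocalization.lift (M := idOne.primeCompl) (S := Loc)
  (g := algebraMap ℚ[X] Rat1) fun q => IsUnit.mk0 _ (by
    simpa using (IsFractionRing.injective ℚ[X] Rat1).ne (ne_zero_of_notMem q.2))).toAlgebra

instance : IsScalarTower ℚ[X] Loc Rat1 :=
  IsScalarTower.of_algebraMap_eq fun p => (IsLocalization.lift_eq _ p).symm

instance : Algebra Loc Lau := ((algebraMap Rat1 Lau).comp (algebraMap Loc Rat1)).toAlgebra

instance : IsScalarTower Loc Rat1 Lau := IsScalarTower.of_algebraMap_eq fun _ => rfl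

instance : IsScalarTower ℚ[X] Loc Lau := IsScalarTower.of_algebraMap_eq fun p => by
  rw [IsScalarTower.algebraMap_apply Loc Rat1 Lau, ← IsScalarTower.algebraMap_apply ℚ[X] Loc Rat1,
    ← IsScalarTower.algebraMap_apply ℚ[X] Rat1 Lau]

lemma exists_D_loc (c : Loc) : ∃ c' : Loc, D (algebraMap Loc Lau c) = algebraMap Loc Lau c' := by
  obtain ⟨p, q, rfl⟩ := IsLocalization.exists_mk'_eq idOne.primeCompl c
  refine ⟨IsLocalization.mk' Loc (derivative p * q - p * derivative (q : ℚ[X])) (q ^ 2), ?_⟩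
  have h0 : pl q ≠ 0 := by simpa using pl_injective.ne (ne_zero_of_notMem q.2)
  have key : ∀ (p : ℚ[X]) (q : idOne.primeCompl), algebraMap Loc Lau (IsLocalization.mk' Loc p q) = pl p / pl q := by
    intro p q
    have h0 : pl q ≠ 0 := by simpa using pl_injective.ne (ne_zero_of_notMem q.2)
    rw [eq_div_iff h0]
    have h := congrArg (algebraMap Loc Lau) (IsLocalization.mk'_spec Loc p q)
    rwa [map_mul, ← IsScalarTower.algebraMap_apply, ← IsScalarTower.algebraMap_apply] at h
  rw [key, key, D_div _ _ h0, D_pl, D_pl]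
  simp only [map_sub, map_mul, SubmonoidClass.coe_pow, map_pow]

/-- The derivation of the local ring. -/
def dLoc (c : Loc) : Loc := (exists_D_loc c).choose

lemma D_algebraMap_loc (c : Loc) : D (algebraMap Loc Lau c) = algebraMap Loc Lau (dLoc c) :=
  (exists_D_loc c).choose_spec

lemma D_smul_loc (c : Loc) (f : Lau) : D (c • f) = dLoc c • f + c • D f := by
  rw [Algebra.smul_def, D_mul, D_algebraMap_loc, Algebra.smul_def, Algebra.smul_def]

lemma D_iterate_smul_sub_mem (c : Loc) (v : Lau) (k : ℕ) :
    D^[k] (c • v) - c • D^[k] v ∈ spanLT Loc D v k := by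
  apply iterate_smul_sub_mem (R := Loc) (V := Lau) (δ := D) (d := dLoc)
  exact D_smul_loc

end LocalRing

section Laplace

local notation "∂" => PowerSeries.derivative ℚ

/-- The exponential generating series of `a`. -/
def ex (a : ℕ → ℚ) : PowerSeries ℚ := PowerSeries.mk fun n => a n / n.factorial

lemma coeff_theta (f : PowerSeries ℚ) (j m : ℕ) :
    PowerSeries.coeff m ((PowerSeries.X : PowerSeries ℚ) ^ j * ∂^[j] f) = m.descFactorial j * PowerSeries.coeff m f := by
  rw [PowerSeries.coeff_X_pow_mul']
  split_ifs with h
  · rw [PowerSeries.coeff_iterate_derivative, Nat.sub_add_cancel h]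
    congr 2
    rw [← Nat.add_descFactorial_eq_ascFactorial, Nat.sub_add_cancel h]
  · rw [Nat.descFactorial_eq_zero_iff_lt.2 (not_le.1 h)]; simp

lemma coeff_iterate_theta_ex (a : ℕ → ℚ) (j e r : ℕ) :
    r.factorial * PowerSeries.coeff r (∂^[e] ((PowerSeries.X : PowerSeries ℚ) ^ j * ∂^[j] (ex a))) =
      (r + e).descFactorial j * a (r + e) := by
  rw [PowerSeries.coeff_iterate_derivative, coeff_theta, ← mul_assoc, ← Nat.cast_mul,
    Nat.factorial_mul_ascFactorial, ex, PowerSeries.coeff_mk]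
  have : ((r + e).factorial : ℚ) ≠ 0 := by positivity
  field_simp

/-- The Laplace transform of an equation with polynomial coefficients in `X` and `X^j ∂^j`. -/
lemma laplace (a : ℕ → ℚ) {n d : ℕ} (ρ : ℕ → ℚ[X]) (hρ : ∀ j, (ρ j).natDegree ≤ d)
    (h : ∑ j ∈ Finset.range (n + 1), (ρ j : PowerSeries ℚ) *
      ((PowerSeries.X : PowerSeries ℚ) ^ j * ∂^[j] (PowerSeries.mk a)) = 0) :
    ∑ j ∈ Finset.range (n + 1), ∑ k ∈ Finset.range (d + 1), PowerSeries.C ((ρ j).coeff k) *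
      ∂^[d - k] ((PowerSeries.X : PowerSeries ℚ) ^ j * ∂^[j] (ex a)) = 0 := by
  ext r
  have hr : (r.factorial : ℚ) ≠ 0 := by positivity
  refine mul_left_cancel₀ hr ?_
  have h' := congrArg (PowerSeries.coeff (r + d)) h
  simp only [map_sum, map_zero] at h' ⊢
  rw [mul_zero, ← h', Finset.mul_sum]
  refine Finset.sum_congr rfl fun j _ => ?_
  rw [PowerSeries.coeff_mul, Finset.mul_sum]
  simp only [coeff_theta, PowerSeries.coeff_mk, PowerSeries.coeff_C_mul, Polynomial.coeff_coe]
  rw [Finset.Nat.sum_antidiagonal_eq_sum_range_succ_mk]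
  refine Eq.trans ?_ (Finset.sum_subset (Finset.range_mono (show d + 1 ≤ (r + d).succ by lia)) ?_)
  · refine Finset.sum_congr rfl fun k hk => ?_
    rw [mul_left_comm, coeff_iterate_theta_ex, show r + (d - k) = r + d - k by
      have := Finset.mem_range.1 hk; lia]
  · intro k _ hk
    rw [coeff_eq_zero_of_natDegree_lt, zero_mul]
    have := hρ j
    have := Finset.mem_range.not.1 hk
    lia

lemma X_loc_isUnit : IsUnit (algebraMap ℚ[X] Loc X) :=
  IsLocalization.map_units (M := idOne.primeCompl) Loc ⟨X, fun h => by simp [mem_idOne] at h⟩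

lemma C_loc_isUnit {c : ℚ} (hc : c ≠ 0) : IsUnit (algebraMap ℚ[X] Loc (C c)) :=
  (isUnit_C.2 hc.isUnit).map _

lemma coe_mul_eq_smul (p : ℚ[X]) (f : PowerSeries ℚ) :
    ((p * f : PowerSeries ℚ) : Lau) = algebraMap ℚ[X] Loc p • (f : Lau) := by
  rw [Algebra.smul_def, ← IsScalarTower.algebraMap_apply, PowerSeries.coe_mul]
  rfl

/-- If the generating series of `a` satisfies an equation regular singular at the origin, the exponential
generating series satisfies an equation without singularities outside the origin. -/
lemma exists_iterate_mem_spanLT (a : ℕ → ℚ) {n : ℕ} (ρ : ℕ → ℚ[X]) (h0 : (ρ n).coeff 0 ≠ 0)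
    (h : ∑ j ∈ Finset.range (n + 1), (ρ j : PowerSeries ℚ) *
      ((PowerSeries.X : PowerSeries ℚ) ^ j * ∂^[j] (PowerSeries.mk a)) = 0) :
    ∃ K, D^[K] (ex a : Lau) ∈ spanLT Loc D (ex a : Lau) K := by
  obtain ⟨d, hd⟩ : ∃ d, ∀ j ≤ n, (ρ j).natDegree ≤ d :=
    ⟨(Finset.range (n + 1)).sup fun j => (ρ j).natDegree, fun j hj =>
      Finset.le_sup (f := fun j => (ρ j).natDegree) (Finset.mem_range.2 (by lia))⟩
  have hl := laplace a (n := n) (d := d) (fun j => if j ≤ n then ρ j else 0)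
    (fun j => by split_ifs with hj; exacts [hd j hj, by simp])
    (by
      rw [← h]
      refine Finset.sum_congr rfl fun j hj => ?_
      rw [if_pos (by have := Finset.mem_range.1 hj; lia)])
  set f : Lau := (ex a : Lau) with hf
  refine ⟨d + n, ?_⟩
  set U := spanLT Loc D f (d + n) with hU
  have hterm : ∀ j e, D^[e] (algebraMap ℚ[X] Loc (X ^ j) • D^[j] f) -
      algebraMap ℚ[X] Loc (X ^ j) • D^[e + j] f ∈ spanLT Loc D f (e + j) := by
    intro j e
    have h1 := D_iterate_smul_sub_mem (algebraMap ℚ[X] Loc (X ^ j)) (D^[j] f) e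
    rw [← Function.iterate_add_apply] at h1
    refine Submodule.span_le.2 ?_ h1
    rintro _ ⟨i, rfl⟩
    change D^[i] (D^[j] f) ∈ _
    rw [← Function.iterate_add_apply]
    exact iterate_mem_spanLT D f (by have := i.2; omega)
  have hlow : ∀ j e, e + j < d + n → D^[e] (algebraMap ℚ[X] Loc (X ^ j) • D^[j] f) ∈ U := by
    intro j e he
    have h1 := spanLT_mono (R := Loc) D f he.le (hterm j e)
    have h2 := U.add_mem h1 (U.smul_mem (algebraMap ℚ[X] Loc (X ^ j)) (iterate_mem_spanLT D f he))
    rwa [sub_add_cancel] at h2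
  have hl' : ∑ j ∈ Finset.range (n + 1), ∑ k ∈ Finset.range (d + 1),
      algebraMap ℚ[X] Loc (C ((if j ≤ n then ρ j else 0).coeff k)) •
        D^[d - k] (algebraMap ℚ[X] Loc (X ^ j) • D^[j] f) = 0 := by
    have h1 := congrArg (HahnSeries.ofPowerSeries ℤ ℚ) hl
    simp only [map_sum, map_zero] at h1
    rw [← h1]
    refine Finset.sum_congr rfl fun j _ => Finset.sum_congr rfl fun k _ => ?_
    have h2 := coe_mul_eq_smul (C ((if j ≤ n then ρ j else 0).coeff k))
      (∂^[d - k] ((PowerSeries.X : PowerSeries ℚ) ^ j * ∂^[j] (ex a)))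
    rw [Polynomial.coe_C] at h2
    refine Eq.trans ?_ h2.symm
    congr 1
    have h3 := coe_mul_eq_smul (X ^ j) (∂^[j] (ex a))
    rw [Polynomial.coe_pow, Polynomial.coe_X] at h3
    rw [← D_iterate_coe, h3, ← D_iterate_coe]
  rw [Finset.sum_range_succ, Finset.sum_range_succ' _ d] at hl'
  have h1 : ∑ j ∈ Finset.range n, ∑ k ∈ Finset.range (d + 1),
      algebraMap ℚ[X] Loc (C ((if j ≤ n then ρ j else 0).coeff k)) •
        D^[d - k] (algebraMap ℚ[X] Loc (X ^ j) • D^[j] f) ∈ U :=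
    U.sum_mem fun j hj => U.sum_mem fun k _ => U.smul_mem _ (hlow _ _ (by
      have := Finset.mem_range.1 hj; lia))
  have h2 : ∑ k ∈ Finset.range d, algebraMap ℚ[X] Loc (C ((if n ≤ n then ρ n else 0).coeff (k + 1))) •
        D^[d - (k + 1)] (algebraMap ℚ[X] Loc (X ^ n) • D^[n] f) ∈ U :=
    U.sum_mem fun k hk => U.smul_mem _ (hlow _ _ (by have := Finset.mem_range.1 hk; lia))
  have h3 := (U.add_mem_iff_right h1).1 (hl' ▸ U.zero_mem)
  have h4 := (U.add_mem_iff_right h2).1 h3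
  rw [if_pos le_rfl, U.smul_mem_iff_of_isUnit (C_loc_isUnit h0)] at h4
  have h5 := U.sub_mem h4 (hterm n d)
  rw [tsub_zero, sub_sub_cancel, map_pow, U.smul_mem_iff_of_isUnit (X_loc_isUnit.pow n)] at h5
  exact h5

lemma coe_zl_mul (p : ℤ[X]) (f : PowerSeries ℚ) :
    zl p * (f : Lau) = ((mapRingHom (Int.castRingHom ℚ) p * f : PowerSeries ℚ) : Lau) := by
  rw [PowerSeries.coe_mul]
  rfl

lemma exists_polynomial_relation {f : PowerSeries ℚ} {n : ℕ} {γ : Fin n → Rat1}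
    (h : D^[n] (f : Lau) = ∑ j, γ j • D^[j] (f : Lau)) : ∃ (T : ℤ[X]) (G : Fin n → ℤ[X]), T ≠ 0 ∧
      (∀ j, zr T * γ j = zr (G j)) ∧
      (mapRingHom (Int.castRingHom ℚ) T : PowerSeries ℚ) * ∂^[n] f =
        ∑ j : Fin n, (mapRingHom (Int.castRingHom ℚ) (G j) : PowerSeries ℚ) * ∂^[j] f := by
  obtain ⟨T, hT0, -, hT⟩ := exists_zr_denominator γ
  choose G hG using hT
  refine ⟨T, G, hT0, hG, HahnSeries.ofPowerSeries_injective (Γ := ℤ) ?_⟩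
  rw [map_sum]
  simp only [← coe_zl_mul, ← D_iterate_coe]
  rw [h, Finset.mul_sum]
  refine Finset.sum_congr rfl fun j _ => ?_
  rw [Algebra.smul_def, ← mul_assoc, ← algebraMap_zr, ← map_mul, hG, algebraMap_zr]

lemma exists_regular_equation {A : PowerSeries ℚ} {n : ℕ} {γ : Fin n → Rat1}
    (hγ : ∀ j : Fin n, LB (-((n : ℤ) - (j : ℕ))) (algebraMap Rat1 Lau (γ j)))
    (h : D^[n] (A : Lau) = ∑ j, γ j • D^[j] (A : Lau)) :
    ∃ ρ : ℕ → ℚ[X], (ρ n).coeff 0 ≠ 0 ∧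
      ∑ j ∈ Finset.range (n + 1), (ρ j : PowerSeries ℚ) *
        ((PowerSeries.X : PowerSeries ℚ) ^ j * ∂^[j] A) = 0 := by
  obtain ⟨T, G, hT0, hTG, hrel⟩ := exists_polynomial_relation h
  have hq0 : mapRingHom (Int.castRingHom ℚ) T ≠ 0 := by
    simpa using map_int_injective.ne hT0
  obtain ⟨q', hq', hnd⟩ := exists_eq_pow_rootMultiplicity_mul_and_not_dvd _ hq0 0
  set e := (mapRingHom (Int.castRingHom ℚ) T).rootMultiplicity 0 with he
  simp only [map_zero, sub_zero] at hq' hnd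
  have hTe : LB e (zl T) := fun m hm => by
    rcases lt_or_ge m 0 with h | h
    · exact zl_coeff_neg _ _ h
    · lift m to ℕ using h
      change (pl (mapRingHom (Int.castRingHom ℚ) T)).coeff m = 0
      rw [pl_coeff_nat, hq', coeff_X_pow_mul', if_neg (by lia)]
  have hdvd : ∀ j : Fin n, X ^ (e + j) ∣ X ^ n * mapRingHom (Int.castRingHom ℚ) (G j) := by
    intro j
    rw [X_pow_dvd_iff]
    intro m hm
    rw [coeff_X_pow_mul']
    split_ifs with hnm
    · rw [← pl_coeff_nat]
      change (zl (G j)).coeff _ = 0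
      rw [← algebraMap_zr, ← hTG, map_mul, algebraMap_zr]
      refine hTe.mul (hγ j) _ ?_
      push_cast [hnm]
      lia
    · rfl
  choose ρ hρ using hdvd
  refine ⟨fun j => if h : j < n then -ρ ⟨j, h⟩ else q', ?_, ?_⟩
  · simpa [X_dvd_iff] using hnd
  rw [Finset.sum_range_succ, Finset.sum_range]
  simp only [lt_irrefl, dite_false, Fin.is_lt, dite_true, Fin.eta]
  have hX : (PowerSeries.X : PowerSeries ℚ) ^ e ≠ 0 := pow_ne_zero _ PowerSeries.X_ne_zero
  refine mul_left_cancel₀ hX ?_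
  have h1 := congrArg (fun s => (PowerSeries.X : PowerSeries ℚ) ^ n * s) hrel
  simp only [Finset.mul_sum] at h1
  rw [mul_zero, mul_add, Finset.mul_sum]
  have h2 : ∀ j : Fin n, (PowerSeries.X : PowerSeries ℚ) ^ n *
      ((mapRingHom (Int.castRingHom ℚ) (G j) : PowerSeries ℚ) * ∂^[j] A) =
      (PowerSeries.X : PowerSeries ℚ) ^ e * ((ρ j : PowerSeries ℚ) *
        ((PowerSeries.X : PowerSeries ℚ) ^ (j : ℕ) * ∂^[j] A)) := fun j => by
    have h3 := congrArg (fun p : ℚ[X] => (p : PowerSeries ℚ)) (hρ j)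
    simp only [Polynomial.coe_mul, Polynomial.coe_pow, Polynomial.coe_X] at h3
    rw [← mul_assoc, h3, pow_add]
    ring
  simp only [h2] at h1
  simp only [Polynomial.coe_neg, neg_mul, mul_neg, Finset.sum_neg_distrib]
  rw [← h1, hq', Polynomial.coe_mul, Polynomial.coe_pow, Polynomial.coe_X]
  ring

lemma D_iterate_smul_sub_mem_rat (c : Rat1) (v : Lau) (k : ℕ) :
    D^[k] (c • v) - c • D^[k] v ∈ spanLT Rat1 D v k := by
  apply iterate_smul_sub_mem (R := Rat1) (V := Lau) (δ := D) (d := dr)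
  exact D_smul

lemma spanLT_stable_rat {v : Lau} {k : ℕ} {U : Submodule Rat1 Lau} (hU : spanLT Rat1 D v k ≤ U)
    (h : D^[k] v ∈ U) {w : Lau} (hw : w ∈ spanLT Rat1 D v k) : D w ∈ U := by
  apply map_mem_of_span (R := Rat1) (V := Lau) (δ := D) (d := dr) _ hU _ hw
  · exact D_smul
  · rintro _ ⟨i, rfl⟩
    change D (D^[i] v) ∈ _
    rw [← Function.iterate_succ_apply' D]
    rcases Nat.lt_or_ge (i : ℕ).succ k with h1 | h1
    · exact hU (iterate_mem_spanLT D v h1)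
    · rwa [show (i : ℕ).succ = k by have := i.2; omega]

lemma pl_X_pow (e : ℕ) : pl (X ^ e) = HahnSeries.single (e : ℤ) 1 := by
  rw [pl_eq, Polynomial.coe_pow, Polynomial.coe_X, PowerSeries.coe_pow, PowerSeries.coe_X, HahnSeries.single_pow]
  simp

lemma pl_X_pow_mul_coeff (e : ℕ) (f : Lau) (m : ℤ) : (pl (X ^ e) * f).coeff m = f.coeff (m - e) := by
  rw [pl_X_pow]
  have := HahnSeries.coeff_single_mul_add (r := (1:ℚ)) (x := f) (a := m - e) (b := e)
  rwa [sub_add_cancel, one_mul] at this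

/-- A Laurent series without nonnegative exponents is a rational function. -/
lemma exists_rat_of_coeff_eq_zero (W : Lau) (h : ∀ m : ℕ, W.coeff m = 0) : ∃ r : Rat1, W = algebraMap Rat1 Lau r := by
  obtain ⟨e, he⟩ : ∃ e : ℕ, ∀ m : ℤ, m < -e → W.coeff m = 0 :=
    ⟨(-W.order).toNat, fun m hm => HahnSeries.coeff_eq_zero_of_lt_order (by omega)⟩
  have h0 : pl (X ^ e) ≠ 0 := by simp
  refine ⟨algebraMap ℚ[X] _ (∑ i ∈ Finset.range e, monomial i (W.coeff (i - e))) / algebraMap ℚ[X] _ (X ^ e), ?_⟩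
  rw [algebraMap_div, eq_div_iff h0, mul_comm]
  ext m
  rw [pl_X_pow_mul_coeff]
  rcases lt_or_ge m 0 with hm | hm
  · rw [he _ (by lia), pl_eq, PowerSeries.coeff_coe, if_pos hm]
  · lift m to ℕ using hm
    rw [pl_coeff_nat, finsetSum_coeff]
    simp only [coeff_monomial]
    rw [Finset.sum_ite_eq']
    split_ifs with hme
    · rfl
    · rw [Finset.mem_range] at hme
      rw [show (m : ℤ) - e = ((m - e : ℕ) : ℤ) by lia]
      exact h _

lemma factorial_mul_coeff (a : ℕ → ℚ) (P : ℚ[X]) (i d N : ℕ) (hd : P.natDegree ≤ d) :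
    N.factorial * PowerSeries.coeff N ((P : PowerSeries ℚ) * ∂^[i] (ex a)) =
      ∑ k ∈ Finset.range (d + 1), P.coeff k * (N.descFactorial k * a (N - k + i)) := by
  rw [PowerSeries.coeff_mul, Finset.Nat.sum_antidiagonal_eq_sum_range_succ_mk, Finset.mul_sum]
  trans ∑ k ∈ Finset.range (N + d + 1), P.coeff k * (N.descFactorial k * a (N - k + i))
  · refine Eq.trans (Finset.sum_congr rfl fun k hk => ?_)
      (Finset.sum_subset (Finset.range_mono (show N.succ ≤ N + d + 1 by lia)) ?_)
    · have hkN : k ≤ N := by have := Finset.mem_range.1 hk; lia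
      have h1 := coeff_iterate_theta_ex a 0 i (N - k)
      simp only [pow_zero, one_mul, Function.iterate_zero, id_eq, Nat.descFactorial_zero, Nat.cast_one] at h1
      have h2 := Nat.factorial_mul_descFactorial hkN
      rw [← h1, Polynomial.coeff_coe, ← h2]
      push_cast
      ring
    · intro k _ hk
      rw [Nat.descFactorial_eq_zero_iff_lt.2 (by have := Finset.mem_range.not.1 hk; lia)]
      simp
  · symm
    refine Finset.sum_subset (Finset.range_mono (by lia)) fun k _ hk => ?_
    rw [coeff_eq_zero_of_natDegree_lt (by have := Finset.mem_range.not.1 hk; lia), zero_mul]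

lemma D_iterate_X_pow_mul_coeff (a : ℕ → ℚ) (n i k N : ℕ) (hi : i ≤ n) {B : Lau}
    (hB : ∀ m : ℤ, B.coeff m = (PowerSeries.mk a : Lau).coeff (m + n)) :
    (pl (X ^ k) * D^[k] (pl (X ^ (k + n - i)) * B)).coeff N = N.descFactorial k * a (N - k + i) := by
  rw [pl_X_pow_mul_coeff, D_iterate_coeff, pl_X_pow_mul_coeff, hB]
  rcases Nat.lt_or_ge N k with h | h
  · rw [Nat.descFactorial_eq_zero_iff_lt.2 h, Finset.prod_eq_zero (Finset.mem_range.2 h)]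
    · simp
    · push_cast; ring
  · congr 1
    · rw [Nat.descFactorial_eq_prod_range, Nat.cast_prod]
      refine Finset.prod_congr rfl fun j hj => ?_
      rw [Nat.cast_sub (by have := Finset.mem_range.1 hj; lia)]
      push_cast; ring
    · rw [show (N : ℤ) - k + k - ((k + n - i : ℕ) : ℤ) + n = ((N - k + i : ℕ) : ℤ) by omega,
        LaurentSeries.coeff_coe_powerSeries, PowerSeries.coeff_mk]

/-- The generating series of `a` is holonomic as soon as its exponential generating series is. -/
lemma hol_mk_of_hol_ex {a : ℕ → ℚ} (h : Hol (ex a : Lau)) : Hol (PowerSeries.mk a : Lau) := by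
  classical
  obtain ⟨n, -, γ, hγ⟩ := exists_companion h
  obtain ⟨T, G, hT0, -, hrel⟩ := exists_polynomial_relation hγ
  obtain ⟨P, hPn, hP⟩ : ∃ P : ℕ → ℚ[X], P n ≠ 0 ∧
      ∑ i ∈ Finset.range (n + 1), (P i : PowerSeries ℚ) * ∂^[i] (ex a) = 0 := by
    refine ⟨fun i => if h : i < n then -mapRingHom (Int.castRingHom ℚ) (G ⟨i, h⟩) else
      mapRingHom (Int.castRingHom ℚ) T, by simpa using map_int_injective.ne hT0, ?_⟩
    rw [Finset.sum_range_succ, Finset.sum_range]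
    simp only [Fin.is_lt, dite_true, lt_self_iff_false, dite_false]
    rw [hrel, ← Finset.sum_add_distrib]
    refine Finset.sum_eq_zero fun j _ => ?_
    rw [Polynomial.coe_neg]
    ring
  obtain ⟨i₀, hi₀, hmax⟩ := Finset.exists_max_image ((Finset.range (n + 1)).filter fun i => P i ≠ 0)
    (fun i => (P i).natDegree) ⟨n, by simp [hPn]⟩
  set K := (P i₀).natDegree with hK
  have hdeg : ∀ i ∈ Finset.range (n + 1), (P i).natDegree ≤ K := fun i hi => by
    by_cases h0 : P i = 0
    · simp [h0]
    · exact hmax i (Finset.mem_filter.2 ⟨hi, h0⟩)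
  set A : Lau := (PowerSeries.mk a : Lau) with hA
  set B : Lau := HahnSeries.single (-n : ℤ) 1 * A with hBdef
  have hB : ∀ m : ℤ, B.coeff m = A.coeff (m + n) := fun m => by
    have := HahnSeries.coeff_single_mul_add (r := (1:ℚ)) (x := A) (a := m + n) (b := -n)
    rwa [add_neg_cancel_right, one_mul] at this
  set xp : ℕ → Rat1 := fun e => algebraMap ℚ[X] Rat1 (X ^ e) with hxp
  set cc : ℕ → ℕ → Rat1 := fun i k => algebraMap ℚ[X] Rat1 (C ((P i).coeff k)) with hcc
  set W : Lau := ∑ i ∈ Finset.range (n + 1), ∑ k ∈ Finset.range (K + 1),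
    (cc i k * xp k) • D^[k] (xp (k + n - i) • B) with hW
  have hpl : ∀ p : ℚ[X], algebraMap Rat1 Lau (algebraMap ℚ[X] Rat1 p) = pl p := fun p =>
    (IsScalarTower.algebraMap_apply ℚ[X] Rat1 Lau p).symm
  have hplC : ∀ (c : ℚ) (f : Lau) (m : ℤ), (pl (C c) * f).coeff m = c * f.coeff m := fun c f m => by
    rw [pl_eq, Polynomial.coe_C]
    erw [HahnSeries.ofPowerSeries_C, HahnSeries.coeff_single_zero_mul]
  obtain ⟨r, hr⟩ : ∃ r : Rat1, W = algebraMap Rat1 Lau r := by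
    refine exists_rat_of_coeff_eq_zero W fun N => ?_
    have h1 := congrArg (fun f => (N.factorial : ℚ) * PowerSeries.coeff N f) hP
    simp only [map_sum, map_zero, mul_zero, Finset.mul_sum] at h1
    rw [← h1, hW, HahnSeries.coeff_sum]
    refine Finset.sum_congr rfl fun i hi => ?_
    rw [factorial_mul_coeff a (P i) i K N (hdeg i hi), HahnSeries.coeff_sum]
    refine Finset.sum_congr rfl fun k _ => ?_
    rw [Algebra.smul_def, Algebra.smul_def, map_mul, hpl, hpl, hpl, mul_assoc, hplC,
      D_iterate_X_pow_mul_coeff a n i k N (by have := Finset.mem_range.1 hi; lia) hB]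
  set U : Submodule Rat1 Lau := spanLT Rat1 D B K ⊔ Submodule.span Rat1 {1} with hU
  have hterm : ∀ i k, k ≤ K → (cc i k * xp k) • D^[k] (xp (k + n - i) • B) -
      (cc i k * xp k) • xp (k + n - i) • D^[k] B ∈ U := by
    intro i k hk
    rw [← smul_sub]
    exact U.smul_mem _ (Submodule.mem_sup_left (spanLT_mono D B hk (D_iterate_smul_sub_mem_rat _ _ _)))
  have hlow : ∀ i k, k < K → (cc i k * xp k) • D^[k] (xp (k + n - i) • B) ∈ U := by
    intro i k hk
    have h1 := U.add_mem (hterm i k hk.le) (U.smul_mem (cc i k * xp k) (U.smul_mem (xp (k + n - i))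
      (Submodule.mem_sup_left (iterate_mem_spanLT D B hk))))
    rwa [sub_add_cancel] at h1
  have hWU : W ∈ U := by
    rw [hr, ← mul_one (algebraMap Rat1 Lau r), ← Algebra.smul_def]
    exact U.smul_mem _ (Submodule.mem_sup_right (Submodule.mem_span_singleton_self 1))
  set s : Rat1 := ∑ i ∈ Finset.range (n + 1), cc i K * xp K * xp (K + n - i) with hs
  have hsU : s • D^[K] B ∈ U := by
    rw [hs, Finset.sum_smul]
    have h1 : W - ∑ i ∈ Finset.range (n + 1), (cc i K * xp K * xp (K + n - i)) • D^[K] B ∈ U := by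
      rw [hW, ← Finset.sum_sub_distrib]
      refine U.sum_mem fun i _ => ?_
      rw [Finset.sum_range_succ, add_sub_assoc, mul_smul (cc i K * xp K)]
      exact U.add_mem (U.sum_mem fun k hk => hlow i k (Finset.mem_range.1 hk)) (hterm i K le_rfl)
    have h2 := U.sub_mem hWU h1
    rwa [sub_sub_cancel] at h2
  have hs0 : s ≠ 0 := by
    have h1 : s = algebraMap ℚ[X] Rat1 (∑ i ∈ Finset.range (n + 1),
        C ((P i).coeff K) * X ^ K * X ^ (K + n - i)) := by
      rw [hs, map_sum]
      simp only [map_mul, cc, xp]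
    rw [h1]
    refine fun h0 => ?_
    have h2 := (IsFractionRing.injective ℚ[X] Rat1) (h0.trans (map_zero _).symm)
    have hi₀n := Finset.mem_range.1 (Finset.mem_filter.1 hi₀).1
    have h3 := congrArg (fun p => p.coeff (K + (K + n - i₀))) h2
    simp only [finsetSum_coeff, coeff_zero, mul_assoc, ← pow_add, coeff_C_mul, coeff_X_pow] at h3
    rw [Finset.sum_eq_single i₀] at h3
    · simp only [if_true, mul_one] at h3
      exact (Finset.mem_filter.1 hi₀).2 (leadingCoeff_eq_zero.1 h3)
    · intro i hi hne
      have := Finset.mem_range.1 hi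
      rw [if_neg (by omega), mul_zero]
    · intro hni; exact absurd (Finset.mem_filter.1 hi₀).1 hni
  have hDK : D^[K] B ∈ U := (U.smul_mem_iff hs0).1 hsU
  have hBhol : Hol B := by
    refine ⟨U, ?_, fun v hv => ?_, ?_⟩
    · have : Module.Finite Rat1 (spanLT Rat1 D B K) :=
        Module.Finite.span_of_finite Rat1 (Set.finite_range _)
      infer_instance
    · obtain ⟨x, hx, y, hy, rfl⟩ := Submodule.mem_sup.1 hv
      rw [map_add]
      refine U.add_mem (spanLT_stable_rat le_sup_left hDK hx) ?_
      obtain ⟨c, rfl⟩ := Submodule.mem_span_singleton.1 hy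
      rw [D_smul, D_one, smul_zero, add_zero]
      exact U.smul_mem _ (Submodule.mem_sup_right (Submodule.mem_span_singleton_self 1))
    · rcases Nat.eq_zero_or_pos K with h0 | h0
      · rwa [h0] at hDK
      · exact Submodule.mem_sup_left (iterate_mem_spanLT (i := 0) D B h0)
  have hAB : A = algebraMap Rat1 Lau (xp n) * B := by
    rw [hpl, pl_X_pow, hBdef, ← mul_assoc, HahnSeries.single_mul_single]
    simp
  rw [hAB]
  exact (hol_rat _).mul hBhol

/-- Arithmetic holonomic exponential series have no singularity at `1`. -/
theorem andre {a : ℕ → ℚ} (h : Hol (ex a : Lau)) (hG : Geom a) :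
    ∃ K, D^[K] (ex a : Lau) ∈ spanLT Loc D (ex a : Lau) K := by
  obtain ⟨n, γ, hγ, hA⟩ := exists_fuchsian (hol_mk_of_hol_ex h) (by simpa using hG)
  obtain ⟨ρ, h0, hρ⟩ := exists_regular_equation hγ hA
  exact exists_iterate_mem_spanLT a ρ h0 hρ

end Laplace

section NormForm
variable {ι : Type} [Fintype ι] [DecidableEq ι] {L : Type*} [Field L] [Algebra ℚ L] (θ : Module.Basis ι ℚ L)

/-- The matrix of multiplication by `∑ y j θ j`. -/
def mulMat {R : Type*} [CommRing R] (φ : ℚ →+* R) (y : ι → R) : Matrix ι ι R :=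
  Matrix.of fun p q => ∑ j, y j * φ (Algebra.leftMulMatrix θ (θ j) p q)

/-- The norm form attached to the basis `θ`. -/
def normForm {R : Type*} [CommRing R] (φ : ℚ →+* R) (y : ι → R) : R := (mulMat θ φ y).det

lemma map_normForm {R S : Type*} [CommRing R] [CommRing S] (φ : ℚ →+* R) (φ' : ℚ →+* S) (ψ : R →+* S)
    (y : ι → R) : ψ (normForm θ φ y) = normForm θ φ' fun j => ψ (y j) := by
  rw [normForm, RingHom.map_det, normForm]
  congr 1
  ext p q
  simp only [mulMat, RingHom.mapMatrix_apply, Matrix.map_apply, Matrix.of_apply, map_sum, map_mul]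
  refine Finset.sum_congr rfl fun j _ => ?_
  rw [← RingHom.comp_apply ψ φ, Subsingleton.elim (ψ.comp φ) φ']

lemma vecMul_mulMat {R : Type*} [CommRing R] (φ : ℚ →+* R) (y : ι → R) (σ : L →+* R) :
    Matrix.vecMul (fun p => σ (θ p)) (mulMat θ φ y) = (∑ j, y j * σ (θ j)) • fun p => σ (θ p) := by
  ext q
  simp only [Matrix.vecMul, dotProduct, mulMat, Matrix.of_apply, Pi.smul_apply, smul_eq_mul,
    Finset.mul_sum, Finset.sum_mul]
  rw [Finset.sum_comm]
  refine Finset.sum_congr rfl fun j _ => ?_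
  rw [mul_assoc, ← map_mul, ← θ.sum_repr (θ j * θ q), map_sum, Finset.mul_sum]
  refine Finset.sum_congr rfl fun p _ => ?_
  rw [Algebra.leftMulMatrix_eq_repr_mul, Algebra.smul_def, map_mul σ, ← RingHom.comp_apply σ,
    Subsingleton.elim (σ.comp (algebraMap ℚ L)) φ]
  ring

lemma normForm_eq_zero {R : Type*} [Field R] (φ : ℚ →+* R) (y : ι → R) (σ : L →+* R)
    (h : ∑ j, y j * σ (θ j) = 0) : normForm θ φ y = 0 := by
  refine Matrix.exists_vecMul_eq_zero_iff.1 ⟨fun p => σ (θ p), fun h0 => ?_, ?_⟩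
  · have h1 : σ 1 = 0 := by
      rw [← θ.sum_repr 1, map_sum]
      refine Finset.sum_eq_zero fun p _ => ?_
      rw [Algebra.smul_def, map_mul, show σ (θ p) = 0 from congrFun h0 p, mul_zero]
    simp at h1
  · rw [vecMul_mulMat, h, zero_smul]

lemma exists_embedding_of_normForm_eq_zero {Ω : Type*} [Field Ω] [CharZero Ω] [IsAlgClosed Ω] (φ : ℚ →+* Ω) (y : ι → Ω)
    (h : normForm θ φ y = 0) : ∃ σ : L →+* Ω, ∑ j, y j * σ (θ j) = 0 := by
  have : FiniteDimensional ℚ L := θ.finiteDimensional_of_finite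
  have hcard : Fintype.card ι = Fintype.card (L →ₐ[ℚ] Ω) := by
    rw [AlgHom.card ℚ L Ω, Module.finrank_eq_card_basis θ]
  let e : ι ≃ (L →ₐ[ℚ] Ω) := Fintype.equivOfCardEq hcard
  set V := Algebra.embeddingsMatrixReindex ℚ Ω θ e with hV
  have hV0 : V.det ≠ 0 := by
    intro h0
    have h1 := Algebra.discr_eq_det_embeddingsMatrixReindex_pow_two ℚ Ω θ e
    rw [← hV, h0, zero_pow two_ne_zero, map_eq_zero] at h1
    exact Algebra.discr_not_zero_of_basis ℚ θ h1
  have hVM : V.transpose * mulMat θ φ y = Matrix.diagonal (fun i => ∑ j, y j * e i (θ j)) * V.transpose := by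
    ext i q
    have h1 := congrFun (vecMul_mulMat θ φ y (e i : L →+* Ω)) q
    rw [Matrix.diagonal_mul]
    exact h1
  have h2 := congrArg Matrix.det hVM
  rw [Matrix.det_mul, Matrix.det_mul, show (mulMat θ φ y).det = 0 from h, mul_zero, Matrix.det_diagonal,
    Matrix.det_transpose] at h2
  obtain ⟨i, -, hi⟩ := Finset.prod_eq_zero_iff.1 ((mul_eq_zero.1 h2.symm).resolve_right hV0)
  exact ⟨e i, hi⟩

lemma normForm_rat_ne_zero (φ : ℚ →+* ℚ) (y : ι → ℚ) (hy : y ≠ 0) : normForm θ φ y ≠ 0 := by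
  have : FiniteDimensional ℚ L := θ.finiteDimensional_of_finite
  have h1 : mulMat θ φ y = Algebra.leftMulMatrix θ (∑ j, y j • θ j) := by
    ext p q
    rw [map_sum, Matrix.sum_apply]
    simp only [mulMat, Matrix.of_apply, map_smul, Matrix.smul_apply, smul_eq_mul]
    rw [Subsingleton.elim φ (RingHom.id ℚ)]
    rfl
  rw [normForm, h1, ← Algebra.norm_eq_matrix_det, Ne, Algebra.norm_eq_zero_iff]
  intro h0
  exact hy (funext fun j => Fintype.linearIndependent_iff.1 θ.linearIndependent y h0 j)

lemma normForm_smul {R : Type*} [CommRing R] (φ : ℚ →+* R) (c : R) (y : ι → R) :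
    normForm θ φ (fun j => c * y j) = c ^ Fintype.card ι * normForm θ φ y := by
  rw [normForm, normForm, ← Matrix.det_smul]
  congr 1
  ext p q
  simp [mulMat, Finset.mul_sum, mul_assoc]

lemma normForm_powerSeries_ne_zero (φ : ℚ →+* PowerSeries ℚ) (y : ι → PowerSeries ℚ) (hy : y ≠ 0) :
    normForm θ φ y ≠ 0 := by
  classical
  have hex : ∃ k, ∃ j, PowerSeries.coeff k (y j) ≠ 0 := by
    by_contra hcon
    push Not at hcon
    exact hy (funext fun j => by ext k; exact hcon k j)
  have hdvd : ∀ j, PowerSeries.X ^ Nat.find hex ∣ y j := fun j =>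
    PowerSeries.X_pow_dvd_iff.2 fun m hm => by
      have := Nat.find_min hex hm
      push Not at this
      exact this j
  choose w hw using hdvd
  obtain ⟨j, hj⟩ := Nat.find_spec hex
  rw [show y = fun j => PowerSeries.X ^ Nat.find hex * w j from funext hw, normForm_smul]
  refine mul_ne_zero (pow_ne_zero _ (pow_ne_zero _ PowerSeries.X_ne_zero)) fun h0 => ?_
  have h1 := map_normForm θ φ (RingHom.id ℚ) PowerSeries.constantCoeff w
  rw [h0, map_zero] at h1
  refine normForm_rat_ne_zero θ _ _ (fun h2 => hj ?_) h1.symm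
  rw [hw j, PowerSeries.coeff_X_pow_mul', if_pos le_rfl, Nat.sub_self, PowerSeries.coeff_zero_eq_constantCoeff_apply]
  exact congrFun h2 j

lemma normForm_laurentSeries_ne_zero (φ : ℚ →+* LaurentSeries ℚ) (y : ι → LaurentSeries ℚ) (hy : y ≠ 0) :
    normForm θ φ y ≠ 0 := by
  obtain ⟨c, hc⟩ := IsLocalization.exist_integer_multiples_of_finite
    (nonZeroDivisors (PowerSeries ℚ)) y
  choose w hw using hc
  have hc0 : algebraMap (PowerSeries ℚ) (LaurentSeries ℚ) c ≠ 0 := by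
    simpa using (IsFractionRing.injective (PowerSeries ℚ) (LaurentSeries ℚ)).ne (nonZeroDivisors.ne_zero c.2)
  have hw' : (fun j => algebraMap (PowerSeries ℚ) (LaurentSeries ℚ) (w j)) =
      fun j => algebraMap (PowerSeries ℚ) (LaurentSeries ℚ) c * y j := funext fun j => by
    rw [hw j, Algebra.smul_def]
  intro h0
  have h1 := map_normForm θ (algebraMap ℚ _) φ (algebraMap (PowerSeries ℚ) (LaurentSeries ℚ)) w
  rw [hw', normForm_smul, h0, mul_zero] at h1
  refine normForm_powerSeries_ne_zero θ _ w (fun hw0 => hy (funext fun j => ?_))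
    ((IsFractionRing.injective (PowerSeries ℚ) (LaurentSeries ℚ)) (h1.trans (map_zero _).symm))
  have h2 := congrFun hw' j
  rw [hw0] at h2
  simp only [Pi.zero_apply, map_zero] at h2
  exact (mul_eq_zero.1 h2.symm).resolve_left hc0

end NormForm

lemma D_iterate_mul (f g : Lau) (k : ℕ) : D^[k] (f * g) =
    ∑ ij ∈ Finset.HasAntidiagonal.antidiagonal k, (k.choose ij.1) • (D^[ij.1] f * D^[ij.2] g) := by
  induction k with
  | zero => simp
  | succ k ih =>
    rw [Function.iterate_succ_apply', ih, map_sum,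
      Finset.sum_antidiagonal_choose_succ_nsmul (fun i j => D^[i] f * D^[j] g) k, ← Finset.sum_add_distrib]
    refine Finset.sum_congr rfl fun ij hij => ?_
    rw [map_nsmul, D_mul, Function.iterate_succ_apply' D, Function.iterate_succ_apply' D,
      Nat.choose_symm_of_eq_add (Finset.HasAntidiagonal.mem_antidiagonal.1 hij).symm, ← nsmul_add, add_comm]

section Horizontal
variable {T : Type*} [CommRing T] [Algebra (PowerSeries ℚ) T] (ι : Lau →+* T)

/-- The series `(-t)^k / k!`. -/
def expTerm (k : ℕ) : PowerSeries ℚ := PowerSeries.C ((-1) ^ k / (k.factorial : ℚ)) * PowerSeries.X ^ k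

lemma expTerm_zero : expTerm 0 = 1 := by simp [expTerm]

lemma expTerm_mul (i j : ℕ) : expTerm i * expTerm j = ((i + j).choose i : PowerSeries ℚ) * expTerm (i + j) := by
  rw [expTerm, expTerm, expTerm, mul_mul_mul_comm, ← map_mul, ← pow_add, ← mul_assoc]
  congr 1
  rw [← map_natCast (PowerSeries.C (R := ℚ)), ← map_mul]
  congr 1
  have h := Nat.add_choose_mul_factorial_mul_factorial i j
  have hi : (i.factorial : ℚ) ≠ 0 := by positivity
  have hj : (j.factorial : ℚ) ≠ 0 := by positivity
  have hij : ((i + j).factorial : ℚ) ≠ 0 := by positivity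
  have h' : ((i + j).choose i : ℚ) * i.factorial * j.factorial = (i + j).factorial := by
    rw [Nat.choose_symm_add]
    exact_mod_cast h
  field_simp
  rw [← h']
  ring

lemma expTerm_succ (k : ℕ) : ((k + 1 : ℕ) : PowerSeries ℚ) * expTerm (k + 1) = - (PowerSeries.X * expTerm k) := by
  have h := expTerm_mul 1 k
  rw [add_comm 1 k, Nat.choose_one_right] at h
  rw [← h]
  simp [expTerm]

/-- `y` is the sum of the series `∑ (-t)^k / k! D^k r`, the value at the base point of the Taylor expansion
of `r`, computed in a finitely generated module over the ring of power series in `t`. -/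
def HasLim (r : Lau) (y : T) : Prop :=
  ∃ H : Submodule (PowerSeries ℚ) T, H.FG ∧ (∀ k, ι (D^[k] r) ∈ H) ∧
    ∀ m, ∃ h ∈ H, y = ∑ k ∈ Finset.range m, expTerm k • ι (D^[k] r) + (PowerSeries.X ^ m : PowerSeries ℚ) • h

variable {ι}

lemma HasLim.add {r r' : Lau} {y y' : T} (h : HasLim ι r y) (h' : HasLim ι r' y') : HasLim ι (r + r') (y + y') := by
  obtain ⟨H, hH, hr, hy⟩ := h
  obtain ⟨H', hH', hr', hy'⟩ := h'
  have hD : ∀ k, ι (D^[k] (r + r')) = ι (D^[k] r) + ι (D^[k] r') := fun k => by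
    rw [iterate_map_add, map_add]
  refine ⟨H ⊔ H', hH.sup hH', fun k => ?_, fun m => ?_⟩
  · rw [hD]
    exact add_mem (Submodule.mem_sup_left (hr k)) (Submodule.mem_sup_right (hr' k))
  · obtain ⟨x, hx, h1⟩ := hy m
    obtain ⟨x', hx', h1'⟩ := hy' m
    refine ⟨x + x', add_mem (Submodule.mem_sup_left hx) (Submodule.mem_sup_right hx'), ?_⟩
    simp only [hD, smul_add, Finset.sum_add_distrib]
    rw [h1, h1']
    abel

lemma expTerm_smul (k : ℕ) (x : T) : expTerm k • x =
    (PowerSeries.X ^ k : PowerSeries ℚ) • (PowerSeries.C ((-1) ^ k / (k.factorial : ℚ)) • x) := by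
  rw [smul_smul, mul_comm, expTerm]

lemma HasLim.mul {r r' : Lau} {y y' : T} (h : HasLim ι r y) (h' : HasLim ι r' y') : HasLim ι (r * r') (y * y') := by
  obtain ⟨H, hH, hr, hy⟩ := h
  obtain ⟨H', hH', hr', hy'⟩ := h'
  refine ⟨H * H', hH.mul hH', fun k => ?_, fun m => ?_⟩
  · rw [D_iterate_mul, map_sum]
    refine sum_mem fun ij _ => ?_
    rw [map_nsmul, map_mul]
    exact nsmul_mem (Submodule.mul_mem_mul (hr _) (hr' _)) _
  · have hy'0 : y' ∈ H' := by
      obtain ⟨x, hx, h1⟩ := hy' 0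
      rw [h1]
      simpa using hx
    choose x hx hyx using hy
    choose x' hx' hyx' using hy'
    have hsum : ∑ k ∈ Finset.range m, expTerm k • ι (D^[k] (r * r')) =
        ∑ i ∈ Finset.range m, ∑ j ∈ Finset.range (m - i),
          (expTerm i • ι (D^[i] r)) * (expTerm j • ι (D^[j] r')) := by
      rw [← Finset.sum_range_diag_flip m (fun i j => (expTerm i • ι (D^[i] r)) * (expTerm j • ι (D^[j] r')))]
      refine Finset.sum_congr rfl fun k _ => ?_
      rw [D_iterate_mul, map_sum, Finset.smul_sum,
        ← Finset.Nat.sum_antidiagonal_eq_sum_range_succ_mk (fun ij : ℕ × ℕ =>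
          (expTerm ij.1 • ι (D^[ij.1] r)) * (expTerm ij.2 • ι (D^[ij.2] r'))) k]
      refine Finset.sum_congr rfl fun ij hij => ?_
      have hk := Finset.HasAntidiagonal.mem_antidiagonal.1 hij
      rw [smul_mul_smul_comm, expTerm_mul, hk, map_nsmul, map_mul, mul_smul, Nat.cast_smul_eq_nsmul, smul_comm]
    refine ⟨x m * y' + ∑ i ∈ Finset.range m,
      (PowerSeries.C ((-1) ^ i / (i.factorial : ℚ)) • ι (D^[i] r)) * x' (m - i),
      add_mem (Submodule.mul_mem_mul (hx m) hy'0) (sum_mem fun i _ =>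
        Submodule.mul_mem_mul (H.smul_mem _ (hr i)) (hx' _)), ?_⟩
    rw [hsum]
    conv_lhs => rw [hyx m]
    rw [add_mul, smul_add, smul_mul_assoc, add_left_comm, add_comm]
    congr 1
    rw [Finset.smul_sum, ← Finset.sum_add_distrib, Finset.sum_mul]
    refine Finset.sum_congr rfl fun i hi => ?_
    conv_lhs => rw [hyx' (m - i), mul_add, Finset.mul_sum]
    congr 1
    rw [expTerm_smul, smul_mul_smul_comm, ← pow_add, Nat.add_sub_cancel' (Finset.mem_range.1 hi).le]

lemma HasLim.of_D_eq_zero {r : Lau} (h : D r = 0) : HasLim ι r (ι r) := by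
  have hD : ∀ k, D^[k + 1] r = 0 := fun k => by
    rw [Function.iterate_succ_apply, h]
    exact iterate_map_zero D k
  refine ⟨Submodule.span _ {ι r}, Submodule.fg_span_singleton _, fun k => ?_, fun m => ?_⟩
  · cases k with
    | zero => exact Submodule.mem_span_singleton_self _
    | succ k => rw [hD, map_zero]; exact zero_mem _
  · cases m with
    | zero => exact ⟨ι r, Submodule.mem_span_singleton_self _, by simp⟩
    | succ m =>
      refine ⟨0, zero_mem _, ?_⟩
      rw [Finset.sum_range_succ']
      simp [hD, expTerm_zero, -Function.iterate_succ]

lemma HasLim.eq_zero {y : T} (h : HasLim ι 0 y) : y = 0 := by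
  obtain ⟨H, hH, -, hy⟩ := h
  have hfin : Module.Finite (PowerSeries ℚ) H := Module.Finite.iff_fg.2 hH
  have hyH : y ∈ H := by
    obtain ⟨x, hx, h1⟩ := hy 0
    rw [h1]
    simpa using hx
  have key := Ideal.iInf_pow_smul_eq_bot_of_isLocalRing (M := H) (Ideal.span {(PowerSeries.X : PowerSeries ℚ)})
    (by rw [Ne, Ideal.span_singleton_eq_top]; exact PowerSeries.X_prime.not_isUnit)
  have hmem : (⟨y, hyH⟩ : H) ∈ (⨅ i : ℕ, Ideal.span {(PowerSeries.X : PowerSeries ℚ)} ^ i • (⊤ : Submodule (PowerSeries ℚ) H)) := by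
    refine (Submodule.mem_iInf _).2 fun m => ?_
    obtain ⟨x, hx, h1⟩ := hy m
    have h2 : (⟨y, hyH⟩ : H) = (PowerSeries.X ^ m : PowerSeries ℚ) • (⟨x, hx⟩ : H) := by
      ext
      simp [h1, iterate_map_zero]
    rw [h2]
    exact Submodule.smul_mem_smul (Ideal.pow_mem_pow (Ideal.mem_span_singleton_self _) m) trivial
  rw [key] at hmem
  exact congrArg Subtype.val ((Submodule.mem_bot _).1 hmem)

lemma HasLim.sum {κ : Type*} (s : Finset κ) {r : κ → Lau} {y : κ → T} (h : ∀ i ∈ s, HasLim ι (r i) (y i)) :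
    HasLim ι (∑ i ∈ s, r i) (∑ i ∈ s, y i) := by
  classical
  induction s using Finset.induction_on with
  | empty => simpa using HasLim.of_D_eq_zero (ι := ι) (map_zero D)
  | insert a s ha ih =>
    rw [Finset.sum_insert ha, Finset.sum_insert ha]
    exact (h a (Finset.mem_insert_self _ _)).add (ih fun i hi => h i (Finset.mem_insert_of_mem hi))

lemma D_neg_one : D (-1) = 0 := by rw [map_neg, D_one, neg_zero]

lemma HasLim.neg {r : Lau} {y : T} (h : HasLim ι r y) : HasLim ι (-r) (-y) := by
  have := (HasLim.of_D_eq_zero (ι := ι) D_neg_one).mul h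
  simpa using this

lemma HasLim.unique {r : Lau} {y y' : T} (h : HasLim ι r y) (h' : HasLim ι r y') : y = y' := by
  have := h.add h'.neg
  rw [add_neg_cancel] at this
  exact add_neg_eq_zero.1 this.eq_zero

/-- The pairs consisting of a series and its value at the base point. -/
def limSubring (ι : Lau →+* T) : Subring (Lau × T) where
  carrier := {p | HasLim ι p.1 p.2}
  mul_mem' := HasLim.mul
  add_mem' := HasLim.add
  neg_mem' := HasLim.neg
  zero_mem' := by simpa using HasLim.of_D_eq_zero (ι := ι) (map_zero D)
  one_mem' := by simpa using HasLim.of_D_eq_zero (ι := ι) D_one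

/-- A multiple of `z - 1` has value zero at the base point. -/
lemma hasLim_zero {q : Lau} {z : Lau} (hz : D z = 1) (hιz : ι z = algebraMap (PowerSeries ℚ) T (1 + PowerSeries.X))
    {H : Submodule (PowerSeries ℚ) T} (hH : H.FG) (hq : ∀ k, ι (D^[k] q) ∈ H) :
    HasLim ι ((z - 1) * q) 0 := by
  have hD : ∀ k, D^[k + 1] ((z - 1) * q) = (z - 1) * D^[k + 1] q + (k + 1) • D^[k] q := by
    intro k
    induction k with
    | zero => simp [D_mul, hz, D_one, add_comm]
    | succ k ih =>
      rw [Function.iterate_succ_apply', ih, map_add, D_mul, map_sub, hz, D_one, sub_zero, one_mul, map_nsmul,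
        ← Function.iterate_succ_apply' D, ← Function.iterate_succ_apply' D, succ_nsmul _ (k + 1)]
      abel
  have hz1 : ∀ x : T, ι (z - 1) * x = (PowerSeries.X : PowerSeries ℚ) • x := fun x => by
    rw [map_sub, map_one, hιz, Algebra.smul_def, map_add, map_one, add_sub_cancel_left]
  refine ⟨H, hH, fun k => ?_, fun m => ?_⟩
  · cases k with
    | zero =>
      rw [Function.iterate_zero, id, map_mul, hz1]
      exact H.smul_mem _ (hq 0)
    | succ k =>
      rw [hD, map_add, map_mul, hz1, map_nsmul]
      exact add_mem (H.smul_mem _ (hq _)) (nsmul_mem (hq _) _)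
  · have hsum : ∀ m, ∑ k ∈ Finset.range (m + 1), expTerm k • ι (D^[k] ((z - 1) * q)) =
        (PowerSeries.X : PowerSeries ℚ) • (expTerm m • ι (D^[m] q)) := by
      intro m
      induction m with
      | zero => simp [expTerm_zero, ← hz1]
      | succ m ih =>
        rw [Finset.sum_range_succ, ih, hD, map_add, map_mul, hz1, map_nsmul, smul_add,
          ← Nat.cast_smul_eq_nsmul (PowerSeries ℚ), smul_smul (expTerm (m + 1)) _ (ι (D^[m] q)),
          mul_comm (expTerm (m + 1)), expTerm_succ, neg_smul, mul_smul, smul_comm (expTerm (m + 1))]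
        abel
    cases m with
    | zero => exact ⟨0, zero_mem _, by simp⟩
    | succ m =>
      refine ⟨-(PowerSeries.C ((-1) ^ m / (m.factorial : ℚ)) • ι (D^[m] q)), neg_mem (H.smul_mem _ (hq m)), ?_⟩
      rw [hsum, expTerm_smul, smul_smul, ← pow_succ', smul_neg, add_neg_cancel]

/-- Existence of values at the base point. -/
lemma exists_hasLim {g : Lau} {K : ℕ} (c : ℕ → Fin K → PowerSeries ℚ)
    (h : ∀ k, ι (D^[k] g) = ∑ i, c k i • ι (D^[i] g)) :
    ∃ y, HasLim ι g y ∧ y ∈ Submodule.span (PowerSeries ℚ) (Set.range fun i : Fin K => ι (D^[i] g)) := by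
  set H := Submodule.span (PowerSeries ℚ) (Set.range fun i : Fin K => ι (D^[i] g)) with hH
  have hmem : ∀ i : Fin K, ι (D^[i] g) ∈ H := fun i => Submodule.subset_span ⟨i, rfl⟩
  set b : Fin K → PowerSeries ℚ := fun i => PowerSeries.mk fun n =>
    PowerSeries.coeff n (∑ k ∈ Finset.range (n + 1), expTerm k * c k i) with hb
  have hbm : ∀ m i, PowerSeries.X ^ m ∣ b i - ∑ k ∈ Finset.range m, expTerm k * c k i := by
    intro m i
    rw [PowerSeries.X_pow_dvd_iff]
    intro n hn
    rw [map_sub, hb, PowerSeries.coeff_mk, sub_eq_zero, map_sum, map_sum]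
    refine Finset.sum_subset (Finset.range_mono (by lia)) fun k _ hk => ?_
    rw [expTerm, mul_comm (PowerSeries.C _), mul_assoc, PowerSeries.coeff_X_pow_mul', if_neg]
    have := Finset.mem_range.not.1 hk
    lia
  choose e he using hbm
  refine ⟨∑ i, b i • ι (D^[i] g), ⟨H, Submodule.fg_span (Set.finite_range _), fun k => ?_, fun m => ?_⟩,
    sum_mem fun i _ => H.smul_mem _ (hmem i)⟩
  · rw [h]
    exact sum_mem fun i _ => H.smul_mem _ (hmem i)
  · refine ⟨∑ i, e m i • ι (D^[i] g), sum_mem fun i _ => H.smul_mem _ (hmem i), ?_⟩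
    have h1 : ∑ k ∈ Finset.range m, expTerm k • ι (D^[k] g) =
        ∑ i, (∑ k ∈ Finset.range m, expTerm k * c k i) • ι (D^[i] g) := by
      simp only [Finset.sum_smul]
      rw [Finset.sum_comm]
      refine Finset.sum_congr rfl fun k _ => ?_
      rw [h k, Finset.smul_sum]
      simp only [smul_smul]
    rw [h1, Finset.smul_sum, ← Finset.sum_add_distrib]
    refine Finset.sum_congr rfl fun i _ => ?_
    rw [smul_smul, ← he, ← add_smul, add_sub_cancel]

end Horizontal

section Disjoint
variable {F M Ω : Type*} [Field F] [Field M] [Field Ω] [Algebra F M] [Algebra M Ω] [Algebra F Ω] [IsScalarTower F M Ω]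

lemma minpoly_map_of_relatively_closed (hFM : ∀ x : M, IsAlgebraic F x → x ∈ (algebraMap F M).range)
    {x : Ω} (hx : IsIntegral F x) : minpoly M x = (minpoly F x).map (algebraMap F M) := by
  have hxM : IsIntegral M x := hx.tower_top
  have hdvd : minpoly M x ∣ (minpoly F x).map (algebraMap F M) := minpoly.dvd_map_of_isScalarTower F M x
  have hcoeff : ∀ i, (minpoly M x).coeff i ∈ (algebraMap F M).range := fun i =>
    hFM _ (Polynomial.isIntegral_coeff_of_dvd _ _ (minpoly.monic hx) (minpoly.monic hxM) hdvd i).isAlgebraic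
  obtain ⟨p, hp⟩ := (mem_lifts (minpoly M x)).1 ((lifts_iff_coeff_lifts _).2 fun i => hcoeff i)
  have hpm : p.Monic := by
    refine Polynomial.monic_of_injective (algebraMap F M).injective ?_
    rw [hp]
    exact minpoly.monic hxM
  have hp0 : aeval x p = 0 := by
    have := minpoly.aeval M x
    rw [← hp, aeval_map_algebraMap] at this
    exact this
  rw [← hp] at hdvd ⊢
  congr 1
  refine eq_of_monic_of_associated hpm (minpoly.monic hx) (associated_of_dvd_dvd ?_ (minpoly.dvd F x hp0))
  exact (map_dvd_map' _).1 hdvd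

/-- Linear disjointness of an extension in which `F` is relatively algebraically closed and of algebraic elements. -/
lemma linear_disjoint [CharZero F] (hFM : ∀ x : M, IsAlgebraic F x → x ∈ (algebraMap F M).range) {κ : Type*} [Fintype κ]
    {v : κ → M} (hv : LinearIndependent F v) {c : κ → Ω} (hc : ∀ i, IsAlgebraic F (c i))
    (h : ∑ i, c i * algebraMap M Ω (v i) = 0) (i : κ) : c i = 0 := by
  let E := IntermediateField.adjoin F (Set.range c)
  have hfin : FiniteDimensional F E :=
    IntermediateField.finiteDimensional_adjoin fun x hx => by
      obtain ⟨i, rfl⟩ := hx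
      exact (hc i).isIntegral
  let pb : PowerBasis F E := Field.powerBasisOfFiniteOfSeparable F E
  let c' : κ → E := fun i => ⟨c i, IntermediateField.subset_adjoin F _ ⟨i, rfl⟩⟩
  let a : κ → Fin pb.dim → F := fun i k => pb.basis.repr (c' i) k
  set x : Ω := algebraMap E Ω pb.gen with hx
  have hxi : IsIntegral F x := (Algebra.IsIntegral.isIntegral pb.gen).map (IsScalarTower.toAlgHom F E Ω)
  have hdeg : (minpoly F x).natDegree = pb.dim := by
    rw [hx, minpoly.algebraMap_eq (algebraMap E Ω).injective, pb.natDegree_minpoly]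
  have hci : ∀ i, c i = ∑ k, algebraMap F Ω (a i k) * x ^ (k : ℕ) := fun i => by
    have h1 := congrArg (algebraMap E Ω) (pb.basis.sum_repr (c' i))
    rw [map_sum] at h1
    refine h1.symm.trans (Finset.sum_congr rfl fun k _ => ?_)
    rw [Algebra.smul_def, map_mul, pb.basis_eq_pow, map_pow, ← IsScalarTower.algebraMap_apply]
  let w : Fin pb.dim → M := fun k => ∑ i, a i k • v i
  have hw : ∑ k, algebraMap M Ω (w k) * x ^ (k : ℕ) = 0 := by
    rw [← h]
    simp only [hci, w, map_sum, Finset.sum_mul]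
    rw [Finset.sum_comm]
    refine Finset.sum_congr rfl fun i _ => Finset.sum_congr rfl fun k _ => ?_
    rw [Algebra.smul_def, map_mul, ← IsScalarTower.algebraMap_apply]
    ring
  let Q : M[X] := ∑ k : Fin pb.dim, monomial (k : ℕ) (w k)
  have hQ0 : aeval x Q = 0 := by
    rw [← hw, map_sum]
    simp only [aeval_monomial]
  have hQ : Q = 0 := by
    by_contra hne
    have h1 := minpoly.degree_le_of_ne_zero M x hne hQ0
    rw [minpoly_map_of_relatively_closed hFM hxi, degree_map, degree_eq_natDegree (minpoly.ne_zero hxi), hdeg] at h1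
    have h2 : Q.degree < (pb.dim : WithBot ℕ) := by
      refine (degree_sum_le _ _).trans_lt ((Finset.sup_lt_iff (WithBot.bot_lt_coe _)).2 fun k _ => ?_)
      exact (degree_monomial_le _ _).trans_lt (by exact_mod_cast k.2)
    exact absurd h1 (not_le.2 h2)
  have hwk : ∀ k, w k = 0 := fun k => by
    have h1 := congrArg (fun p => p.coeff (k : ℕ)) hQ
    simp only [Q, finsetSum_coeff, coeff_monomial, coeff_zero] at h1
    rw [Finset.sum_eq_single k (fun j _ hj => if_neg fun h => hj (Fin.ext h)) (by simp)] at h1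
    simpa using h1
  rw [hci]
  refine Finset.sum_eq_zero fun k _ => ?_
  rw [Fintype.linearIndependent_iff.1 hv (fun i => a i k) (hwk k) i, map_zero, zero_mul]

end Disjoint

section Entire
open Filter Topology

lemma exists_polynomial_of_growth {φ : ℂ → ℂ} (hφ : Differentiable ℂ φ) {B : ℝ} {κ : ℕ}
    (h : ∀ z, ‖φ z‖ ≤ B * (1 + ‖z‖) ^ κ) : ∃ Q : ℂ[X], ∀ z, φ z = Q.eval z := by
  have hB : 0 ≤ B := by
    have := (norm_nonneg _).trans (h 0)
    simpa using this
  have hz : ∀ n, κ < n → iteratedDeriv n φ 0 = 0 := by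
    intro n hn
    have key : ∀ R : ℝ, 1 ≤ R → ‖iteratedDeriv n φ 0‖ ≤ n.factorial * (B * 2 ^ κ) / R := by
      intro R hR
      have hR0 : 0 < R := by linarith
      have := Complex.norm_iteratedDeriv_le_of_forall_mem_sphere_norm_le (c := 0) (C := B * (1 + R) ^ κ) (f := φ) n hR0
        hφ.diffContOnCl (fun z hz => by
          have := h z
          rwa [mem_sphere_zero_iff_norm.1 hz] at this)
      refine this.trans ?_
      rw [div_le_div_iff₀ (by positivity) hR0]
      have h1 : (1 + R) ^ κ * R ≤ 2 ^ κ * R ^ n := by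
        calc (1 + R) ^ κ * R ≤ (2 * R) ^ κ * R := by gcongr; linarith
          _ = 2 ^ κ * R ^ (κ + 1) := by ring
          _ ≤ 2 ^ κ * R ^ n := by gcongr; exact hn
      calc n.factorial * (B * (1 + R) ^ κ) * R = n.factorial * B * ((1 + R) ^ κ * R) := by ring
        _ ≤ n.factorial * B * (2 ^ κ * R ^ n) := by gcongr
        _ = _ := by ring
    have hlim : Tendsto (fun R : ℝ => n.factorial * (B * 2 ^ κ) / R) atTop (𝓝 0) :=
      tendsto_const_nhds.div_atTop tendsto_id
    have := ge_of_tendsto hlim ((eventually_ge_atTop 1).mono key)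
    exact norm_le_zero_iff.1 this
  refine ⟨∑ n ∈ Finset.range (κ + 1), monomial n ((n.factorial : ℂ)⁻¹ * iteratedDeriv n φ 0), fun z => ?_⟩
  rw [← Complex.taylorSeries_eq_of_entire' 0 z hφ, tsum_eq_sum (s := Finset.range (κ + 1)), eval_finsetSum]
  · simp
  · intro n hn
    rw [hz n (by simpa using hn)]
    simp

/-- An entire quotient of polynomial growth is a polynomial. -/
lemma exists_polynomial_of_quotient_growth {u v : ℂ → ℂ} (hu : Differentiable ℂ u) (hv : Differentiable ℂ v)
    (hv0 : ∃ z, v z ≠ 0) {B : ℝ} {κ : ℕ} (h : ∀ z, ‖u z‖ ≤ B * (1 + ‖z‖) ^ κ * ‖v z‖) :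
    ∃ Q : ℂ[X], ∀ z, u z = Q.eval z * v z := by
  have hva : AnalyticOnNhd ℂ v Set.univ := fun z _ => hv.analyticAt z
  have hne : ∀ x, ∀ᶠ z in 𝓝[≠] x, v z ≠ 0 := by
    intro x
    rcases (hv.analyticAt x).eventually_eq_zero_or_eventually_ne_zero with h0 | h0
    · obtain ⟨z, hz⟩ := hv0
      have := hva.eqOn_zero_of_preconnected_of_eventuallyEq_zero isPreconnected_univ (Set.mem_univ x) h0
      exact absurd (this (Set.mem_univ z)) hz
    · exact h0
  have hmer : MeromorphicOn (u / v) Set.univ := fun x _ =>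
    (hu.analyticAt x).meromorphicAt.div (hv.analyticAt x).meromorphicAt
  set φ := toMeromorphicNFOn (u / v) Set.univ with hφdef
  have hφ : ∀ x, ∀ᶠ z in 𝓝[≠] x, φ z = u z / v z ∧ v z ≠ 0 := fun x =>
    (hmer.toMeromorphicNFOn_eq_self_on_nhdsNE (Set.mem_univ x)).and (hne x)
  have hbd : ∀ x, ∀ᶠ z in 𝓝[≠] x, ‖φ z‖ ≤ B * (1 + ‖z‖) ^ κ := fun x => by
    filter_upwards [hφ x] with z hz
    rw [hz.1, norm_div, div_le_iff₀ (norm_pos_iff.2 hz.2)]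
    exact h z
  have hord : ∀ x, 0 ≤ meromorphicOrderAt φ x := by
    intro x
    by_contra hlt
    have ht := tendsto_norm_cobounded_atTop.comp (tendsto_cobounded_of_meromorphicOrderAt_neg (not_le.1 hlt))
    have hc : Tendsto (fun z : ℂ => B * (1 + ‖z‖) ^ κ) (𝓝[≠] x) (𝓝 (B * (1 + ‖x‖) ^ κ)) := by
      refine tendsto_nhdsWithin_of_tendsto_nhds ?_
      exact (by fun_prop : Continuous fun z : ℂ => B * (1 + ‖z‖) ^ κ).tendsto x
    have h1 := hc.eventually (gt_mem_nhds (lt_add_one _))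
    have h2 := ht.eventually (eventually_ge_atTop (B * (1 + ‖x‖) ^ κ + 1))
    obtain ⟨z, hz1, hz2, hz3⟩ := (h1.and (h2.and (hbd x))).exists
    simp only [Function.comp_apply] at hz2
    linarith
  have hφd : Differentiable ℂ φ := fun x =>
    ((meromorphicNFOn_toMeromorphicNFOn (u / v) Set.univ (Set.mem_univ x)).meromorphicOrderAt_nonneg_iff_analyticAt.1
      (hord x)).differentiableAt
  have hgrowth : ∀ z, ‖φ z‖ ≤ B * (1 + ‖z‖) ^ κ := fun x =>
    le_of_tendsto_of_tendsto (tendsto_nhdsWithin_of_tendsto_nhds (hφd.continuous.norm.tendsto x))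
      (tendsto_nhdsWithin_of_tendsto_nhds ((by fun_prop : Continuous fun z : ℂ => B * (1 + ‖z‖) ^ κ).tendsto x)) (hbd x)
  have hmul : ∀ z, φ z * v z = u z := fun x => by
    refine tendsto_nhds_unique_of_eventuallyEq (l := 𝓝[≠] x)
      (tendsto_nhdsWithin_of_tendsto_nhds ((hφd.continuous.mul hv.continuous).tendsto x))
      (tendsto_nhdsWithin_of_tendsto_nhds (hu.continuous.tendsto x)) ?_
    filter_upwards [hφ x] with z hz
    rw [Pi.mul_apply, hz.1, div_mul_cancel₀ _ hz.2]
  obtain ⟨Q, hQ⟩ := exists_polynomial_of_growth hφd hgrowth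
  exact ⟨Q, fun z => by rw [← hQ, hmul]⟩

end Entire

section Entire
open Filter Topology

lemma coeff_mul_mul_pow (f g : PowerSeries ℂ) (z : ℂ) (n : ℕ) : PowerSeries.coeff n (f * g) * z ^ n =
    ∑ kl ∈ Finset.HasAntidiagonal.antidiagonal n,
      (PowerSeries.coeff kl.1 f * z ^ kl.1) * (PowerSeries.coeff kl.2 g * z ^ kl.2) := by
  rw [PowerSeries.coeff_mul, Finset.sum_mul]
  refine Finset.sum_congr rfl fun kl hkl => ?_
  rw [← Finset.HasAntidiagonal.mem_antidiagonal.1 hkl, pow_add]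
  ring

/-- Absolute convergence of a power series everywhere. -/
def Ent (f : PowerSeries ℂ) : Prop := ∀ z : ℂ, Summable fun n => ‖PowerSeries.coeff n f * z ^ n‖

lemma Ent.mul {f g : PowerSeries ℂ} (hf : Ent f) (hg : Ent g) : Ent (f * g) := fun z => by
  have h := summable_norm_sum_mul_antidiagonal_of_summable_norm (hf z) (hg z)
  exact h.congr fun n => by rw [coeff_mul_mul_pow]

lemma Ent.add {f g : PowerSeries ℂ} (hf : Ent f) (hg : Ent g) : Ent (f + g) := fun z => by
  refine Summable.of_nonneg_of_le (fun n => norm_nonneg _) (fun n => ?_) ((hf z).add (hg z))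
  rw [map_add, add_mul]
  exact norm_add_le _ _

lemma Ent.neg {f : PowerSeries ℂ} (hf : Ent f) : Ent (-f) := fun z =>
  (hf z).congr fun n => by rw [map_neg, neg_mul, norm_neg]

lemma ent_coe (p : ℂ[X]) : Ent (p : PowerSeries ℂ) := fun z => by
  refine summable_of_ne_finset_zero (s := p.support) fun n hn => ?_
  rw [Polynomial.coeff_coe, notMem_support_iff.1 hn]
  simp

/-- The ring of everywhere convergent power series. -/
def entC : Subring (PowerSeries ℂ) where
  carrier := {f | Ent f}
  mul_mem' := Ent.mul
  one_mem' := by simpa using ent_coe 1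
  add_mem' := Ent.add
  zero_mem' := by simpa using ent_coe 0
  neg_mem' := Ent.neg

/-- The value at `z` of an everywhere convergent power series. -/
def evC (z : ℂ) : entC →+* ℂ where
  toFun f := ∑' n, PowerSeries.coeff n (f : PowerSeries ℂ) * z ^ n
  map_one' := by
    rw [tsum_eq_single 0 fun n hn => by simp [PowerSeries.coeff_one, hn]]
    simp
  map_mul' f g := by
    rw [tsum_mul_tsum_eq_tsum_sum_antidiagonal_of_summable_norm (f.2 z) (g.2 z)]
    exact tsum_congr fun n => coeff_mul_mul_pow _ _ _ _
  map_zero' := by simp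
  map_add' f g := by
    rw [← (f.2 z).of_norm.tsum_add (g.2 z).of_norm]
    exact tsum_congr fun n => by
      rw [Subring.coe_add, map_add, add_mul]

lemma evC_apply (z : ℂ) (f : entC) : evC z f = ∑' n, PowerSeries.coeff n (f : PowerSeries ℂ) * z ^ n := rfl

lemma evC_hasFPowerSeriesOnBall (f : entC) : HasFPowerSeriesOnBall (fun z => evC z f)
    (FormalMultilinearSeries.ofScalars ℂ fun n => PowerSeries.coeff n (f : PowerSeries ℂ)) 0 ⊤ := by
  set p := FormalMultilinearSeries.ofScalars ℂ fun n => PowerSeries.coeff n (f : PowerSeries ℂ) with hp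
  have hr : p.radius = ⊤ := p.radius_eq_top_of_summable_norm fun r => by
    refine (f.2 (r : ℂ)).congr fun n => ?_
    rw [hp, FormalMultilinearSeries.ofScalars_norm, norm_mul, norm_pow]
    simp
  have h := p.hasFPowerSeriesOnBall (by rw [hr]; exact ENNReal.zero_lt_top)
  rw [hr] at h
  refine h.congr fun z _ => ?_
  refine (FormalMultilinearSeries.ofScalars_sum_eq _ z).trans ?_
  rfl

lemma evC_differentiable (f : entC) : Differentiable ℂ fun z => evC z f := by
  have h := (evC_hasFPowerSeriesOnBall f).differentiableOn
  rw [Metric.eball_top, differentiableOn_univ] at h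
  exact h

lemma evC_injective {f g : entC} (h : ∀ z, evC z f = evC z g) : f = g := by
  have hf := (evC_hasFPowerSeriesOnBall f).hasFPowerSeriesAt
  have hg := (evC_hasFPowerSeriesOnBall g).hasFPowerSeriesAt
  rw [show (fun z => evC z f) = fun z => evC z g from funext h] at hf
  have := FormalMultilinearSeries.ofScalars_series_injective ℂ ℂ (hf.eq_formalMultilinearSeries hg)
  ext n
  exact congrFun this n

lemma coe_mem_entC (p : ℂ[X]) : (p : PowerSeries ℂ) ∈ entC := ent_coe p

lemma evC_coe (p : ℂ[X]) (z : ℂ) : evC z ⟨p, coe_mem_entC p⟩ = p.eval z := by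
  rw [evC_apply, tsum_eq_sum (s := p.support) fun n hn => by
    rw [Polynomial.coeff_coe, notMem_support_iff.1 hn, zero_mul], eval_eq_sum, Polynomial.sum]
  exact Finset.sum_congr rfl fun n _ => by rw [Polynomial.coeff_coe]

/-- Base change of a rational power series to the complex numbers. -/
def toC : PowerSeries ℚ →+* PowerSeries ℂ := PowerSeries.map (algebraMap ℚ ℂ)

lemma toC_injective : Function.Injective toC := PowerSeries.map_injective _ (algebraMap ℚ ℂ).injective

lemma toC_coe (p : ℚ[X]) : toC p = ((p.map (algebraMap ℚ ℂ) : ℂ[X]) : PowerSeries ℂ) := by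
  rw [toC, Polynomial.polynomial_map_coe]

/-- Rational power series which converge everywhere. -/
def ent : Subring (PowerSeries ℚ) := entC.comap toC

lemma coe_mem_ent (p : ℚ[X]) : (p : PowerSeries ℚ) ∈ ent := by
  rw [ent, Subring.mem_comap, toC_coe]
  exact coe_mem_entC _

/-- The value at `z` of an everywhere convergent rational power series. -/
def ev (z : ℂ) : ent →+* ℂ := (evC z).comp (toC.restrict ent entC fun _ h => h)

lemma ev_coe (p : ℚ[X]) (z : ℂ) : ev z ⟨p, coe_mem_ent p⟩ = (p.map (algebraMap ℚ ℂ)).eval z := by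
  rw [← evC_coe]
  change evC z ⟨toC p, _⟩ = _
  congr 1
  exact Subtype.ext (toC_coe p)

lemma ev_differentiable (f : ent) : Differentiable ℂ fun z => ev z f := evC_differentiable _

lemma ev_injective {f g : ent} (h : ∀ z, ev z f = ev z g) : f = g := by
  have := evC_injective h
  exact Subtype.ext (toC_injective (congrArg Subtype.val this))

end Entire

lemma exists_eval_growth (p : ℂ[X]) : ∃ (B : ℝ) (κ : ℕ), 0 ≤ B ∧ ∀ z : ℂ, ‖p.eval z‖ ≤ B * (1 + ‖z‖) ^ κ := by
  refine ⟨∑ i ∈ p.support, ‖p.coeff i‖, p.natDegree, Finset.sum_nonneg fun _ _ => norm_nonneg _, fun z => ?_⟩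
  rw [eval_eq_sum, Polynomial.sum, Finset.sum_mul]
  refine (norm_sum_le _ _).trans (Finset.sum_le_sum fun i hi => ?_)
  rw [norm_mul, norm_pow]
  gcongr
  calc ‖z‖ ^ i ≤ (1 + ‖z‖) ^ i := by gcongr; linarith
    _ ≤ (1 + ‖z‖) ^ p.natDegree :=
      pow_le_pow_right₀ (by linarith [norm_nonneg z]) (le_natDegree_of_mem_supp _ hi)

lemma exists_sum_growth {n : ℕ} (p : ℕ → ℂ[X]) :
    ∃ (B : ℝ) (κ : ℕ), 0 ≤ B ∧ ∀ z : ℂ, ∑ i ∈ Finset.range n, ‖(p i).eval z‖ ≤ B * (1 + ‖z‖) ^ κ := by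
  induction n with
  | zero => exact ⟨0, 0, le_rfl, fun z => by simp⟩
  | succ n ih =>
    obtain ⟨B, κ, hB, h⟩ := ih
    obtain ⟨B', κ', hB', h'⟩ := exists_eval_growth (p n)
    refine ⟨B + B', max κ κ', by positivity, fun z => ?_⟩
    have h1 : (1 : ℝ) ≤ 1 + ‖z‖ := by linarith [norm_nonneg z]
    rw [Finset.sum_range_succ, add_mul]
    refine add_le_add ((h z).trans ?_) ((h' z).trans ?_)
    · gcongr
      · exact le_max_left _ _
    · gcongr
      · exact le_max_right _ _

/-- A bound for the solutions of a homogeneous monic equation. -/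
lemma norm_le_of_homogeneous_eq_zero {n : ℕ} (hn : 0 < n) (c : ℕ → ℂ) {x y : ℂ}
    (h : x ^ n + ∑ i ∈ Finset.range n, c i * x ^ i * y ^ (n - i) = 0) :
    ‖x‖ ≤ (1 + ∑ i ∈ Finset.range n, ‖c i‖) * ‖y‖ := by
  have hS : 0 ≤ ∑ i ∈ Finset.range n, ‖c i‖ := Finset.sum_nonneg fun _ _ => norm_nonneg _
  by_contra hlt
  rw [not_le] at hlt
  have hxy : ‖y‖ ≤ ‖x‖ := by nlinarith [norm_nonneg y, mul_nonneg hS (norm_nonneg y)]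
  have hx : 0 < ‖x‖ := lt_of_le_of_lt (by positivity) hlt
  have h1 : ‖x‖ ^ n ≤ ∑ i ∈ Finset.range n, ‖c i‖ * (‖x‖ ^ (n - 1) * ‖y‖) := by
    rw [← norm_pow, eq_neg_of_add_eq_zero_left h, norm_neg]
    refine (norm_sum_le _ _).trans (Finset.sum_le_sum fun i hi => ?_)
    have hi := Finset.mem_range.1 hi
    rw [norm_mul, norm_mul, norm_pow, norm_pow, mul_assoc]
    refine mul_le_mul_of_nonneg_left ?_ (norm_nonneg _)
    calc ‖x‖ ^ i * ‖y‖ ^ (n - i) = ‖x‖ ^ i * (‖y‖ ^ (n - 1 - i) * ‖y‖) := by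
          rw [← pow_succ]; congr 2; lia
      _ ≤ ‖x‖ ^ i * (‖x‖ ^ (n - 1 - i) * ‖y‖) := by gcongr
      _ = ‖x‖ ^ (n - 1) * ‖y‖ := by
          rw [← mul_assoc, ← pow_add]; congr 2; lia
  rw [← Finset.sum_mul] at h1
  have h2 : ‖x‖ ^ n = ‖x‖ ^ (n - 1) * ‖x‖ := by rw [← pow_succ]; congr 1; lia
  have hp : 0 < ‖x‖ ^ (n - 1) := by positivity
  have h3 : ‖x‖ ≤ (∑ i ∈ Finset.range n, ‖c i‖) * ‖y‖ := by
    refine le_of_mul_le_mul_left ?_ hp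
    rw [← h2]
    exact h1.trans (le_of_eq (by ring))
  nlinarith [norm_nonneg y]

/-- `h` is a quotient of two everywhere convergent power series. -/
def IsMer (h : Lau) : Prop :=
  ∃ u v : PowerSeries ℚ, u ∈ ent ∧ v ∈ ent ∧ v ≠ 0 ∧ h * (v : Lau) = u

lemma IsMer.add {h h' : Lau} (H : IsMer h) (H' : IsMer h') : IsMer (h + h') := by
  obtain ⟨u, v, hu, hv, hv0, e⟩ := H
  obtain ⟨u', v', hu', hv', hv0', e'⟩ := H'
  refine ⟨u * v' + u' * v, v * v', add_mem (mul_mem hu hv') (mul_mem hu' hv), mul_mem hv hv', mul_ne_zero hv0 hv0', ?_⟩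
  rw [PowerSeries.coe_mul, PowerSeries.coe_add, PowerSeries.coe_mul, PowerSeries.coe_mul, ← e, ← e']
  ring

lemma IsMer.mul {h h' : Lau} (H : IsMer h) (H' : IsMer h') : IsMer (h * h') := by
  obtain ⟨u, v, hu, hv, hv0, e⟩ := H
  obtain ⟨u', v', hu', hv', hv0', e'⟩ := H'
  refine ⟨u * u', v * v', mul_mem hu hu', mul_mem hv hv', mul_ne_zero hv0 hv0', ?_⟩
  rw [PowerSeries.coe_mul, PowerSeries.coe_mul, ← e, ← e']
  ring

lemma coe_ne_zero {v : PowerSeries ℚ} (h : v ≠ 0) : (v : Lau) ≠ 0 := fun h0 =>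
  h (HahnSeries.ofPowerSeries_injective (h0.trans (PowerSeries.coe_zero).symm))

lemma IsMer.inv {h : Lau} (H : IsMer h) : IsMer h⁻¹ := by
  obtain ⟨u, v, hu, hv, hv0, e⟩ := H
  rcases eq_or_ne h 0 with rfl | h0
  · rw [inv_zero]
    exact ⟨0, 1, zero_mem _, one_mem _, one_ne_zero, by simp⟩
  · refine ⟨v, u, hv, hu, ?_, ?_⟩
    · rintro rfl
      rw [PowerSeries.coe_zero] at e
      exact mul_ne_zero h0 (coe_ne_zero hv0) e
    · rw [← e, inv_mul_cancel_left₀ h0]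

lemma isMer_coe {u : PowerSeries ℚ} (hu : u ∈ ent) : IsMer (u : Lau) :=
  ⟨u, 1, hu, one_mem _, one_ne_zero, by simp⟩

lemma isMer_pl (p : ℚ[X]) : IsMer (pl p) := by
  rw [pl_eq]
  exact isMer_coe (coe_mem_ent p)

lemma isMer_algebraMap (c : Rat1) : IsMer (algebraMap Rat1 Lau c) := by
  obtain ⟨p, q, hq, rfl⟩ := IsFractionRing.div_surjective (A := ℚ[X]) c
  rw [algebraMap_div, div_eq_mul_inv]
  exact (isMer_pl p).mul (isMer_pl q).inv

/-- The field of quotients of everywhere convergent power series. -/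
def mer : IntermediateField Rat1 Lau where
  carrier := {h | IsMer h}
  mul_mem' := IsMer.mul
  add_mem' := IsMer.add
  algebraMap_mem' := isMer_algebraMap
  inv_mem' _ := IsMer.inv

lemma mem_mer {h : Lau} : h ∈ mer ↔ IsMer h := Iff.rfl

lemma mem_pl_range_of_quotient {y : Lau} {u v : PowerSeries ℚ} (hv : v ≠ 0) (h : y * (v : Lau) = u) {Q : ℂ[X]}
    (hQ : toC u = (Q : PowerSeries ℂ) * toC v) : y ∈ pl.range := by
  have hdvd : v ∣ u := by
    rcases ValuationRing.dvd_total v u with h1 | ⟨w, hw⟩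
    · exact h1
    · rcases eq_or_ne u 0 with rfl | hu
      · exact dvd_zero _
      · have h1 : (Q : PowerSeries ℂ) * toC w = 1 := by
          have hu' : toC u ≠ 0 := fun h0 => hu (toC_injective (h0.trans (map_zero _).symm))
          refine mul_left_cancel₀ hu' ?_
          rw [mul_one]
          conv_rhs => rw [hQ, hw, map_mul]
          ring
        have h2 : IsUnit w := by
          rw [PowerSeries.isUnit_iff_constantCoeff, isUnit_iff_ne_zero]
          intro h0
          have h3 := congrArg PowerSeries.constantCoeff h1
          rw [map_mul, toC, ← PowerSeries.coeff_zero_eq_constantCoeff_apply (PowerSeries.map _ w),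
            PowerSeries.coeff_map, PowerSeries.coeff_zero_eq_constantCoeff_apply, h0] at h3
          simp at h3
        rw [hw]
        exact (h2.mul_right_dvd).2 dvd_rfl
  obtain ⟨w, hw⟩ := hdvd
  have hyw : y = (w : Lau) := by
    refine mul_right_cancel₀ (coe_ne_zero hv) ?_
    rw [h, hw, PowerSeries.coe_mul, mul_comm]
  have hwQ : toC w = (Q : PowerSeries ℂ) := by
    have hv' : toC v ≠ 0 := fun h0 => hv (toC_injective (h0.trans (map_zero _).symm))
    refine mul_right_cancel₀ hv' ?_
    rw [← hQ, hw, map_mul, mul_comm]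
  refine ⟨PowerSeries.trunc (Q.natDegree + 1) w, ?_⟩
  rw [pl_eq, hyw]
  congr 1
  ext n
  rw [Polynomial.coeff_coe, PowerSeries.coeff_trunc]
  split_ifs with hn
  · rfl
  · have h1 := congrArg (PowerSeries.coeff n) hwQ
    rw [toC, PowerSeries.coeff_map, Polynomial.coeff_coe, coeff_eq_zero_of_natDegree_lt (by lia)] at h1
    exact ((map_eq_zero _).1 h1).symm

lemma mem_pl_range_of_isIntegral {y : Lau} (hy : IsMer y) (hint : IsIntegral ℚ[X] y) : y ∈ pl.range := by
  obtain ⟨u, v, hu, hv, hv0, e⟩ := hy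
  obtain ⟨P, hP, hP0⟩ := hint
  set n := P.natDegree with hn
  have hn0 : 0 < n := by
    rw [hn, Nat.pos_iff_ne_zero]
    intro h0
    rw [hP.natDegree_eq_zero.1 h0] at hP0
    simp at hP0
  have hrel : u ^ n + ∑ i ∈ Finset.range n, (P.coeff i : PowerSeries ℚ) * u ^ i * v ^ (n - i) = 0 := by
    apply HahnSeries.ofPowerSeries_injective (Γ := ℤ)
    rw [map_zero, map_add, map_sum, map_pow]
    rw [eval₂_eq_sum_range, Finset.sum_range_succ, ← hn, hP.coeff_natDegree, map_one, one_mul] at hP0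
    change ((u : Lau)) ^ n + _ = 0
    have h1 : (u : Lau) ^ n = y ^ n * (v : Lau) ^ n := by rw [← e, mul_pow]
    rw [h1, ← zero_mul ((v : Lau) ^ n), ← hP0, add_mul, add_comm, Finset.sum_mul]
    congr 1
    refine Finset.sum_congr rfl fun i hi => ?_
    rw [map_mul, map_mul, map_pow, map_pow]
    change pl (P.coeff i) * (u : Lau) ^ i * (v : Lau) ^ (n - i) = _
    rw [← e, mul_pow, ← Nat.add_sub_of_le (Finset.mem_range.1 hi).le, pow_add (v : Lau), Nat.add_sub_cancel_left]
    ring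
  let U : ent := ⟨u, hu⟩
  let W : ent := ⟨v, hv⟩
  have hrel' : U ^ n + ∑ i ∈ Finset.range n, (⟨P.coeff i, coe_mem_ent _⟩ : ent) * U ^ i * W ^ (n - i) = 0 := by
    apply Subtype.ext
    refine Eq.trans ?_ hrel
    simp [U, W, AddSubmonoidClass.coe_finsetSum]
  obtain ⟨B, κ, hB, hBκ⟩ := exists_sum_growth (n := n) fun i => (P.coeff i).map (algebraMap ℚ ℂ)
  obtain ⟨Q, hQ⟩ := exists_polynomial_of_quotient_growth (ev_differentiable U) (ev_differentiable W) (B := 1 + B) (κ := κ)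
    (by
      by_contra! h0
      refine hv0 (congrArg Subtype.val (ev_injective (f := W) (g := 0) fun z => ?_))
      rw [h0, map_zero])
    (fun z => by
      have h1 := congrArg (ev z) hrel'
      simp only [map_add, map_sum, map_mul, map_pow, map_zero, ev_coe] at h1
      refine (norm_le_of_homogeneous_eq_zero hn0 _ h1).trans ?_
      refine mul_le_mul_of_nonneg_right ?_ (norm_nonneg _)
      have h2 : (1 : ℝ) ≤ (1 + ‖z‖) ^ κ := one_le_pow₀ (by linarith [norm_nonneg z])
      linarith [hBκ z])
  refine mem_pl_range_of_quotient hv0 e (Q := Q) ?_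
  have h3 := evC_injective (f := ⟨toC u, hu⟩) (g := ⟨Q, coe_mem_entC Q⟩ * ⟨toC v, hv⟩) fun z => by
    rw [map_mul, evC_coe]
    exact hQ z
  exact congrArg Subtype.val h3

/-- Rational functions are algebraically closed in the field of quotients of entire series. -/
lemma mer_relatively_closed (x : mer) (hx : IsAlgebraic Rat1 x) : x ∈ (algebraMap Rat1 mer).range := by
  have hx' : IsAlgebraic Rat1 (x : Lau) := hx.algebraMap (A := Lau)
  rw [← IsFractionRing.isAlgebraic_iff ℚ[X] Rat1 Lau] at hx'
  obtain ⟨p, hp, hint⟩ := hx'.exists_integral_multiple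
  have hm : IsMer (p • (x : Lau)) := by
    rw [Algebra.smul_def]
    exact (isMer_pl p).mul x.2
  obtain ⟨q, hq⟩ := mem_pl_range_of_isIntegral hm hint
  refine ⟨algebraMap ℚ[X] Rat1 q / algebraMap ℚ[X] Rat1 p, Subtype.ext ?_⟩
  change algebraMap Rat1 Lau _ = _
  have hp0 : pl p ≠ 0 := by simpa using pl_injective.ne hp
  rw [algebraMap_div, hq, Algebra.smul_def, mul_div_cancel_left₀ _ hp0]

section NormForms
open TensorProduct

/-- A finitely generated domain over a field has points in any algebraically closed extension. -/
lemma exists_algHom_of_finiteType (F B Ω : Type*) [Field F] [CommRing B] [Nontrivial B] [Algebra F B]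
    [Algebra.FiniteType F B] [Field Ω] [IsAlgClosed Ω] [Algebra F Ω] :
    ∃ χ : B →ₐ[F] Ω, ∀ b, IsAlgebraic F (χ b) := by
  obtain ⟨m, hm⟩ := Ideal.exists_maximal B
  let _ : Field (B ⧸ m) := Ideal.Quotient.field m
  have : Algebra.FiniteType F (B ⧸ m) :=
    Algebra.FiniteType.of_surjective (Ideal.Quotient.mkₐ F m) (Ideal.Quotient.mkₐ_surjective F m)
  have : Module.Finite F (B ⧸ m) := finite_of_finite_type_of_isJacobsonRing F (B ⧸ m)
  refine ⟨(IsAlgClosed.lift (R := F) (S := B ⧸ m) (M := Ω)).comp (Ideal.Quotient.mkₐ F m), fun b => ?_⟩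
  have h : IsIntegral F (Ideal.Quotient.mkₐ F m b) := Algebra.IsIntegral.isIntegral _
  exact (h.map (IsAlgClosed.lift (R := F) (S := B ⧸ m) (M := Ω))).isAlgebraic

section Specialize
variable {ι : Type} [Fintype ι] [DecidableEq ι] {L : Type*} [Field L] [Algebra ℚ L] (θ : Module.Basis ι ℚ L)

/-- If the norm form vanishes at a combination of linearly independent functions, it vanishes at each coefficient. -/
lemma normForm_coeff_eq_zero {F M N P κ : Type*} (Ω : Type*) [Field Ω] [IsAlgClosed Ω] [Field F] [CharZero F] [Field M] [Field N] [Field P] [Algebra F M]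
    [Algebra M N] [Algebra F N] [IsScalarTower F M N] [Algebra F P]
    [Algebra N Ω] [Algebra M Ω] [Algebra F Ω] [IsScalarTower M N Ω] [IsScalarTower F M Ω] [IsScalarTower F N Ω]
    (hFM : ∀ x : M, IsAlgebraic F x → x ∈ (algebraMap F M).range) [Fintype κ] {v : κ → M}
    (hv : LinearIndependent F v) (b : ι → κ → P) (φ : ℚ →+* P ⊗[F] N) (φ' : ℚ →+* P)
    (h : normForm θ φ (fun j => ∑ x, b j x ⊗ₜ[F] algebraMap M N (v x)) = 0) (k : κ) :
    normForm θ φ' (fun j => b j k) = 0 := by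
  by_contra hne
  have : CharZero N := charZero_of_injective_algebraMap (algebraMap F N).injective
  have : CharZero Ω := charZero_of_injective_algebraMap (algebraMap N Ω).injective
  let s : Set P := Set.range (fun jx : ι × κ => b jx.1 jx.2) ∪ {(normForm θ φ' fun j => b j k)⁻¹}
  let B := Algebra.adjoin F s
  have hs : s.Finite := (Set.finite_range _).union (Set.finite_singleton _)
  have : Algebra.FiniteType F B := Algebra.FiniteType.adjoin_of_finite hs
  let b' : ι → κ → B := fun j x => ⟨b j x, Algebra.subset_adjoin (Or.inl ⟨(j, x), rfl⟩)⟩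
  let i' : B := ⟨(normForm θ φ' fun j => b j k)⁻¹, Algebra.subset_adjoin (Or.inr rfl)⟩
  let φB : ℚ →+* B := (algebraMap F B).comp (algebraMap ℚ F)
  obtain ⟨χ, hχ⟩ := exists_algHom_of_finiteType F B Ω
  have hunit : normForm θ φB (fun j => b' j k) * i' = 1 := by
    apply Subtype.val_injective
    have h1 : B.val (normForm θ φB fun j => b' j k) = normForm θ φ' fun j => b j k :=
      map_normForm θ φB φ' (B.val : B →+* P) _
    change B.val _ * _ = 1
    rw [h1]
    exact mul_inv_cancel₀ hne
  have hB : normForm θ ((algebraMap F (B ⊗[F] N)).comp (algebraMap ℚ F))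
      (fun j => ∑ x, b' j x ⊗ₜ[F] algebraMap M N (v x)) = 0 := by
    have hinj : Function.Injective (Algebra.TensorProduct.map B.val (AlgHom.id F N)) :=
      Module.Flat.rTensor_preserves_injective_linearMap (M := N) B.val.toLinearMap Subtype.val_injective
    apply hinj
    rw [map_zero, ← h]
    refine (map_normForm θ _ φ (Algebra.TensorProduct.map B.val (AlgHom.id F N) : B ⊗[F] N →+* P ⊗[F] N) _).trans ?_
    congr 1
    funext j
    simp [b']
  let Ψ : B ⊗[F] N →ₐ[F] Ω := Algebra.TensorProduct.lift χ (IsScalarTower.toAlgHom F N Ω) fun _ _ => Commute.all _ _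
  have hΩ : normForm θ (algebraMap ℚ Ω) (fun j => ∑ x, χ (b' j x) * algebraMap M Ω (v x)) = 0 := by
    have h1 := congrArg (Ψ : B ⊗[F] N →+* Ω) hB
    rw [map_normForm θ _ (algebraMap ℚ Ω), map_zero] at h1
    rw [← h1]
    congr 1
    funext j
    simp [Ψ, IsScalarTower.algebraMap_apply M N Ω]
  obtain ⟨σ, hσ⟩ := exists_embedding_of_normForm_eq_zero θ _ _ hΩ
  have hfd : FiniteDimensional ℚ L := θ.finiteDimensional_of_finite
  have hσalg : ∀ l, IsAlgebraic F (σ l) := fun l => by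
    have h1 : IsIntegral ℚ (σ l) := (Algebra.IsIntegral.isIntegral (R := ℚ) l).map σ.toRatAlgHom
    have : IsScalarTower ℚ F Ω := inferInstance
    exact h1.isAlgebraic.tower_top F
  have hsum : ∑ x, (∑ j, χ (b' j x) * σ (θ j)) * algebraMap M Ω (v x) = 0 := by
    rw [← hσ]
    simp only [Finset.sum_mul]
    rw [Finset.sum_comm]
    exact Finset.sum_congr rfl fun j _ => Finset.sum_congr rfl fun x _ => by ring
  have hlin := linear_disjoint hFM hv
    (fun x => (IsIntegral.sum _ fun j _ => (hχ _).isIntegral.mul (hσalg _).isIntegral).isAlgebraic) hsum k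
  have h0 := normForm_eq_zero θ (algebraMap ℚ Ω) (fun j => χ (b' j k)) σ hlin
  have h1 := congrArg χ hunit
  rw [map_mul, map_one] at h1
  have h2 : χ (normForm θ φB fun j => b' j k) = 0 :=
    (map_normForm θ _ (algebraMap ℚ Ω) (χ : B →+* Ω) _).trans h0
  rw [h2, zero_mul] at h1
  exact zero_ne_one h1

end Specialize

section Expansion

/-- Laurent series in the local parameter `t = z - 1`. -/
def Pt := LaurentSeries ℚ

instance : Field Pt := inferInstanceAs (Field (LaurentSeries ℚ))

instance : Algebra (PowerSeries ℚ) Pt := inferInstanceAs (Algebra (PowerSeries ℚ) (LaurentSeries ℚ))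

/-- Taylor expansion at `1`. -/
def taylorOne : ℚ[X] →+* PowerSeries ℚ := (Polynomial.coeToPowerSeries.ringHom).comp (taylorAlgHom (1 : ℚ)).toRingHom

lemma taylorOne_apply (p : ℚ[X]) : taylorOne p = ((taylor 1 p : ℚ[X]) : PowerSeries ℚ) := rfl

lemma taylorOne_injective : Function.Injective taylorOne := fun _ _ h =>
  taylor_injective 1 (Polynomial.coe_injective ℚ h)

lemma algebraMap_pt_injective : Function.Injective (algebraMap (PowerSeries ℚ) Pt) :=
  HahnSeries.ofPowerSeries_injective

instance : Algebra Rat1 Pt := (IsFractionRing.lift (K := Rat1) (g := (algebraMap (PowerSeries ℚ) Pt).comp taylorOne)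
  (algebraMap_pt_injective.comp taylorOne_injective)).toAlgebra

lemma algebraMap_rat_pt (p : ℚ[X]) : algebraMap Rat1 Pt (algebraMap ℚ[X] Rat1 p) =
    algebraMap (PowerSeries ℚ) Pt (taylorOne p) := IsFractionRing.lift_algebraMap _ p

/-- Taylor expansion at `1` of the rational functions regular there. -/
def taylorLoc : Loc →+* PowerSeries ℚ := IsLocalization.lift (M := idOne.primeCompl) (S := Loc) (g := taylorOne) fun q => by
  rw [PowerSeries.isUnit_iff_constantCoeff, isUnit_iff_ne_zero, ← PowerSeries.coeff_zero_eq_constantCoeff_apply,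
    taylorOne_apply, Polynomial.coeff_coe, taylor_coeff_zero]
  exact fun h => q.2 (mem_idOne.2 h)

lemma algebraMap_loc_pt (c : Loc) : algebraMap Rat1 Pt (algebraMap Loc Rat1 c) = algebraMap (PowerSeries ℚ) Pt (taylorLoc c) := by
  have h : ((algebraMap Rat1 Pt).comp (algebraMap Loc Rat1)) = (algebraMap (PowerSeries ℚ) Pt).comp taylorLoc := by
    refine IsLocalization.ringHom_ext idOne.primeCompl (RingHom.ext fun p => ?_)
    simp only [RingHom.comp_apply]
    rw [← IsScalarTower.algebraMap_apply ℚ[X] Loc Rat1, algebraMap_rat_pt, taylorLoc, IsLocalization.lift_eq]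
  exact congrArg (fun f : Loc →+* Pt => f c) h

instance : SMulCommClass Rat1 (PowerSeries ℚ) Pt := ⟨fun a b c => by
  rw [Algebra.smul_def, Algebra.smul_def, Algebra.smul_def, Algebra.smul_def, mul_left_comm]⟩

/-- Analytic functions near `0` with coefficients expanded near `1`. -/
abbrev Tp := Pt ⊗[Rat1] Lau

/-- The inclusion of series in `z`. -/
def inT : Lau →+* Tp := (Algebra.TensorProduct.includeRight : Lau →ₐ[Rat1] Tp).toRingHom

lemma inT_apply (w : Lau) : inT w = (1 : Pt) ⊗ₜ[Rat1] w := rfl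

lemma smul_inT (c : PowerSeries ℚ) (w : Lau) : c • inT w = algebraMap (PowerSeries ℚ) Pt c ⊗ₜ[Rat1] w := by
  rw [inT_apply, TensorProduct.smul_tmul', Algebra.smul_def, mul_one]

lemma inT_loc_smul (c : Loc) (w : Lau) : inT (c • w) = taylorLoc c • inT w := by
  rw [smul_inT, ← algebraMap_loc_pt, inT_apply, ← IsScalarTower.algebraMap_smul Rat1 c w, ← TensorProduct.smul_tmul,
    Algebra.smul_def, mul_one]

lemma inT_X : inT (pl X) = algebraMap (PowerSeries ℚ) Tp (1 + PowerSeries.X) := by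
  have h : pl X = (algebraMap ℚ[X] Loc X) • (1 : Lau) := by
    rw [Algebra.smul_def, mul_one, ← IsScalarTower.algebraMap_apply]
  rw [h, inT_loc_smul, smul_inT, Algebra.TensorProduct.algebraMap_apply]
  congr 2
  rw [taylorLoc, IsLocalization.lift_eq, taylorOne_apply, taylor_X]
  simp [add_comm]

lemma exists_hasLim_of_loc {g : Lau} {K : ℕ} (h : D^[K] g ∈ spanLT Loc D g K) :
    ∃ c : ℕ → Fin K → PowerSeries ℚ, ∀ k, inT (D^[k] g) = ∑ i, c k i • inT (D^[i] g) := by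
  have hmem : ∀ k, D^[k] g ∈ spanLT Loc D g K := by
    intro k
    induction k with
    | zero =>
      rcases Nat.eq_zero_or_pos K with rfl | hK
      · exact h
      · exact iterate_mem_spanLT D g hK
    | succ k ih =>
      rw [Function.iterate_succ_apply' D]
      apply spanLT_stable (R := Loc) (V := Lau) (δ := D) (d := dLoc) _ h ih
      exact D_smul_loc
  have hex : ∀ k, ∃ c : Fin K → PowerSeries ℚ, inT (D^[k] g) = ∑ i, c i • inT (D^[i] g) := fun k => by
    obtain ⟨c, hc⟩ := (Submodule.mem_span_range_iff_exists_fun Loc).1 (hmem k)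
    refine ⟨fun i => taylorLoc (c i), ?_⟩
    rw [← hc, map_sum]
    exact Finset.sum_congr rfl fun i _ => inT_loc_smul _ _
  choose c hc using hex
  exact ⟨c, hc⟩

lemma exists_tmul_sum {t : Set Lau} [Fintype t] {w : Lau} (hw : w ∈ Submodule.span Rat1 t) (p : Pt) :
    ∃ b : t → Pt, p ⊗ₜ[Rat1] w = ∑ x, b x ⊗ₜ[Rat1] (x : Lau) := by
  rw [← Subtype.range_coe (s := t)] at hw
  obtain ⟨c, rfl⟩ := (Submodule.mem_span_range_iff_exists_fun Rat1).1 hw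
  refine ⟨fun x => c x • p, ?_⟩
  rw [TensorProduct.tmul_sum]
  exact Finset.sum_congr rfl fun x _ => by rw [TensorProduct.smul_tmul]

lemma exists_sum_of_mem_span {t : Set Lau} [Fintype t] {K : ℕ} {w : Fin K → Lau} (hw : ∀ i, w i ∈ Submodule.span Rat1 t) {y : Tp}
    (hy : y ∈ Submodule.span (PowerSeries ℚ) (Set.range fun i => inT (w i))) :
    ∃ b : t → Pt, y = ∑ x, b x ⊗ₜ[Rat1] (x : Lau) := by
  obtain ⟨c, rfl⟩ := (Submodule.mem_span_range_iff_exists_fun (PowerSeries ℚ)).1 hy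
  choose b hb using fun i => exists_tmul_sum (hw i) (algebraMap (PowerSeries ℚ) Pt (c i))
  refine ⟨fun x => ∑ i, b i x, ?_⟩
  simp only [TensorProduct.sum_tmul]
  rw [Finset.sum_comm]
  exact Finset.sum_congr rfl fun i _ => by rw [smul_inT, hb]

end Expansion

/-- The power series with rational coefficients which are `E`-functions. -/
def IsEQ (f : PowerSeries ℚ) : Prop := Hol (f : Lau) ∧ Geom fun n => (n.factorial : ℚ) * PowerSeries.coeff n f

lemma ex_factorial_mul_coeff (f : PowerSeries ℚ) : ex (fun n => (n.factorial : ℚ) * PowerSeries.coeff n f) = f := by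
  ext n
  rw [ex, PowerSeries.coeff_mk, mul_div_cancel_left₀ _ (Nat.cast_ne_zero.2 n.factorial_ne_zero)]

lemma IsEQ.exists_iterate_mem {f : PowerSeries ℚ} (h : IsEQ f) : ∃ K, D^[K] (f : Lau) ∈ spanLT Loc D (f : Lau) K := by
  have := andre (a := fun n => (n.factorial : ℚ) * PowerSeries.coeff n f) (by rw [ex_factorial_mul_coeff]; exact h.1) h.2
  rwa [ex_factorial_mul_coeff] at this

lemma coeff_toC (f : PowerSeries ℚ) (n : ℕ) : PowerSeries.coeff n (toC f) = ((PowerSeries.coeff n f : ℚ) : ℂ) := by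
  simp [toC]

lemma ent_of_bound {f : PowerSeries ℂ} {C : ℝ}
    (h : ∀ n, ‖PowerSeries.coeff n f‖ ≤ C ^ (n + 1) / n.factorial) : Ent f := fun z => by
  refine Summable.of_nonneg_of_le (fun n => norm_nonneg _) (fun n => ?_)
    ((Real.summable_pow_div_factorial (C * ‖z‖)).mul_left C)
  rw [norm_mul, norm_pow]
  calc _ ≤ C ^ (n + 1) / n.factorial * ‖z‖ ^ n := mul_le_mul_of_nonneg_right (h n) (by positivity)
    _ = _ := by rw [mul_pow, pow_succ]; ring

lemma norm_coeff_le {f : PowerSeries ℚ} {n : ℕ} {B : ℝ}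
    (h : |(((n.factorial : ℚ) * PowerSeries.coeff n f : ℚ) : ℝ)| ≤ B) :
    ‖((PowerSeries.coeff n f : ℚ) : ℂ)‖ ≤ B / n.factorial := by
  have hn : (0 : ℝ) < n.factorial := by positivity
  rw [le_div_iff₀ hn, ← Complex.ofReal_ratCast, Complex.norm_real, Real.norm_eq_abs]
  rwa [Rat.cast_mul, Rat.cast_natCast, abs_mul, Nat.abs_cast, mul_comm] at h

lemma IsEQ.mem_ent {f : PowerSeries ℚ} (h : IsEQ f) : f ∈ ent := by
  obtain ⟨C, hC, hN⟩ := h.2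
  refine ent_of_bound (C := C) fun n => ?_
  obtain ⟨δ, -, -, hl⟩ := hN n
  rw [coeff_toC]
  exact norm_coeff_le (hl n le_rfl).2

lemma derivative_mem_ent {f : PowerSeries ℚ} (h : f ∈ ent) : PowerSeries.derivative ℚ f ∈ ent := fun z => by
  have h2 := h (2 * (‖z‖ + 1) : ℝ)
  refine Summable.of_nonneg_of_le (fun n => norm_nonneg _) (fun n => ?_) ((summable_nat_add_iff 1).2 h2)
  rw [coeff_toC, PowerSeries.coeff_derivative, coeff_toC, norm_mul, norm_mul, Rat.cast_mul, norm_mul, norm_pow, norm_pow,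
    Complex.norm_real, Real.norm_of_nonneg (by positivity), mul_assoc]
  refine mul_le_mul_of_nonneg_left ?_ (norm_nonneg _)
  rw [mul_pow]
  have e : ‖(((n : ℚ) + 1 : ℚ) : ℂ)‖ = (n + 1 : ℕ) := by
    rw [← Nat.cast_succ, Rat.cast_natCast, Complex.norm_natCast]
  rw [e]
  have h3 : ((n + 1 : ℕ) : ℝ) ≤ 2 ^ (n + 1) := by exact_mod_cast (Nat.lt_two_pow_self (n := n + 1)).le
  have h4 : ‖z‖ ^ n ≤ (‖z‖ + 1) ^ (n + 1) :=
    (pow_le_pow_left₀ (norm_nonneg z) (by linarith) n).trans (pow_le_pow_right₀ (by linarith [norm_nonneg z]) n.le_succ)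
  exact mul_le_mul h3 h4 (by positivity) (by positivity)

lemma D_iterate_mem_mer {f : PowerSeries ℚ} (h : f ∈ ent) (i : ℕ) : D^[i] (f : Lau) ∈ mer := by
  rw [D_iterate_coe, mem_mer]
  refine isMer_coe ?_
  induction i with
  | zero => exact h
  | succ i ih =>
    rw [Function.iterate_succ_apply']
    exact derivative_mem_ent ih

lemma IsEQ.exists_lim {f : PowerSeries ℚ} (h : IsEQ f) : ∃ K, ∃ y, HasLim inT (f : Lau) y ∧
    y ∈ Submodule.span (PowerSeries ℚ) (Set.range fun i : Fin K => inT (D^[i] (f : Lau))) := by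
  obtain ⟨K, hK⟩ := h.exists_iterate_mem
  obtain ⟨c, hc⟩ := exists_hasLim_of_loc hK
  exact ⟨K, exists_hasLim c hc⟩

lemma IsEQ.hasLim_zero {q : PowerSeries ℚ} (h : IsEQ q) : HasLim inT ((pl X - 1) * (q : Lau)) 0 := by
  obtain ⟨K, hK⟩ := h.exists_iterate_mem
  obtain ⟨c, hc⟩ := exists_hasLim_of_loc hK
  refine EFun.hasLim_zero (H := Submodule.span (PowerSeries ℚ) (Set.range fun i : Fin K => inT (D^[i] (q : Lau)))) ?_ inT_X
    (Submodule.fg_span (Set.finite_range _)) fun k => ?_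
  · rw [D_pl, derivative_X, map_one]
  · rw [hc]
    exact sum_mem fun i _ => Submodule.smul_mem _ _ (Submodule.subset_span ⟨i, rfl⟩)

lemma D_ratCast (φ : ℚ →+* Lau) (c : ℚ) : D (φ c) = 0 := by
  rw [Subsingleton.elim φ (pl.comp C), RingHom.comp_apply, D_pl, derivative_C, map_zero]

lemma HasLim.normForm {ι : Type} [Fintype ι] [DecidableEq ι] {L : Type*} [Field L] [Algebra ℚ L] (θ : Module.Basis ι ℚ L)
    (φ : ℚ →+* Lau) {g : ι → Lau} {y : ι → Tp} (h : ∀ j, HasLim inT (g j) (y j)) :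
    HasLim inT (normForm θ φ g) (normForm θ (inT.comp φ) y) := by
  let Φ : ℚ →+* limSubring inT := (φ.prod (inT.comp φ)).codRestrict _ fun c => HasLim.of_D_eq_zero (D_ratCast φ c)
  let Y : ι → limSubring inT := fun j => ⟨(g j, y j), h j⟩
  have h1 := map_normForm θ Φ φ ((RingHom.fst Lau Tp).comp (limSubring inT).subtype) Y
  have h2 := map_normForm θ Φ (inT.comp φ) ((RingHom.snd Lau Tp).comp (limSubring inT).subtype) Y
  have h3 := (EFun.normForm θ Φ Y).2
  change HasLim inT _ _ at h3
  have h1' : ((EFun.normForm θ Φ Y : limSubring inT) : Lau × Tp).1 = EFun.normForm θ φ g := h1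
  have h2' : ((EFun.normForm θ Φ Y : limSubring inT) : Lau × Tp).2 = EFun.normForm θ (inT.comp φ) y := h2
  rwa [h1', h2'] at h3

theorem not_normForm_eq {ι : Type} [Fintype ι] [DecidableEq ι] {L : Type*} [Field L] [Algebra ℚ L] (θ : Module.Basis ι ℚ L)
    (φ : ℚ →+* Lau) {g : ι → PowerSeries ℚ} (hg : ∀ j, IsEQ (g j)) {q : PowerSeries ℚ} (hq : IsEQ q)
    (hN : normForm θ φ (fun j => (g j : Lau)) = (pl X - 1) * (q : Lau)) (l : ι → ℚ)
    (hl : ∑ j, φ (l j) * (g j : Lau) = -1) : False := by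
  choose K y hy hspan using fun j => (hg j).exists_lim
  have hz : normForm θ (inT.comp φ) y = 0 := by
    have := HasLim.normForm θ φ hy
    rw [hN] at this
    exact this.unique hq.hasLim_zero
  have h1 : ∑ j, inT (φ (l j)) * y j = -1 := by
    have h2 : HasLim inT (∑ j, φ (l j) * (g j : Lau)) (∑ j, inT (φ (l j)) * y j) :=
      HasLim.sum _ fun j _ => (HasLim.of_D_eq_zero (D_ratCast φ (l j))).mul (hy j)
    rw [hl] at h2
    have h3 := HasLim.of_D_eq_zero (ι := inT) D_neg_one
    rw [map_neg, map_one] at h3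
    exact h2.unique h3
  let s : Set Lau := Set.range fun p : Σ j, Fin (K j) => D^[p.2] (g p.1 : Lau)
  obtain ⟨t, hts, hspant, hlin⟩ := exists_linearIndependent Rat1 s
  have htf : t.Finite := (Set.finite_range _).subset hts
  let _ : Fintype t := htf.fintype
  have hmer : ∀ x : t, (x : Lau) ∈ mer := fun x => by
    obtain ⟨p, hp⟩ := hts x.2
    rw [← hp]
    exact D_iterate_mem_mer (hg p.1).mem_ent p.2
  choose b hb using fun j => exists_sum_of_mem_span (t := t) (w := fun i : Fin (K j) => D^[i] (g j : Lau))
    (fun i => by rw [hspant]; exact Submodule.subset_span ⟨⟨j, i⟩, rfl⟩) (hspan j)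
  let v : t → mer := fun x => ⟨x, hmer x⟩
  have hv : LinearIndependent Rat1 v := by
    refine LinearIndependent.of_comp mer.val.toLinearMap ?_
    exact hlin
  have hyv : y = fun j => ∑ x, b j x ⊗ₜ[Rat1] algebraMap mer Lau (v x) := funext hb
  rw [hyv] at hz
  have hb0 : ∀ j x, b j x = 0 := fun j x => by
    by_contra hne
    let φ' : ℚ →+* Pt := (algebraMap (PowerSeries ℚ) Pt).comp PowerSeries.C
    have h4 := normForm_coeff_eq_zero θ (AlgebraicClosure Lau) mer_relatively_closed hv b (inT.comp φ) φ' hz x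
    exact normForm_laurentSeries_ne_zero θ φ' (fun j => b j x) (fun h0 => hne (congrFun h0 j)) h4
  have hy0 : ∀ j, y j = 0 := fun j => by
    rw [hb j]
    exact Finset.sum_eq_zero fun x _ => by rw [hb0, TensorProduct.zero_tmul]
  have : (0 : Tp) = -1 := by
    rw [← h1]
    exact (Finset.sum_eq_zero fun j _ => by rw [hy0, mul_zero]).symm
  exact one_ne_zero (neg_eq_zero.1 this.symm)

end NormForms

lemma Geom.add {a b : ℕ → ℚ} (ha : Geom a) (hb : Geom b) : Geom (a + b) := by
  obtain ⟨A, hA, hNA⟩ := ha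
  obtain ⟨B, hB, hNB⟩ := hb
  have hAB : A ≤ 2 * A * B := by nlinarith
  have hBA : B ≤ 2 * A * B := by nlinarith
  have hAB2 : A * B ≤ 2 * A * B := by nlinarith
  refine ⟨2 * A * B, by linarith, fun N => ?_⟩
  obtain ⟨δ, hδ, hδA, hl⟩ := hNA N
  obtain ⟨ε, hε, hεB, hm⟩ := hNB N
  refine ⟨δ * ε, Nat.mul_pos hδ hε, ?_, fun l h => ⟨?_, ?_⟩⟩
  · rw [Nat.cast_mul]
    calc (δ * ε : ℝ) ≤ A ^ (N + 1) * B ^ (N + 1) := by gcongr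
      _ = (A * B) ^ (N + 1) := (mul_pow _ _ _).symm
      _ ≤ _ := by gcongr
  · obtain ⟨x, hx⟩ := (hl l h).1
    obtain ⟨y, hy⟩ := (hm l h).1
    refine ⟨ε * x + δ * y, ?_⟩
    push_cast
    rw [← hx, ← hy, Pi.add_apply]
    ring
  · have h1 := (hl l h).2
    have h2 := (hm l h).2
    rw [Pi.add_apply, Rat.cast_add]
    have hA1 : 1 ≤ A ^ (N + 1) := one_le_pow₀ hA
    have hB1 : 1 ≤ B ^ (N + 1) := one_le_pow₀ hB
    have h21 : (2 : ℝ) ≤ 2 ^ (N + 1) := by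
      rw [pow_succ]
      nlinarith [one_le_pow₀ (M₀ := ℝ) one_le_two (n := N)]
    calc _ ≤ A ^ (N + 1) + B ^ (N + 1) := (abs_add_le _ _).trans (add_le_add h1 h2)
      _ ≤ 2 * (A ^ (N + 1) * B ^ (N + 1)) := by nlinarith
      _ ≤ 2 ^ (N + 1) * (A ^ (N + 1) * B ^ (N + 1)) := by gcongr
      _ = _ := by rw [mul_pow, mul_pow]; ring

lemma factorial_mul_coeff_mul (f g : PowerSeries ℚ) (n : ℕ) :
    (n.factorial : ℚ) * PowerSeries.coeff n (f * g) = ∑ p ∈ Finset.HasAntidiagonal.antidiagonal n,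
      (n.choose p.1 : ℚ) * ((p.1.factorial : ℚ) * PowerSeries.coeff p.1 f) * ((p.2.factorial : ℚ) * PowerSeries.coeff p.2 g) := by
  rw [PowerSeries.coeff_mul, Finset.mul_sum]
  refine Finset.sum_congr rfl fun p hp => ?_
  obtain rfl := Finset.HasAntidiagonal.mem_antidiagonal.1 hp
  rw [← Nat.add_choose_mul_factorial_mul_factorial, Nat.choose_symm_add]
  push_cast
  ring

lemma Geom.mul {f g : PowerSeries ℚ} (hf : Geom fun n => (n.factorial : ℚ) * PowerSeries.coeff n f)
    (hg : Geom fun n => (n.factorial : ℚ) * PowerSeries.coeff n g) :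
    Geom fun n => (n.factorial : ℚ) * PowerSeries.coeff n (f * g) := by
  obtain ⟨A, hA, hNA⟩ := hf
  obtain ⟨B, hB, hNB⟩ := hg
  have hAB2 : A * B ≤ 2 * A * B := by nlinarith
  refine ⟨2 * A * B, by nlinarith, fun N => ?_⟩
  obtain ⟨δ, hδ, hδA, hl⟩ := hNA N
  obtain ⟨ε, hε, hεB, hm⟩ := hNB N
  refine ⟨δ * ε, Nat.mul_pos hδ hε, ?_, fun l h => ?_⟩
  · rw [Nat.cast_mul]
    calc (δ * ε : ℝ) ≤ A ^ (N + 1) * B ^ (N + 1) := by gcongr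
      _ = (A * B) ^ (N + 1) := (mul_pow _ _ _).symm
      _ ≤ _ := by gcongr
  have hp1 : ∀ p ∈ Finset.HasAntidiagonal.antidiagonal l, p.1 ≤ N ∧ p.2 ≤ N := fun p hp => by
    have := Finset.HasAntidiagonal.mem_antidiagonal.1 hp
    omega
  beta_reduce at hl hm
  refine ⟨?_, ?_⟩
  · choose! x hx using fun i hi => (hl i hi).1
    choose! y hy using fun i hi => (hm i hi).1
    refine ⟨∑ p ∈ Finset.HasAntidiagonal.antidiagonal l, (l.choose p.1 : ℤ) * x p.1 * y p.2, ?_⟩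
    beta_reduce
    rw [factorial_mul_coeff_mul, Finset.mul_sum]
    push_cast
    refine Finset.sum_congr rfl fun p hp => ?_
    rw [← hx _ (hp1 p hp).1, ← hy _ (hp1 p hp).2]
    ring
  · beta_reduce
    rw [factorial_mul_coeff_mul, Rat.cast_sum]
    calc _ ≤ ∑ p ∈ Finset.HasAntidiagonal.antidiagonal l, (l.choose p.1 : ℝ) * (A ^ (N + 1) * B ^ (N + 1)) := by
          refine (Finset.abs_sum_le_sum_abs _ _).trans (Finset.sum_le_sum fun p hp => ?_)
          rw [Rat.cast_mul, Rat.cast_mul, abs_mul, abs_mul, Rat.cast_natCast, Nat.abs_cast, mul_assoc]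
          have h1 := (hl _ (hp1 p hp).1).2
          have h2 := (hm _ (hp1 p hp).2).2
          refine mul_le_mul_of_nonneg_left ?_ (Nat.cast_nonneg _)
          exact mul_le_mul h1 h2 (abs_nonneg _) (by positivity)
      _ = 2 ^ l * (A ^ (N + 1) * B ^ (N + 1)) := by
          rw [← Finset.sum_mul, Finset.Nat.sum_antidiagonal_eq_sum_range_succ_mk]
          congr 1
          exact_mod_cast Nat.sum_range_choose l
      _ ≤ 2 ^ (N + 1) * (A ^ (N + 1) * B ^ (N + 1)) := by
          refine mul_le_mul_of_nonneg_right ?_ (by positivity)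
          exact pow_le_pow_right₀ one_le_two (by omega)
      _ = _ := by rw [mul_pow, mul_pow]; ring

lemma coe_C (c : ℚ) : ((PowerSeries.C c : PowerSeries ℚ) : Lau) = pl (C c) := by
  rw [pl_eq, Polynomial.coe_C]

lemma hol_pl (p : ℚ[X]) : Hol (pl p) := by
  rw [pl, IsScalarTower.algebraMap_apply ℚ[X] Rat1 Lau]
  exact hol_rat _

lemma isEQ_C (c : ℚ) : IsEQ (PowerSeries.C c) := by
  refine ⟨?_, 1 + c.den + |(c : ℝ)|, ?_, fun N => ⟨c.den, c.den_pos, ?_, fun l _ => ?_⟩⟩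
  · rw [coe_C]
    exact hol_pl _
  · have := abs_nonneg (c : ℝ)
    have : (0 : ℝ) ≤ c.den := Nat.cast_nonneg _
    linarith
  · refine le_trans ?_ (le_self_pow₀ ?_ (Nat.succ_ne_zero N)) <;>
    linarith [abs_nonneg (c : ℝ), Nat.cast_nonneg (α := ℝ) c.den]
  · beta_reduce
    rw [PowerSeries.coeff_C]
    split_ifs with h
    · subst h
      refine ⟨⟨c.num, by rw [Nat.factorial_zero, Nat.cast_one, one_mul, Rat.den_mul_eq_num]⟩, ?_⟩
      rw [Nat.factorial_zero, Nat.cast_one, one_mul]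
      refine le_trans ?_ (le_self_pow₀ ?_ (Nat.succ_ne_zero N)) <;>
      linarith [abs_nonneg (c : ℝ), Nat.cast_nonneg (α := ℝ) c.den]
    · refine ⟨⟨0, by simp⟩, ?_⟩
      rw [mul_zero, Rat.cast_zero, abs_zero]
      positivity

lemma IsEQ.add {f g : PowerSeries ℚ} (hf : IsEQ f) (hg : IsEQ g) : IsEQ (f + g) := by
  refine ⟨?_, ?_⟩
  · rw [PowerSeries.coe_add]
    exact hf.1.add hg.1
  · simp only [map_add, mul_add]
    exact hf.2.add hg.2

lemma IsEQ.mul {f g : PowerSeries ℚ} (hf : IsEQ f) (hg : IsEQ g) : IsEQ (f * g) := by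
  refine ⟨?_, hf.2.mul hg.2⟩
  rw [PowerSeries.coe_mul]
  exact hf.1.mul hg.1

/-- The ring of `E`-functions with rational coefficients. -/
def EQ : Subring (PowerSeries ℚ) where
  carrier := {f | IsEQ f}
  mul_mem' := IsEQ.mul
  add_mem' := IsEQ.add
  neg_mem' {f} hf := by
    have := (isEQ_C (-1)).mul hf
    rwa [map_neg, map_one, neg_one_mul] at this
  zero_mem' := by simpa using isEQ_C 0
  one_mem' := by simpa using isEQ_C 1

/-- Division of an `E`-function vanishing at `1`. -/
lemma IsEQ.exists_div {f : PowerSeries ℚ} (hf : IsEQ f) (h0 : ev 1 ⟨f, hf.mem_ent⟩ = 0) :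
    ∃ q, IsEQ q ∧ f = (PowerSeries.X - 1) * q := by
  let q : PowerSeries ℚ := PowerSeries.mk fun n => -∑ k ∈ Finset.range (n + 1), PowerSeries.coeff k f
  have hqf : f = (PowerSeries.X - 1) * q := by
    ext n
    rw [sub_mul, one_mul, map_sub]
    cases n with
    | zero => simp [q]
    | succ n =>
      rw [PowerSeries.coeff_succ_X_mul, PowerSeries.coeff_mk, PowerSeries.coeff_mk, Finset.sum_range_succ _ (n + 1)]
      ring
  refine ⟨q, ⟨?_, ?_⟩, hqf⟩
  · have hX : pl (X - 1) ≠ 0 := by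
      rw [map_ne_zero_iff _ pl_injective]
      exact X_sub_C_ne_zero (1 : ℚ)
    have e : (q : Lau) = algebraMap Rat1 Lau (algebraMap ℚ[X] _ 1 / algebraMap ℚ[X] _ (X - 1)) * (f : Lau) := by
      rw [algebraMap_div, map_one, hqf, PowerSeries.coe_mul]
      have : ((PowerSeries.X - 1 : PowerSeries ℚ) : Lau) = pl (X - 1) := by
        rw [pl_eq]
        simp
      rw [this]
      field_simp
    rw [e]
    exact (hol_rat _).mul hf.1
  · obtain ⟨A, hA, hN⟩ := hf.2
    set E : ℝ := ∑' m : ℕ, A ^ m / m.factorial with hE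
    have hE0 : 0 ≤ E := tsum_nonneg fun m => by positivity
    have hA2 : A ≤ A ^ 2 * (1 + E) := by
      have : A ≤ A ^ 2 := le_self_pow₀ hA two_ne_zero
      nlinarith
    refine ⟨A ^ 2 * (1 + E), hA.trans hA2, fun N => ?_⟩
    obtain ⟨δ, hδ, hδA, hl⟩ := hN N
    refine ⟨δ, hδ, hδA.trans (pow_le_pow_left₀ (by linarith) hA2 _), fun l h => ⟨?_, ?_⟩⟩
    · beta_reduce at hl
      choose! x hx using fun i hi => (hl i hi).1
      refine ⟨-∑ k ∈ Finset.range (l + 1), ((l.factorial / k.factorial : ℕ) : ℤ) * x k, ?_⟩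
      beta_reduce
      rw [PowerSeries.coeff_mk]
      rw [Int.cast_neg, Int.cast_sum, mul_neg, mul_neg, Finset.mul_sum, Finset.mul_sum, neg_inj]
      refine Finset.sum_congr rfl fun k hk => ?_
      have hkl : k ≤ l := by
        rw [Finset.mem_range] at hk
        omega
      rw [Int.cast_mul, Int.cast_natCast, ← hx k (hkl.trans h), Nat.cast_div (Nat.factorial_dvd_factorial hkl) (Nat.cast_ne_zero.2 k.factorial_ne_zero)]
      field_simp
    · have hb : ∀ k, ‖((PowerSeries.coeff k f : ℚ) : ℂ)‖ ≤ A ^ (k + 1) / k.factorial := fun k => by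
        obtain ⟨ε, -, -, hk⟩ := hN k
        exact norm_coeff_le (hk k le_rfl).2
      have hsum : Summable fun k => ((PowerSeries.coeff k f : ℚ) : ℂ) := by
        have := (hf.mem_ent 1).of_norm
        simpa only [one_pow, mul_one, coeff_toC] using this
      have hts : ∑' k, ((PowerSeries.coeff k f : ℚ) : ℂ) = 0 := by
        have : ev 1 ⟨f, hf.mem_ent⟩ = ∑' k, PowerSeries.coeff k (toC f) * 1 ^ k := rfl
        rw [h0] at this
        simpa only [one_pow, mul_one, coeff_toC, eq_comm] using this
      have hq : ((PowerSeries.coeff l q : ℚ) : ℂ) = ∑' k, ((PowerSeries.coeff (k + (l + 1)) f : ℚ) : ℂ) := by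
        rw [← hsum.sum_add_tsum_nat_add (l + 1)] at hts
        rw [PowerSeries.coeff_mk, Rat.cast_neg, Rat.cast_sum, ← add_eq_zero_iff_neg_eq.1 hts]
      have hE' : HasSum (fun m : ℕ => A ^ (l + 2) / l.factorial * (A ^ m / m.factorial)) (A ^ (l + 2) / l.factorial * E) :=
        (Real.summable_pow_div_factorial A).hasSum.mul_left _
      have hq2 : ‖((PowerSeries.coeff l q : ℚ) : ℂ)‖ ≤ A ^ (l + 2) / l.factorial * E := by
        rw [hq]
        refine tsum_of_norm_bounded hE' fun m => (hb _).trans ?_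
        rw [div_mul_div_comm, ← pow_add, show m + (l + 1) + 1 = l + 2 + m by omega]
        refine div_le_div_of_nonneg_left (by positivity) (by positivity) ?_
        have h1 : l.factorial * m.factorial ≤ (m + (l + 1)).factorial :=
          (Nat.le_of_dvd (Nat.factorial_pos _) (Nat.factorial_mul_factorial_dvd_factorial_add l m)).trans
            (Nat.factorial_le (by omega))
        exact_mod_cast h1
      rw [← Complex.ofReal_ratCast, Complex.norm_real, Real.norm_eq_abs] at hq2
      rw [Rat.cast_mul, Rat.cast_natCast, abs_mul, Nat.abs_cast]
      have hl0 : (0 : ℝ) < l.factorial := by positivity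
      calc _ ≤ (l.factorial : ℝ) * (A ^ (l + 2) / l.factorial * E) := mul_le_mul_of_nonneg_left hq2 hl0.le
        _ = A ^ (l + 2) * E := by field_simp
        _ ≤ A ^ (2 * (N + 1)) * (1 + E) ^ (N + 1) := by
          refine mul_le_mul (pow_le_pow_right₀ hA (by omega)) ?_ hE0 (by positivity)
          exact (by linarith : E ≤ 1 + E).trans (le_self_pow₀ (by linarith) (Nat.succ_ne_zero N))
        _ = _ := by rw [mul_pow, ← pow_mul]

section NumberField
variable {L : Type} [Field L] [NumberField L]

/-- Geometric growth of the conjugates and of the denominators. -/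
def GeomL (c : ℕ → L) : Prop := ∃ C : ℝ, 1 ≤ C ∧ ∀ N : ℕ, ∃ δ : ℕ, 1 ≤ δ ∧ (δ : ℝ) ≤ C ^ (N + 1) ∧ ∀ l ≤ N,
  IsIntegral ℤ ((δ : L) * c l) ∧ ∀ σ : L →+* ℂ, ‖σ (c l)‖ ≤ C ^ (N + 1)

lemma exists_dual_bound (f : Module.Dual ℚ L) : ∃ B : ℝ, 0 ≤ B ∧ ∀ x : L, ∀ R : ℝ,
    (∀ σ : L →+* ℂ, ‖σ x‖ ≤ R) → |((f x : ℚ) : ℝ)| ≤ B * R := by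
  obtain ⟨t, rfl⟩ := (LinearMap.BilinForm.toDual _ (traceForm_nondegenerate ℚ L)).surjective f
  refine ⟨∑ σ : L →ₐ[ℚ] ℂ, ‖σ t‖, Finset.sum_nonneg fun σ _ => norm_nonneg _, fun x R h => ?_⟩
  rw [LinearMap.BilinForm.toDual_def, Algebra.traceForm_apply]
  have e : ‖((Algebra.trace ℚ L (t * x) : ℚ) : ℂ)‖ = |((Algebra.trace ℚ L (t * x) : ℚ) : ℝ)| := by
    rw [← Complex.ofReal_ratCast, Complex.norm_real, Real.norm_eq_abs]
  rw [← e, ← eq_ratCast (algebraMap ℚ ℂ), trace_eq_sum_embeddings ℂ, Finset.sum_mul]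
  refine (norm_sum_le _ _).trans (Finset.sum_le_sum fun σ _ => ?_)
  rw [map_mul, norm_mul]
  exact mul_le_mul_of_nonneg_left (h σ.toRingHom) (norm_nonneg _)

lemma exists_int_repr {x : L} (hx : IsIntegral ℤ x) (j) : ∃ z : ℤ, (NumberField.integralBasis L).repr x j = z :=
  ⟨_, NumberField.integralBasis_repr_apply L ⟨x, hx⟩ j⟩

lemma GeomL.repr {c : ℕ → L} (h : GeomL c) (j) : Geom fun n => (NumberField.integralBasis L).repr (c n) j := by
  obtain ⟨C, hC, hN⟩ := h
  obtain ⟨B, hB, hBx⟩ := exists_dual_bound ((NumberField.integralBasis L).coord j)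
  have hCB : C ≤ (1 + B) * C := by nlinarith
  refine ⟨(1 + B) * C, hC.trans hCB, fun N => ?_⟩
  obtain ⟨δ, hδ, hδC, hl⟩ := hN N
  refine ⟨δ, hδ, hδC.trans (pow_le_pow_left₀ (by linarith) hCB _), fun l h => ⟨?_, ?_⟩⟩
  · obtain ⟨z, hz⟩ := exists_int_repr (hl l h).1 j
    refine ⟨z, ?_⟩
    rw [← hz, ← nsmul_eq_mul δ (c l), map_nsmul, Finsupp.smul_apply, nsmul_eq_mul]
  · refine (hBx (c l) _ (hl l h).2).trans ?_
    rw [mul_pow]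
    refine mul_le_mul_of_nonneg_right ?_ (by positivity)
    exact (by linarith : B ≤ 1 + B).trans (le_self_pow₀ (by linarith) (Nat.succ_ne_zero N))

lemma exists_nat_mul_isIntegral (α : L) : ∃ d : ℕ, 1 ≤ d ∧ IsIntegral ℤ ((d : L) * α) := by
  obtain ⟨d, hd, hdα⟩ := IsAlgebraic.exists_integral_multiple
    ((IsFractionRing.isAlgebraic_iff ℤ ℚ L).2 (IsAlgebraic.of_finite ℚ α))
  refine ⟨d.natAbs, Int.natAbs_pos.2 hd, ?_⟩
  rw [← Int.cast_natCast (R := L), Int.natCast_natAbs, ← zsmul_eq_mul]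
  rcases abs_choice d with h | h <;> rw [h]
  · exact hdα
  · rw [neg_smul]
    exact hdα.neg

lemma GeomL.mul_pow {c : ℕ → L} (h : GeomL c) (α : L) : GeomL fun n => c n * α ^ n := by
  obtain ⟨C, hC, hN⟩ := h
  obtain ⟨d, hd, hdα⟩ := exists_nat_mul_isIntegral α
  set A : ℝ := 1 + NumberField.house α with hA
  have hA1 : 1 ≤ A := by linarith [NumberField.house_nonneg α]
  have hd1 : (1 : ℝ) ≤ d := by exact_mod_cast hd
  refine ⟨C * A * d, one_le_mul_of_one_le_of_one_le (one_le_mul_of_one_le_of_one_le hC hA1) hd1, fun N => ?_⟩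
  obtain ⟨δ, hδ, hδC, hl⟩ := hN N
  have hA' : 1 ≤ A ^ (N + 1) := one_le_pow₀ hA1
  have hd' : 1 ≤ (d : ℝ) ^ (N + 1) := one_le_pow₀ hd1
  have hC' : 1 ≤ C ^ (N + 1) := one_le_pow₀ hC
  refine ⟨δ * d ^ N, Nat.mul_pos hδ (pow_pos hd N), ?_, fun l h => ⟨?_, fun σ => ?_⟩⟩
  · rw [_root_.mul_pow, _root_.mul_pow]
    push_cast
    refine mul_le_mul (hδC.trans (le_mul_of_one_le_right (by positivity) hA')) (pow_le_pow_right₀ hd1 N.le_succ)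
      (by positivity) (by positivity)
  · have e : ((δ * d ^ N : ℕ) : L) * (c l * α ^ l) = (δ * c l) * ((d * α) ^ l * ((d ^ (N - l) : ℕ) : L)) := by
      obtain ⟨k, rfl⟩ := Nat.exists_eq_add_of_le h
      rw [Nat.add_sub_cancel_left]
      push_cast
      ring
    rw [e]
    exact (hl l h).1.mul ((hdα.pow l).mul (isIntegral_natCast _))
  · rw [map_mul, map_pow, norm_mul, norm_pow, _root_.mul_pow, _root_.mul_pow]
    have h1 : ‖σ α‖ ^ l ≤ A ^ (N + 1) := by
      refine (pow_le_pow_left₀ (norm_nonneg _) ?_ l).trans (pow_le_pow_right₀ hA1 (by omega))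
      linarith [NumberField.norm_embedding_le_house α σ]
    refine (mul_le_mul ((hl l h).2 σ) h1 (by positivity) (by positivity)).trans ?_
    exact le_mul_of_one_le_right (by positivity) hd'

end NumberField

section Coordinates
variable {ι : Type} {L : Type} [Field L] [Algebra ℚ L] (θ : Module.Basis ι ℚ L)

/-- Coordinates of power series. -/
def crd (j : ι) (F : PowerSeries L) : PowerSeries ℚ := PowerSeries.mk fun n => θ.repr (PowerSeries.coeff n F) j

lemma coeff_crd (j : ι) (F : PowerSeries L) (n : ℕ) :
    PowerSeries.coeff n (crd θ j F) = θ.repr (PowerSeries.coeff n F) j := PowerSeries.coeff_mk _ _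

lemma crd_derivative (F : PowerSeries L) (j : ι) :
    crd θ j (PowerSeries.derivative L F) = PowerSeries.derivative ℚ (crd θ j F) := by
  ext n
  rw [coeff_crd, PowerSeries.coeff_derivative, PowerSeries.coeff_derivative, coeff_crd]
  have : PowerSeries.coeff (n + 1) F * ((n : L) + 1) = (n + 1) • PowerSeries.coeff (n + 1) F := by
    rw [nsmul_eq_mul]
    push_cast
    ring
  rw [this, map_nsmul, Finsupp.smul_apply, nsmul_eq_mul]
  push_cast
  ring

lemma crd_derivative_iterate (F : PowerSeries L) (j : ι) (i : ℕ) :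
    crd θ j ((PowerSeries.derivative L)^[i] F) = (PowerSeries.derivative ℚ)^[i] (crd θ j F) := by
  induction i with
  | zero => rfl
  | succ i ih => rw [Function.iterate_succ_apply', Function.iterate_succ_apply', crd_derivative, ih]

lemma exists_coe_eq_crd (P : L[X]) (j : ι) : ∃ p : ℚ[X], (p : PowerSeries ℚ) = crd θ j (P : PowerSeries L) := by
  refine ⟨PowerSeries.trunc (P.natDegree + 1) (crd θ j (P : PowerSeries L)), ?_⟩
  ext n
  rw [Polynomial.coeff_coe, PowerSeries.coeff_trunc]
  split_ifs with h
  · rfl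
  · rw [coeff_crd, Polynomial.coeff_coe, coeff_eq_zero_of_natDegree_lt (by omega)]
    simp

lemma crd_sum {κ : Type*} (s : Finset κ) (F : κ → PowerSeries L) (j : ι) :
    crd θ j (∑ i ∈ s, F i) = ∑ i ∈ s, crd θ j (F i) := by
  ext n
  simp [coeff_crd, Finsupp.finsetSum_apply]

lemma eq_zero_of_crd {F : PowerSeries L} (h : ∀ j, crd θ j F = 0) : F = 0 := by
  ext n
  refine θ.repr.map_eq_zero_iff.1 (Finsupp.ext fun j => ?_)
  rw [← coeff_crd, h]
  rfl

variable [Fintype ι]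

lemma mulVec_map_mem {V : Submodule Rat1 Lau} (A : Matrix ι ι Rat1) {w : ι → Lau} (hw : ∀ j, w j ∈ V) (r : ι) :
    ((A.map (algebraMap Rat1 Lau)).mulVec w) r ∈ V := by
  refine sum_mem fun j _ => ?_
  change algebraMap Rat1 Lau (A r j) * w j ∈ V
  rw [← Algebra.smul_def]
  exact V.smul_mem _ (hw j)

variable [DecidableEq ι]

lemma repr_mul (x y : L) (p : ι) :
    θ.repr (x * y) p = ∑ j, (∑ k, θ.repr x k * Algebra.leftMulMatrix θ (θ k) p j) * θ.repr y j := by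
  have h1 : Algebra.leftMulMatrix θ x = ∑ k, θ.repr x k • Algebra.leftMulMatrix θ (θ k) := by
    conv_lhs => rw [← θ.sum_repr x, map_sum]
    exact Finset.sum_congr rfl fun k _ => map_smul _ _ _
  rw [← Algebra.leftMulMatrix_mulVec_repr, h1]
  simp only [Matrix.mulVec, dotProduct, Matrix.sum_apply, Matrix.smul_apply, smul_eq_mul]

lemma crd_mul (F G : PowerSeries L) (p : ι) :
    crd θ p (F * G) = ∑ j, mulMat θ PowerSeries.C (fun k => crd θ k F) p j * crd θ j G := by
  ext n
  rw [coeff_crd, PowerSeries.coeff_mul, map_sum, Finsupp.finsetSum_apply, map_sum]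
  have hM : ∀ a j, PowerSeries.coeff a (mulMat θ PowerSeries.C (fun k => crd θ k F) p j) =
      ∑ k, θ.repr (PowerSeries.coeff a F) k * Algebra.leftMulMatrix θ (θ k) p j := fun a j => by
    simp only [mulMat, Matrix.of_apply, map_sum, PowerSeries.coeff_mul_C, coeff_crd]
  simp only [PowerSeries.coeff_mul, repr_mul, hM, coeff_crd]
  exact Finset.sum_comm

lemma map_mulMat {R S : Type*} [CommRing R] [CommRing S] (φ : ℚ →+* R) (φ' : ℚ →+* S) (ψ : R →+* S)
    (y : ι → R) (p q : ι) : ψ (mulMat θ φ y p q) = mulMat θ φ' (fun j => ψ (y j)) p q := by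
  simp only [mulMat, Matrix.of_apply, map_sum, map_mul]
  refine Finset.sum_congr rfl fun j _ => ?_
  rw [← RingHom.comp_apply ψ φ, Subsingleton.elim (ψ.comp φ) φ']

lemma hol_crd_of_leading {F : PowerSeries L} {m : ℕ} {P : ℕ → L[X]} (hP : P m ≠ 0)
    (h : ∑ i ∈ Finset.range (m + 1), (P i : PowerSeries L) * (PowerSeries.derivative L)^[i] F = 0) (j : ι) :
    Hol (crd θ j F : Lau) := by
  choose p hp using fun i k => exists_coe_eq_crd θ (P i) k
  let φ : ℚ →+* Rat1 := (algebraMap ℚ[X] Rat1).comp C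
  let M : ℕ → Matrix ι ι Rat1 := fun i => mulMat θ φ fun k => algebraMap ℚ[X] Rat1 (p i k)
  let w : ℕ → ι → Lau := fun i j => D^[i] (crd θ j F : Lau)
  have hMc : ∀ i r j, algebraMap Rat1 Lau (M i r j) =
      ((mulMat θ PowerSeries.C (fun k => crd θ k (P i : PowerSeries L)) r j : PowerSeries ℚ) : Lau) := fun i r j => by
    rw [map_mulMat θ φ (pl.comp C), map_mulMat θ PowerSeries.C (pl.comp C) (HahnSeries.ofPowerSeries ℤ ℚ)]
    simp only [← IsScalarTower.algebraMap_apply, ← hp]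
    rfl
  have hrel : ∑ i ∈ Finset.range (m + 1), ((M i).map (algebraMap Rat1 Lau)).mulVec (w i) = 0 := by
    ext1 r
    have h1 := congrArg (fun G => ((crd θ r G : PowerSeries ℚ) : Lau)) h
    simp only [crd_sum, crd_mul, map_sum, map_mul, crd_derivative_iterate, ← D_iterate_coe] at h1
    rw [Finset.sum_apply]
    simp only [Matrix.mulVec, dotProduct, Matrix.map_apply, hMc]
    refine h1.trans ?_
    have : crd θ r (0 : PowerSeries L) = 0 := by
      ext n
      simp [coeff_crd]
    rw [this, map_zero]
    rfl
  have hdet : IsUnit (M m).det := by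
    rw [isUnit_iff_ne_zero, ← map_ne_zero_iff _ (algebraMap Rat1 Lau).injective]
    have h1 := map_normForm θ φ (pl.comp C) (algebraMap Rat1 Lau) fun k => algebraMap ℚ[X] Rat1 (p m k)
    refine fun h0 => normForm_laurentSeries_ne_zero θ (pl.comp C) _ ?_ (h1.symm.trans h0)
    intro h2
    refine hP (Polynomial.coe_injective L ?_)
    rw [Polynomial.coe_zero]
    refine eq_zero_of_crd θ fun k => ?_
    have h3 := congrFun h2 k
    simp only [← IsScalarTower.algebraMap_apply] at h3
    rw [← hp, (map_eq_zero_iff pl pl_injective).1 h3, Polynomial.coe_zero]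
  let V : Submodule Rat1 Lau := Submodule.span Rat1 (Set.range fun x : Fin m × ι => w x.1 x.2)
  have hwV : ∀ i j, i < m → w i j ∈ V := fun i j hi => Submodule.subset_span ⟨(⟨i, hi⟩, j), rfl⟩
  have hwm : ∀ j, w m j ∈ V := fun j => by
    have h1 : w m = -((M m)⁻¹.map (algebraMap Rat1 Lau)).mulVec
        (∑ i ∈ Finset.range m, ((M i).map (algebraMap Rat1 Lau)).mulVec (w i)) := by
      rw [Finset.sum_range_succ, add_comm] at hrel
      rw [← Matrix.mulVec_neg, ← eq_neg_of_add_eq_zero_left hrel, Matrix.mulVec_mulVec, ← Matrix.map_mul,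
        Matrix.nonsing_inv_mul _ hdet, Matrix.map_one _ (map_zero _) (map_one _), Matrix.one_mulVec]
    rw [h1, Pi.neg_apply]
    refine neg_mem (mulVec_map_mem _ (fun k => ?_) j)
    rw [Finset.sum_apply]
    exact sum_mem fun i hi => mulVec_map_mem _ (fun k => hwV i k (Finset.mem_range.1 hi)) _
  refine ⟨V, Module.Finite.span_of_finite _ (Set.finite_range _), fun v hv => ?_, ?_⟩
  · induction hv using Submodule.span_induction with
    | mem x hx =>
      obtain ⟨⟨i, k⟩, rfl⟩ := hx
      have e : D (w i k) = w (i + 1) k := (Function.iterate_succ_apply' D i _).symm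
      rw [e]
      rcases (Nat.succ_le_of_lt i.2).lt_or_eq with hlt | heq
      · exact hwV _ _ hlt
      · have := hwm k
        rwa [← heq] at this
    | zero => rw [map_zero]; exact zero_mem _
    | add x y hx hy ihx ihy => rw [map_add]; exact add_mem ihx ihy
    | smul c x hx ih =>
      rw [D_smul]
      exact add_mem (V.smul_mem _ hx) (V.smul_mem _ ih)
  · change w 0 j ∈ V
    rcases Nat.eq_zero_or_pos m with rfl | hm
    · exact hwm j
    · exact hwV 0 j hm

lemma hol_crd {F : PowerSeries L} {m : ℕ} {P : ℕ → L[X]} (hP : ∃ i, i ≤ m ∧ P i ≠ 0)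
    (h : ∑ i ∈ Finset.range (m + 1), (P i : PowerSeries L) * (PowerSeries.derivative L)^[i] F = 0) (j : ι) :
    Hol (crd θ j F : Lau) := by
  induction m with
  | zero =>
    obtain ⟨i, hi, hPi⟩ := hP
    obtain rfl := Nat.le_zero.1 hi
    exact hol_crd_of_leading θ hPi h j
  | succ m ih =>
    by_cases h0 : P (m + 1) = 0
    · obtain ⟨i, hi, hPi⟩ := hP
      refine ih ⟨i, Nat.le_of_lt_succ (lt_of_le_of_ne hi fun e => hPi (e ▸ h0)), hPi⟩ ?_
      rwa [Finset.sum_range_succ, h0, Polynomial.coe_zero, zero_mul, add_zero] at h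
    · exact hol_crd_of_leading θ h0 h j

end Coordinates

section Value
variable {L : Type} [Field L]

lemma rescale_coe (α : L) (P : L[X]) :
    PowerSeries.rescale α (P : PowerSeries L) = ((P.comp (C α * X) : L[X]) : PowerSeries L) := by
  ext n
  rw [PowerSeries.coeff_rescale, Polynomial.coeff_coe, Polynomial.coeff_coe, comp_C_mul_X_coeff, mul_comm]

lemma rescale_derivative_iterate {α : L} (hα : α ≠ 0) (F : PowerSeries L) (i : ℕ) :
    PowerSeries.rescale α ((PowerSeries.derivative L)^[i] F) =
      α⁻¹ ^ i • (PowerSeries.derivative L)^[i] (PowerSeries.rescale α F) := by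
  have h1 : ∀ G : PowerSeries L, PowerSeries.rescale α (PowerSeries.derivative L G) =
      α⁻¹ • PowerSeries.derivative L (PowerSeries.rescale α G) := fun G => by
    ext n
    rw [PowerSeries.coeff_rescale, PowerSeries.coeff_derivative, PowerSeries.coeff_smul, PowerSeries.coeff_derivative,
      PowerSeries.coeff_rescale, pow_succ, smul_eq_mul]
    field_simp
  induction i with
  | zero => simp
  | succ i ih =>
    rw [Function.iterate_succ_apply', h1, ih, Derivation.map_smul, smul_smul, ← pow_succ', Function.iterate_succ_apply']

lemma exists_rescaled_equation {α : L} (hα : α ≠ 0) {F : PowerSeries L} {m : ℕ} {P : ℕ → L[X]} (hP : ∃ i, i ≤ m ∧ P i ≠ 0)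
    (h : ∑ i ∈ Finset.range (m + 1), (P i : PowerSeries L) * (PowerSeries.derivative L)^[i] F = 0) :
    ∃ Q : ℕ → L[X], (∃ i, i ≤ m ∧ Q i ≠ 0) ∧ ∑ i ∈ Finset.range (m + 1), (Q i : PowerSeries L) *
      (PowerSeries.derivative L)^[i] (PowerSeries.rescale α F) = 0 := by
  refine ⟨fun i => C (α⁻¹ ^ i) * (P i).comp (C α * X), ?_, ?_⟩
  · obtain ⟨i, hi, hPi⟩ := hP
    refine ⟨i, hi, mul_ne_zero (C_ne_zero.2 (pow_ne_zero _ (inv_ne_zero hα))) fun h0 => hPi ?_⟩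
    ext n
    have := congrArg (fun p : L[X] => p.coeff n) h0
    simp only [comp_C_mul_X_coeff, coeff_zero, mul_eq_zero] at this
    rw [coeff_zero]
    exact this.resolve_right (pow_ne_zero _ hα)
  · have h1 := congrArg (PowerSeries.rescale α) h
    rw [map_sum, map_zero] at h1
    rw [← h1]
    refine Finset.sum_congr rfl fun i _ => ?_
    rw [map_mul, rescale_coe, rescale_derivative_iterate hα, Polynomial.coe_mul, Polynomial.coe_C, mul_smul_comm,
      PowerSeries.smul_eq_C_mul, mul_assoc]

variable [NumberField L]

/-- The exponential generating series of `c`. -/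
def exL (c : ℕ → L) : PowerSeries L := PowerSeries.mk fun n => c n / n.factorial

lemma factorial_mul_coeff_crd {ι : Type} (θ : Module.Basis ι ℚ L) (c : ℕ → L) (j : ι) (n : ℕ) :
    (n.factorial : ℚ) * PowerSeries.coeff n (crd θ j (exL c)) = θ.repr (c n) j := by
  rw [coeff_crd, exL, PowerSeries.coeff_mk, ← nsmul_eq_mul, ← Finsupp.smul_apply, ← map_nsmul, nsmul_eq_mul,
    mul_div_cancel₀ _ (Nat.cast_ne_zero.2 n.factorial_ne_zero)]

lemma isEQ_crd {c : ℕ → L} (hc : GeomL c) {m : ℕ} {P : ℕ → L[X]} (hP : ∃ i, i ≤ m ∧ P i ≠ 0)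
    (h : ∑ i ∈ Finset.range (m + 1), (P i : PowerSeries L) * (PowerSeries.derivative L)^[i] (exL c) = 0) (j) :
    IsEQ (crd (NumberField.integralBasis L) j (exL c)) := by
  classical
  refine ⟨hol_crd _ hP h j, ?_⟩
  simp only [factorial_mul_coeff_crd]
  exact hc.repr j

lemma mem_of_hasSum (σ : L →+* ℂ) (W : Submodule ℚ L) {c : ℕ → L} (hcW : ∀ n, c n ∈ W) (hc : GeomL c)
    {m : ℕ} {P : ℕ → L[X]} (hP : ∃ i, i ≤ m ∧ P i ≠ 0)
    (h : ∑ i ∈ Finset.range (m + 1), (P i : PowerSeries L) * (PowerSeries.derivative L)^[i] (exL c) = 0)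
    {ξ : L} (hξ : ∑' n, σ (c n / n.factorial) = σ ξ) : ξ ∈ W := by
  classical
  by_contra hW
  let θ := NumberField.integralBasis L
  let f := fun j => crd θ j (exL c)
  have hf : ∀ j, IsEQ (f j) := isEQ_crd hc hP h
  let g := fun j => f j - PowerSeries.C (θ.repr ξ j)
  have hg : ∀ j, g j ∈ EQ := fun j => sub_mem (S := Subring (PowerSeries ℚ)) (hf j) (isEQ_C _)
  obtain ⟨l, hl⟩ : ∃ l : Module.Dual ℚ L, l ξ = 1 ∧ ∀ x ∈ W, l x = 0 := by
    obtain ⟨l, hlξ, hlW⟩ := Submodule.exists_le_ker_of_notMem hW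
    refine ⟨(l ξ)⁻¹ • l, ?_, fun x hx => ?_⟩
    · rw [LinearMap.smul_apply, smul_eq_mul, inv_mul_cancel₀ hlξ]
    · rw [LinearMap.smul_apply, LinearMap.mem_ker.1 (hlW hx), smul_zero]
  have hlr : ∀ x, ∑ j, l (θ j) * θ.repr x j = l x := fun x => by
    conv_rhs => rw [← θ.sum_repr x, map_sum]
    exact Finset.sum_congr rfl fun j _ => by rw [map_smul, smul_eq_mul, mul_comm]
  have hlg : ∑ j, PowerSeries.C (l (θ j)) * g j = -1 := by
    ext n
    simp only [g, f, mul_sub, Finset.sum_sub_distrib, ← map_mul, ← map_sum, map_sub, hlr, hl.1]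
    have h0 : l (PowerSeries.coeff n (exL c)) = 0 := by
      refine hl.2 _ ?_
      have : PowerSeries.coeff n (exL c) = (n.factorial : ℚ)⁻¹ • c n := by
        rw [exL, PowerSeries.coeff_mk, Algebra.smul_def, map_inv₀, map_natCast, div_eq_inv_mul]
      rw [this]
      exact W.smul_mem _ (hcW n)
    rw [map_sum]
    simp only [PowerSeries.coeff_C_mul, coeff_crd, hlr, h0]
    simp
  let N : PowerSeries ℚ := normForm θ PowerSeries.C g
  let ΦE : ℚ →+* EQ := PowerSeries.C.codRestrict EQ isEQ_C
  have hNE : IsEQ N := by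
    have h1 := map_normForm θ ΦE PowerSeries.C EQ.subtype fun j => ⟨g j, hg j⟩
    have h2 : (normForm θ ΦE fun j => ⟨g j, hg j⟩ : EQ).1 = N := h1
    rw [← h2]
    exact (normForm θ ΦE fun j => ⟨g j, hg j⟩ : EQ).2
  have hEent : EQ ≤ ent := fun x hx => IsEQ.mem_ent hx
  let ψ : EQ →+* ℂ := (ev 1).comp (Subring.inclusion hEent)
  have hψ : ∀ x : EQ, ψ x = ∑' n, ((PowerSeries.coeff n (x : PowerSeries ℚ) : ℚ) : ℂ) := fun x => by
    have : ψ x = ∑' k, PowerSeries.coeff k (toC x) * 1 ^ k := rfl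
    simpa only [one_pow, mul_one, coeff_toC] using this
  have hψs : ∀ x : EQ, HasSum (fun n => ((PowerSeries.coeff n (x : PowerSeries ℚ) : ℚ) : ℂ)) (ψ x) := fun x => by
    rw [hψ]
    refine Summable.hasSum ?_
    have := (hEent x.2 1).of_norm
    simpa only [one_pow, mul_one, coeff_toC] using this
  have hσ : ∀ x : L, ∑ j, ((θ.repr x j : ℚ) : ℂ) * σ (θ j) = σ x := fun x => by
    conv_rhs => rw [← θ.sum_repr x, map_sum]
    exact Finset.sum_congr rfl fun j _ => by rw [Algebra.smul_def, map_mul, eq_ratCast, map_ratCast]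
  have hψf : ∑ j, ψ ⟨f j, hf j⟩ * σ (θ j) = σ ξ := by
    rw [← hξ]
    refine (HasSum.tsum_eq ?_).symm
    have := hasSum_sum (s := Finset.univ) fun j _ => (hψs ⟨f j, hf j⟩).mul_right (σ (θ j))
    simpa only [f, coeff_crd, hσ, exL, PowerSeries.coeff_mk] using this
  have hψg : ∀ j, ψ ⟨g j, hg j⟩ = ψ ⟨f j, hf j⟩ - ((θ.repr ξ j : ℚ) : ℂ) := fun j => by
    have h1 : (⟨g j, hg j⟩ : EQ) = ⟨f j, hf j⟩ - ΦE (θ.repr ξ j) := rfl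
    rw [h1, map_sub, ← RingHom.comp_apply ψ ΦE, eq_ratCast]
  have hN0 : ev 1 ⟨N, hNE.mem_ent⟩ = 0 := by
    have h1 := map_normForm θ ΦE (algebraMap ℚ ℂ) ψ fun j => ⟨g j, hg j⟩
    have h2 : normForm θ (algebraMap ℚ ℂ) (fun j => ψ ⟨g j, hg j⟩) = 0 := by
      refine normForm_eq_zero θ _ _ σ ?_
      simp only [hψg, sub_mul, Finset.sum_sub_distrib, hψf, hσ, sub_self]
    have h3 : (normForm θ ΦE fun j => ⟨g j, hg j⟩ : EQ) = ⟨N, hNE⟩ :=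
      Subtype.ext (map_normForm θ ΦE PowerSeries.C EQ.subtype fun j => ⟨g j, hg j⟩)
    rw [h2, h3] at h1
    exact h1
  obtain ⟨q, hq, hNq⟩ := hNE.exists_div hN0
  let φ : ℚ →+* Lau := (HahnSeries.ofPowerSeries ℤ ℚ).comp PowerSeries.C
  refine not_normForm_eq θ φ hg hq ?_ (fun j => l (θ j)) ?_
  · rw [← map_normForm θ PowerSeries.C φ (HahnSeries.ofPowerSeries ℤ ℚ) g]
    change ((N : PowerSeries ℚ) : Lau) = _
    rw [hNq, map_mul]
    congr 1
    rw [map_sub, map_one, pl_eq, Polynomial.coe_X]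
  · have := congrArg (HahnSeries.ofPowerSeries ℤ ℚ) hlg
    rwa [map_neg, map_one, map_sum, Finset.sum_congr rfl fun j _ => map_mul (HahnSeries.ofPowerSeries ℤ ℚ) _ _] at this

end Value

lemma exists_ringHom_extension {L A : Type} [Field L] [CharZero L] [CommRing A] [IsDomain A] [Algebra ℚ A]
    [Algebra.IsAlgebraic ℚ A] (i : L →+* A) (σ : L →+* ℂ) : ∃ τ : A →+* ℂ, ∀ x, τ (i x) = σ x := by
  let _ : Algebra L A := i.toAlgebra
  let _ : Algebra L ℂ := σ.toAlgebra
  have : IsScalarTower ℚ L A := IsScalarTower.of_algebraMap_eq' (Subsingleton.elim _ _)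
  have : Algebra.IsAlgebraic L A := Algebra.IsAlgebraic.tower_top (K := ℚ) L
  have : FaithfulSMul L A := (faithfulSMul_iff_algebraMap_injective L A).2 i.injective
  let τ : A →ₐ[L] ℂ := IsAlgClosed.lift
  exact ⟨τ, fun x => τ.commutes x⟩

section Assembly
variable (L : IntermediateField ℚ ℂ)

lemma geomL_of_isE [NumberField L] {c : ℕ → L} {a : ℕ → ℂ} (hca : ∀ n, (c n : ℂ) = a n) (hE : IsE a) :
    GeomL c := by
  obtain ⟨-, -, C, hC, d, hd⟩ := hE
  obtain ⟨d₀, hd₀, hint₀⟩ := exists_nat_mul_isIntegral (c 0)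
  have hh : 0 ≤ NumberField.house (c 0) := NumberField.house_nonneg _
  set B : ℝ := d₀ + NumberField.house (c 0) with hB
  have hd₀' : (1 : ℝ) ≤ d₀ := by exact_mod_cast hd₀
  have hB1 : 1 ≤ B := by linarith
  have hpow : ∀ l N : ℕ, l ≤ N → C ^ l ≤ (1 + C) ^ (N + 1) := fun l N hl =>
    (pow_le_pow_left₀ hC.le (by linarith) l).trans (pow_le_pow_right₀ (by linarith) (by omega))
  have hBpow : ∀ N : ℕ, B ≤ B ^ (N + 1) := fun N => le_self_pow₀ hB1 (by omega)
  refine ⟨(1 + C) * B, by nlinarith, fun N => ?_⟩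
  have hdesc : ∀ x : L, IsIntegral ℤ (x : ℂ) → IsIntegral ℤ x := fun x hx =>
    (isIntegral_algebraMap_iff (algebraMap L ℂ).injective).1 hx
  refine ⟨d₀ * (if N = 0 then 1 else d N), ?_, ?_, fun l hl => ⟨?_, fun σ => ?_⟩⟩
  · split_ifs with h
    · omega
    · exact Nat.mul_pos hd₀ (hd N (by omega)).1
  · rw [mul_pow, mul_comm ((1 + C) ^ (N + 1))]
    push_cast
    refine mul_le_mul (le_trans (by linarith) (hBpow N)) ?_ (by positivity) (by positivity)
    split_ifs with h
    · exact one_le_pow₀ (by linarith)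
    · exact (hd N (by omega)).2.1.trans (hpow N N le_rfl)
  · push_cast
    rcases Nat.eq_zero_or_pos l with rfl | hl0
    · rw [mul_comm (d₀ : L), mul_assoc]
      refine IsIntegral.mul ?_ hint₀
      split_ifs
      · exact isIntegral_one
      · exact isIntegral_natCast _
    · rw [if_neg (by omega), mul_assoc]
      refine IsIntegral.mul (isIntegral_natCast _) (hdesc _ ?_)
      have := (hd N (by omega)).2.2.2 l hl0 hl
      push_cast
      rwa [hca]
  · rw [mul_pow]
    rcases Nat.eq_zero_or_pos l with rfl | hl0
    · calc ‖σ (c 0)‖ ≤ NumberField.house (c 0) := NumberField.norm_embedding_le_house _ _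
        _ ≤ B ^ (N + 1) := le_trans (by linarith) (hBpow N)
        _ ≤ _ := le_mul_of_one_le_left (by positivity) (one_le_pow₀ (by linarith))
    · have hmem : ∀ x : L, (x : ℂ) ∈ integralClosure ℚ ℂ := fun x =>
        (Algebra.IsIntegral.isIntegral (R := ℚ) x).map L.val
      obtain ⟨τ, hτ⟩ := exists_ringHom_extension
        ((algebraMap L ℂ).codRestrict (integralClosure ℚ ℂ) hmem) σ
      have h1 := (hd l hl0).2.2.1 τ (hca l ▸ hmem (c l))
      have h2 : τ ⟨a l, hca l ▸ hmem (c l)⟩ = σ (c l) := by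
        rw [← hτ]
        exact congrArg τ (Subtype.ext (hca l).symm)
      rw [h2] at h1
      exact (h1.trans (hpow l N hl)).trans (le_mul_of_one_le_right (by positivity) (one_le_pow₀ hB1))

lemma exists_lifted_equation {c : ℕ → L} {a : ℕ → ℂ} (hca : ∀ n, (c n : ℂ) = a n) {m : ℕ} {p : ℕ → ℂ[X]}
    (hp : ∃ i, i ≤ m ∧ p i ≠ 0) (hL : ∀ i, i ≤ m → ∀ k, (p i).coeff k ∈ L)
    (h : ∑ i ∈ Finset.range (m + 1), polyPS (p i) * psD^[i] (ePS a) = 0) :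
    ∃ P : ℕ → L[X], (∃ i, i ≤ m ∧ P i ≠ 0) ∧
      ∑ i ∈ Finset.range (m + 1), (P i : PowerSeries L) * (PowerSeries.derivative L)^[i] (exL c) = 0 := by
  have hex : ∀ i, ∃ q : L[X], i ≤ m → q.map (algebraMap L ℂ) = p i := fun i => by
    by_cases hi : i ≤ m
    · obtain ⟨q, hq⟩ := (mem_lifts _).1 ((lifts_iff_coeff_lifts (f := algebraMap L ℂ) (p i)).2
        fun k => ⟨⟨_, hL i hi k⟩, rfl⟩)
      exact ⟨q, fun _ => hq⟩
    · exact ⟨0, fun h => absurd h hi⟩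
  choose P hP using hex
  refine ⟨P, ?_, ?_⟩
  · obtain ⟨i, hi, hpi⟩ := hp
    exact ⟨i, hi, fun h0 => hpi (by rw [← hP i hi, h0, Polynomial.map_zero])⟩
  · have hinj : Function.Injective (PowerSeries.map (algebraMap L ℂ)) :=
      PowerSeries.map_injective _ (algebraMap L ℂ).injective
    have hD : ∀ i, PowerSeries.map (algebraMap L ℂ) ((PowerSeries.derivative L)^[i] (exL c)) =
        psD^[i] (ePS a) := fun i => by
      induction i with
      | zero =>
        ext n
        simp [exL, ePS, hca]
      | succ i ih =>
        rw [Function.iterate_succ_apply', Function.iterate_succ_apply', ← ih]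
        ext n
        rw [PowerSeries.coeff_map, PowerSeries.coeff_derivative, psD, PowerSeries.coeff_mk, PowerSeries.coeff_map,
          map_mul, mul_comm]
        simp
    refine hinj ?_
    rw [map_zero, map_sum, ← h]
    refine Finset.sum_congr rfl fun i hi => ?_
    rw [map_mul, hD, ← hP i (Nat.le_of_lt_succ (Finset.mem_range.1 hi))]
    congr 1
    ext n
    simp [polyPS]

end Assembly

lemma exists_finiteDimensional_field (K : Subfield ℂ) [FiniteDimensional ℚ K] (hK : ∀ x ∈ K, IsAlgebraic ℚ x)
    {S : Set ℂ} (hS : S.Finite) (hSalg : ∀ x ∈ S, IsAlgebraic ℚ x) :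
    ∃ L : IntermediateField ℚ ℂ, FiniteDimensional ℚ L ∧ S ⊆ L ∧ ∀ x ∈ K, x ∈ L := by
  let b := Module.finBasis ℚ K
  let T : Set ℂ := S ∪ Set.range fun j => (b j : ℂ)
  have hT : T.Finite := hS.union (Set.finite_range _)
  have : Finite T := hT
  refine ⟨IntermediateField.adjoin ℚ T, IntermediateField.finiteDimensional_adjoin fun x hx => ?_,
    Set.subset_union_left.trans (IntermediateField.subset_adjoin ℚ T), fun x hx => ?_⟩
  · rcases hx with hx | ⟨j, rfl⟩
    · exact (hSalg x hx).isIntegral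
    · exact (hK _ (b j).2).isIntegral
  · have h1 := congrArg K.subtype (b.sum_repr ⟨x, hx⟩)
    rw [map_sum] at h1
    have h2 : K.subtype ⟨x, hx⟩ = x := rfl
    rw [← h2, ← h1]
    refine sum_mem fun j _ => ?_
    rw [map_rat_smul]
    exact (IntermediateField.adjoin ℚ T).smul_mem (IntermediateField.subset_adjoin ℚ T (Or.inr ⟨j, rfl⟩))

lemma evalE_mem (K : Subfield ℂ) [FiniteDimensional ℚ K] (hK : ∀ x ∈ K, IsAlgebraic ℚ x)
    {a : ℕ → ℂ} (hE : IsE a) (haK : ∀ n, a n ∈ K) {α : ℂ} (hαK : α ∈ K) (hα : α ≠ 0)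
    (halg : IsAlgebraic ℚ (evalE a α)) : evalE a α ∈ K := by
  obtain ⟨-, ⟨m, p, hpalg, hp, heq⟩, -⟩ := id hE
  let S : Set ℂ := {evalE a α} ∪ ⋃ i ∈ Finset.range (m + 1), ((p i).coeffs : Set ℂ)
  have hS : S.Finite := (Set.finite_singleton _).union
    (Set.Finite.biUnion (Finset.finite_toSet _) fun i _ => Finset.finite_toSet _)
  have hSalg : ∀ x ∈ S, IsAlgebraic ℚ x := by
    rintro x (rfl | hx)
    · exact halg
    · obtain ⟨i, -, hx⟩ := Set.mem_iUnion₂.1 hx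
      obtain ⟨k, -, rfl⟩ := mem_coeffs_iff.1 (Finset.mem_coe.1 hx)
      exact hpalg i k
  obtain ⟨L, hfin, hSL, hKL⟩ := exists_finiteDimensional_field K hK hS hSalg
  have : NumberField L := ⟨⟩
  let c : ℕ → L := fun n => ⟨a n, hKL _ (haK n)⟩
  let β : L := ⟨α, hKL _ hαK⟩
  have hβ : β ≠ 0 := fun h => hα (congrArg Subtype.val h)
  let ξ : L := ⟨evalE a α, hSL (Or.inl rfl)⟩
  have hcoeff : ∀ i, i ≤ m → ∀ k, (p i).coeff k ∈ L := fun i hi k => by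
    by_cases h0 : (p i).coeff k = 0
    · rw [h0]
      exact zero_mem L
    · exact hSL (Or.inr (Set.mem_iUnion₂.2 ⟨i, Finset.mem_range.2 (by omega),
        Finset.mem_coe.2 (coeff_mem_coeffs h0)⟩))
  obtain ⟨P, hP, hPeq⟩ := exists_lifted_equation L (c := c) (fun _ => rfl) hp hcoeff heq
  obtain ⟨Q, hQ, hQeq⟩ := exists_rescaled_equation hβ hP hPeq
  have hresc : PowerSeries.rescale β (exL c) = exL fun n => c n * β ^ n := by
    ext n
    rw [PowerSeries.coeff_rescale, exL, exL, PowerSeries.coeff_mk, PowerSeries.coeff_mk]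
    ring_nf
  rw [hresc] at hQeq
  let W : Submodule ℚ L :=
    { carrier := {x | (x : ℂ) ∈ K}
      add_mem' := fun hx hy => K.add_mem hx hy
      zero_mem' := K.zero_mem
      smul_mem' := fun q x hx => by
        change ((q • x : L) : ℂ) ∈ K
        rw [Algebra.smul_def, eq_ratCast]
        push_cast
        exact K.mul_mem (SubfieldClass.ratCast_mem K q) hx }
  refine mem_of_hasSum (algebraMap L ℂ) W (ξ := ξ) (fun n => ?_)
    ((geomL_of_isE L (c := c) (fun _ => rfl) hE).mul_pow β) hQ hQeq ?_
  · exact K.mul_mem (haK n) (K.pow_mem hαK n)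
  · change _ = evalE a α
    refine tsum_congr fun n => ?_
    rw [map_div₀, map_mul, map_pow, map_natCast]
    change a n * α ^ n / _ = _
    ring

end EFun

/-- If `K` is a number field, `f` an E-function with coefficients in `K`
and `α ∈ K`, then either `f(α) ∈ K` or `f(α)` is transcendental. -/
theorem E_value_dichotomy
    (K : Subfield ℂ) [FiniteDimensional ℚ K] (hKalg : ∀ x ∈ K, IsAlgebraic ℚ x)
    (a : ℕ → ℂ) (hE : IsE a) (haK : ∀ n, a n ∈ K)
    (α : ℂ) (hαK : α ∈ K) :
    evalE a α ∈ K ∨ Transcendental ℚ (evalE a α) := by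
  by_cases halg : IsAlgebraic ℚ (evalE a α)
  · refine Or.inl ?_
    by_cases hα : α = 0
    · have h0 : evalE a α = a 0 := by
        rw [evalE, tsum_eq_single 0 fun n hn => by rw [hα, zero_pow hn, mul_zero]]
        simp
      rw [h0]
      exact haK 0
    · exact EFun.evalE_mem K hKalg hE haK hαK hα halg
  · exact Or.inr halg
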